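/- Under hypotheses (H1)–(H3), for every λ > 0 and every f ∈ L¹(ℝ^d) there exists a distributional solution u ∈ L¹(ℝ^d) of the resolvent equation u − λ Σ_{i,j=1}^d ∂_i∂_j(a_ij(x,u)u) + λ div(b(x,u)u) = f, i.e., for every φ ∈ C_c^∞(ℝ^d): ∫ u φ dx − λ Σ_{i,j=1}^d ∫ a_ij(x,u(x)) u(x) ∂_i∂_jφ(x) dx − λ ∫ u(x) b(x,u(x))·∇φ(x) dx = ∫ f φ dx. -/

import Mathlib

open MeasureTheory Filter

/-- The `i`-th partial derivative of `φ : ℝ^d → ℝ`. -/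
noncomputable def pd {d : ℕ} (i : Fin d) (φ : (Fin d → ℝ) → ℝ) (x : Fin d → ℝ) : ℝ :=
  fderiv ℝ φ x (Pi.single i 1)

/-- The second partial derivative `∂_i ∂_j φ`. -/
noncomputable def pd2 {d : ℕ} (i j : Fin d) (φ : (Fin d → ℝ) → ℝ) (x : Fin d → ℝ) : ℝ :=
  pd i (pd j φ) x

/-- `u ∈ L¹(ℝ^d)` is a distributional solution of the resolvent equation
`u - λ Σ_{i,j} ∂_i∂_j(a_ij(x,u)u) + λ div(b(x,u)u) = f`. -/
def IsWeakResolventSol {d : ℕ} (a : Fin d → Fin d → (Fin d → ℝ) → ℝ → ℝ)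
    (b : Fin d → (Fin d → ℝ) → ℝ → ℝ) (lam : ℝ) (f u : (Fin d → ℝ) → ℝ) : Prop :=
  Integrable u ∧
  ∀ φ : (Fin d → ℝ) → ℝ, ContDiff ℝ (⊤ : ℕ∞) φ → HasCompactSupport φ →
    (∫ x, u x * φ x) - lam * ∑ i, ∑ j, (∫ x, a i j x (u x) * u x * pd2 i j φ x)
      - lam * (∫ x, u x * ∑ i, b i x (u x) * pd i φ x) = ∫ x, f x * φ x



open MeasureTheory Filter

/-- Admissible nonlinear rate functions. -/
structure GoodV {Ω E : Type*} [MeasurableSpace Ω] [MeasurableSpace E] (L : ℝ)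
    (V : Ω → E → ℝ → ℝ) : Prop where
  meas : Measurable (fun p : Ω × E × ℝ => V p.1 p.2.1 p.2.2)
  zero : ∀ ω y, V ω y 0 = 0
  mono : ∀ ω y, Monotone (V ω y)
  lip : ∀ ω y r s, |V ω y r - V ω y s| ≤ L * |r - s|

/-- The flux along the jump `h ω`. -/
def flux {Ω E : Type*} [Add E] (Vp Vm : Ω → E → ℝ → ℝ) (h : Ω → E) (u : E → ℝ)
    (p : Ω × E) : ℝ :=
  Vp p.1 p.2 (u p.2) - Vm p.1 p.2 (u (p.2 + h p.1))

section Solve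

variable {d : ℕ} {Ω : Type*} [MeasurableSpace Ω] {ν : Measure Ω} [IsFiniteMeasure ν]

theorem shift_mp {h : Ω → (Fin d → ℝ)} (hh : Measurable h) :
    MeasurePreserving (fun p : Ω × (Fin d → ℝ) => (p.1, p.2 + h p.1))
      (ν.prod volume) (ν.prod volume) := by
  refine (MeasurePreserving.id ν).skew_product (g := fun ω x => x + h ω) ?_ ?_
  · fun_prop
  · refine ae_of_all _ (fun ω => ?_)
    exact map_add_right_eq_self volume (h ω)

theorem integrable_shift {h : Ω → (Fin d → ℝ)} (hh : Measurable h)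
    {g : Ω × (Fin d → ℝ) → ℝ} (hg : Integrable g (ν.prod volume)) :
    Integrable (fun p : Ω × (Fin d → ℝ) => g (p.1, p.2 + h p.1)) (ν.prod volume) :=
  (shift_mp (ν := ν) hh).integrable_comp_of_integrable hg

theorem integral_shift {h : Ω → (Fin d → ℝ)} (hh : Measurable h)
    {g : Ω × (Fin d → ℝ) → ℝ} (hg : Integrable g (ν.prod volume)) :
    ∫ p : Ω × (Fin d → ℝ), g (p.1, p.2 + h p.1) ∂(ν.prod volume) = ∫ p, g p ∂(ν.prod volume) := by
  have hm := shift_mp (ν := ν) hh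
  have : AEStronglyMeasurable g (Measure.map
    (fun p : Ω × (Fin d → ℝ) => (p.1, p.2 + h p.1)) (ν.prod volume)) := by
    rw [hm.map_eq]; exact hg.1
  rw [← integral_map hm.measurable.aemeasurable this, hm.map_eq]

theorem integral_shift_neg {h : Ω → (Fin d → ℝ)} (hh : Measurable h)
    {g : Ω × (Fin d → ℝ) → ℝ} (hg : Integrable g (ν.prod volume)) :
    ∫ p : Ω × (Fin d → ℝ), g (p.1, p.2 - h p.1) ∂(ν.prod volume) = ∫ p, g p ∂(ν.prod volume) := by
  simpa [sub_eq_add_neg] using integral_shift (ν := ν) (h := fun ω => - h ω) hh.neg hg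

theorem integrable_shift_neg {h : Ω → (Fin d → ℝ)} (hh : Measurable h)
    {g : Ω × (Fin d → ℝ) → ℝ} (hg : Integrable g (ν.prod volume)) :
    Integrable (fun p : Ω × (Fin d → ℝ) => g (p.1, p.2 - h p.1)) (ν.prod volume) := by
  simpa [sub_eq_add_neg] using integrable_shift (ν := ν) (h := fun ω => - h ω) hh.neg hg

theorem integrable_snd {u : (Fin d → ℝ) → ℝ} (hu : Integrable u) :
    Integrable (fun p : Ω × (Fin d → ℝ) => u p.2) (ν.prod volume) :=
  hu.comp_snd ν

/-- `V(ω, y, u(y))` is measurable. -/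
theorem GoodV.meas_comp {L : ℝ} {V : Ω → (Fin d → ℝ) → ℝ → ℝ} (hV : GoodV L V)
    {k : Ω × (Fin d → ℝ) → (Fin d → ℝ)} (hk : Measurable k)
    {v : Ω × (Fin d → ℝ) → ℝ} (hv : Measurable v) :
    Measurable (fun p : Ω × (Fin d → ℝ) => V p.1 (k p) (v p)) :=
  hV.meas.comp (measurable_fst.prodMk (hk.prodMk hv))

theorem GoodV.abs_le {L : ℝ} {V : Ω → (Fin d → ℝ) → ℝ → ℝ} (hV : GoodV L V) (ω y r) :
    |V ω y r| ≤ L * |r| := by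
  have := hV.lip ω y r 0
  simpa [hV.zero] using this

theorem GoodV.integrable_comp {L : ℝ} {V : Ω → (Fin d → ℝ) → ℝ → ℝ} (hV : GoodV L V)
    {k : Ω × (Fin d → ℝ) → (Fin d → ℝ)} (hk : Measurable k)
    {v : Ω × (Fin d → ℝ) → ℝ} (hv : Measurable v) (hi : Integrable v (ν.prod volume)) :
    Integrable (fun p : Ω × (Fin d → ℝ) => V p.1 (k p) (v p)) (ν.prod volume) := by
  refine (hi.abs.const_mul L).mono' (hV.meas_comp hk hv).aestronglyMeasurable ?_
  exact ae_of_all _ (fun p => hV.abs_le _ _ _)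

theorem integrable_flux {L : ℝ} {Vp Vm : Ω → (Fin d → ℝ) → ℝ → ℝ} (hp : GoodV L Vp)
    (hm : GoodV L Vm) {h : Ω → (Fin d → ℝ)} (hh : Measurable h) {u : (Fin d → ℝ) → ℝ}
    (hu : Measurable u) (hui : Integrable u) :
    Integrable (flux Vp Vm h u) (ν.prod volume) := by
  have h1 : Integrable (fun p : Ω × (Fin d → ℝ) => u p.2) (ν.prod volume) := integrable_snd hui
  have h2 := integrable_shift hh h1
  exact (hp.integrable_comp measurable_snd (by fun_prop) h1).sub
    (hm.integrable_comp measurable_snd (by fun_prop) h2)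

theorem measurable_flux {L : ℝ} {Vp Vm : Ω → (Fin d → ℝ) → ℝ → ℝ} (hp : GoodV L Vp)
    (hm : GoodV L Vm) {h : Ω → (Fin d → ℝ)} (hh : Measurable h) {u : (Fin d → ℝ) → ℝ}
    (hu : Measurable u) :
    Measurable (flux Vp Vm h u) := 
  (hp.meas_comp measurable_snd (by fun_prop)).sub
    (hm.meas_comp measurable_snd (by fun_prop))

/-- The nonlocal operator at the level of the product space. -/
def gflux (Vp Vm : Ω → (Fin d → ℝ) → ℝ → ℝ) (h : Ω → (Fin d → ℝ)) (u : (Fin d → ℝ) → ℝ)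
    (p : Ω × (Fin d → ℝ)) : ℝ :=
  flux Vp Vm h u (p.1, p.2 - h p.1) - flux Vp Vm h u p

theorem integrable_gflux {L : ℝ} {Vp Vm : Ω → (Fin d → ℝ) → ℝ → ℝ} (hp : GoodV L Vp)
    (hm : GoodV L Vm) {h : Ω → (Fin d → ℝ)} (hh : Measurable h) {u : (Fin d → ℝ) → ℝ}
    (hu : Measurable u) (hui : Integrable u) :
    Integrable (gflux Vp Vm h u) (ν.prod volume) :=
  (integrable_shift_neg hh (integrable_flux hp hm hh hu hui)).sub (integrable_flux hp hm hh hu hui)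

theorem mono_lip_aux {L : ℝ} {V : ℝ → ℝ} (hmono : Monotone V)
    (hlip : ∀ r s, |V r - V s| ≤ L * |r - s|) (r s : ℝ) :
    |L * (r - s) - (V r - V s)| = L * |r - s| - |V r - V s| := by
  rcases le_total s r with h | h
  · have h1 := hmono h
    have h2 := hlip r s
    rw [abs_of_nonneg (sub_nonneg.2 h), abs_of_nonneg (sub_nonneg.2 h1)] at *
    rw [abs_of_nonneg (by linarith)]
  · have h1 := hmono h
    have h2 := hlip r s
    rw [abs_of_nonpos (sub_nonpos.2 h), abs_of_nonpos (sub_nonpos.2 h1)] at *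
    rw [abs_of_nonpos (by linarith)]
    ring

theorem contraction_est {L : ℝ} {Vp Vm : Ω → (Fin d → ℝ) → ℝ → ℝ} (hp : GoodV L Vp)
    (hm : GoodV L Vm) {h : Ω → (Fin d → ℝ)} (hh : Measurable h) {u v : (Fin d → ℝ) → ℝ}
    (hu : Measurable u) (hui : Integrable u) (hv : Measurable v) (hvi : Integrable v) :
    ∫ p : Ω × (Fin d → ℝ), |2 * L * (u p.2 - v p.2) + (gflux Vp Vm h u p - gflux Vp Vm h v p)|
      ∂(ν.prod volume) ≤ 2 * L * ν.real Set.univ * ∫ x, |u x - v x| := by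
  set dc : Ω × (Fin d → ℝ) → ℝ := fun p => |Vp p.1 p.2 (u p.2) - Vp p.1 p.2 (v p.2)| with hdc
  set de : Ω × (Fin d → ℝ) → ℝ := fun p =>
    |Vm p.1 p.2 (u (p.2 + h p.1)) - Vm p.1 p.2 (v (p.2 + h p.1))| with hde
  have iu : Integrable (fun p : Ω × (Fin d → ℝ) => u p.2) (ν.prod volume) := integrable_snd hui
  have iv : Integrable (fun p : Ω × (Fin d → ℝ) => v p.2) (ν.prod volume) := integrable_snd hvi
  have idc : Integrable dc (ν.prod volume) :=
    ((hp.integrable_comp measurable_snd (by fun_prop) iu).sub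
      (hp.integrable_comp measurable_snd (by fun_prop) iv)).abs
  have ide : Integrable de (ν.prod volume) :=
    ((hm.integrable_comp measurable_snd (by fun_prop) (integrable_shift hh iu)).sub
      (hm.integrable_comp measurable_snd (by fun_prop) (integrable_shift hh iv))).abs
  have idc' := integrable_shift_neg hh idc
  have ide' := integrable_shift_neg hh ide
  have id0 : Integrable (fun p : Ω × (Fin d → ℝ) => 2 * L * |u p.2 - v p.2|) (ν.prod volume) :=
    ((iu.sub iv).abs).const_mul _
  have key : ∀ p : Ω × (Fin d → ℝ),
      |2 * L * (u p.2 - v p.2) + (gflux Vp Vm h u p - gflux Vp Vm h v p)| ≤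
      2 * L * |u p.2 - v p.2| + ((dc (p.1, p.2 - h p.1) - dc p) + (de p - de (p.1, p.2 - h p.1))) := by
    rintro ⟨ω, x⟩
    have e1 := mono_lip_aux (hp.mono ω x) (hp.lip ω x) (u x) (v x)
    have e2 := mono_lip_aux (hm.mono ω (x - h ω)) (hm.lip ω (x - h ω)) (u x) (v x)
    simp only [hdc, hde, gflux, flux, sub_add_cancel]
    set A := Vp ω x (u x) - Vp ω x (v x)
    set B := Vm ω (x - h ω) (u x) - Vm ω (x - h ω) (v x)
    set C := Vp ω (x - h ω) (u (x - h ω)) - Vp ω (x - h ω) (v (x - h ω))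
    set D := Vm ω x (u (x + h ω)) - Vm ω x (v (x + h ω))
    have : 2 * L * (u x - v x) + (Vp ω (x - h ω) (u (x - h ω)) - Vm ω (x - h ω) (u x) -
          (Vp ω x (u x) - Vm ω x (u (x + h ω))) -
        (Vp ω (x - h ω) (v (x - h ω)) - Vm ω (x - h ω) (v x) -
          (Vp ω x (v x) - Vm ω x (v (x + h ω))))) =
        ((L * (u x - v x) - A) + (L * (u x - v x) - B)) + (C + D) := by
      simp only [A, B, C, D]; ring
    rw [this]
    have t1 := abs_add_le ((L * (u x - v x) - A) + (L * (u x - v x) - B)) (C + D)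
    have t2 := abs_add_le (L * (u x - v x) - A) (L * (u x - v x) - B)
    have t3 := abs_add_le C D
    linarith
  have hint1 : Integrable (fun p : Ω × (Fin d → ℝ) =>
      |2 * L * (u p.2 - v p.2) + (gflux Vp Vm h u p - gflux Vp Vm h v p)|) (ν.prod volume) :=
    (((iu.sub iv).const_mul _).add ((integrable_gflux hp hm hh hu hui).sub
      (integrable_gflux hp hm hh hv hvi))).abs
  have step := integral_mono hint1 (id0.add ((idc'.sub idc).add (ide.sub ide'))) key
  refine step.trans (le_of_eq ?_)
  have e1 : ∫ p : Ω × (Fin d → ℝ), 2 * L * |u p.2 - v p.2| ∂(ν.prod volume) =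
      2 * L * ν.real Set.univ * ∫ x, |u x - v x| := by
    rw [integral_const_mul, integral_fun_snd (fun x => |u x - v x|)]
    simp [mul_assoc]
  have e2 := integral_shift_neg hh idc
  have e3 := integral_shift_neg hh ide
  rw [integral_add' id0 ((idc'.sub idc).add (ide.sub ide')), e1,
    integral_add' (idc'.sub idc) (ide.sub ide'), integral_sub' idc' idc, integral_sub' ide ide', e2, e3]
  ring

end Solve


open MeasureTheory Filter

section Solve2

variable {d : ℕ} {Ω : Type*} [MeasurableSpace Ω] {ν : Measure Ω} [IsFiniteMeasure ν]

theorem step_est {L : ℝ} {Vp Vm : Ω → (Fin d → ℝ) → ℝ → ℝ} (hp : GoodV L Vp)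
    (hm : GoodV L Vm) {h : Ω → (Fin d → ℝ)} (hh : Measurable h) {u v : (Fin d → ℝ) → ℝ}
    (hu : Measurable u) (hui : Integrable u) (hv : Measurable v) (hvi : Integrable v) :
    ∫ x, |2 * L * ν.real Set.univ * (u x - v x) +
      ((∫ ω, gflux Vp Vm h u (ω, x) ∂ν) - ∫ ω, gflux Vp Vm h v (ω, x) ∂ν)|
      ≤ 2 * L * ν.real Set.univ * ∫ x, |u x - v x| := by
  refine le_trans ?_ (contraction_est (ν := ν) hp hm hh hu hui hv hvi)
  have iu : Integrable (fun p : Ω × (Fin d → ℝ) => u p.2) (ν.prod volume) := integrable_snd hui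
  have iv : Integrable (fun p : Ω × (Fin d → ℝ) => v p.2) (ν.prod volume) := integrable_snd hvi
  have igu := integrable_gflux (ν := ν) hp hm hh hu hui
  have igv := integrable_gflux (ν := ν) hp hm hh hv hvi
  have hint0 : Integrable (fun p : Ω × (Fin d → ℝ) =>
      2 * L * (u p.2 - v p.2) + (gflux Vp Vm h u p - gflux Vp Vm h v p)) (ν.prod volume) :=
    (((iu.sub iv).const_mul _).add (igu.sub igv))
  rw [integral_prod_symm _ hint0.abs]
  refine integral_mono_ae ?_ hint0.abs.integral_prod_right ?_
  · exact ((((hui.sub hvi).const_mul _).add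
      (igu.integral_prod_right.sub igv.integral_prod_right))).abs
  · filter_upwards [igu.prod_left_ae, igv.prod_left_ae] with x hx1 hx2
    refine le_trans (le_of_eq ?_) (abs_integral_le_integral_abs (μ := ν))
    congr 1
    have hx12 : Integrable (fun ω => gflux Vp Vm h u (ω, x) - gflux Vp Vm h v (ω, x)) ν := hx1.sub hx2
    rw [integral_add (integrable_const _) hx12, integral_sub hx1 hx2, integral_const]
    simp; ring

theorem solve {L : ℝ} (hL : 0 ≤ L) {Vp Vm : Ω → (Fin d → ℝ) → ℝ → ℝ} (hp : GoodV L Vp)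
    (hm : GoodV L Vm) {h : Ω → (Fin d → ℝ)} (hh : Measurable h) {f : (Fin d → ℝ) → ℝ}
    (hf : Integrable f) :
    ∃ u : (Fin d → ℝ) → ℝ, Measurable u ∧ Integrable u ∧ ∫ x, |u x| ≤ ∫ x, |f x| ∧
      ∀ φ : (Fin d → ℝ) → ℝ, Measurable φ → (∃ C, ∀ x, |φ x| ≤ C) →
        ∫ x, u x * φ x = (∫ x, f x * φ x) + ∫ p : Ω × (Fin d → ℝ),
          flux Vp Vm h u p * (φ (p.2 + h p.1) - φ p.2) ∂(ν.prod volume) := by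
  set Λ : ℝ := 2 * L * ν.real Set.univ with hΛ
  have hΛ0 : 0 ≤ Λ := by positivity
  have hΛ1 : 0 < 1 + Λ := by linarith
  let G : ((Fin d → ℝ) → ℝ) → (Fin d → ℝ) → ℝ := fun u x => ∫ ω, gflux Vp Vm h u (ω, x) ∂ν
  let Φ : ((Fin d → ℝ) → ℝ) → (Fin d → ℝ) → ℝ := fun u x => (1 + Λ)⁻¹ * (f x + (Λ * u x + G u x))
  have hGi : ∀ u : (Fin d → ℝ) → ℝ, Measurable u → Integrable u → Integrable (G u) :=
    fun u hu hui => (integrable_gflux (ν := ν) hp hm hh hu hui).integral_prod_right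
  have hΦi : ∀ u : (Fin d → ℝ) → ℝ, Measurable u → Integrable u → Integrable (Φ u) :=
    fun u hu hui => (hf.add ((hui.const_mul Λ).add (hGi u hu hui))).const_mul _
  have lm : ∀ u : Lp ℝ 1 (volume : Measure (Fin d → ℝ)), Measurable u :=
    fun u => (Lp.stronglyMeasurable u).measurable
  have li : ∀ u : Lp ℝ 1 (volume : Measure (Fin d → ℝ)), Integrable u :=
    fun u => L1.integrable_coeFn u
  have hΦest : ∀ u v : (Fin d → ℝ) → ℝ, Measurable u → Integrable u → Measurable v → Integrable v →
      ∫ x, |Φ u x - Φ v x| ≤ (1 + Λ)⁻¹ * Λ * ∫ x, |u x - v x| := by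
    intro u v hu hui hv hvi
    have := step_est (ν := ν) hp hm hh hu hui hv hvi
    rw [← hΛ] at this
    have e : ∀ x, |Φ u x - Φ v x| = (1 + Λ)⁻¹ * |Λ * (u x - v x) + (G u x - G v x)| := by
      intro x
      have : Φ u x - Φ v x = (1 + Λ)⁻¹ * (Λ * (u x - v x) + (G u x - G v x)) := by
        simp only [Φ]; ring
      rw [this, abs_mul, abs_of_pos (inv_pos.2 hΛ1)]
    simp_rw [e]
    rw [integral_const_mul, mul_assoc]
    exact mul_le_mul_of_nonneg_left this (inv_pos.2 hΛ1).le
  let F : Lp ℝ 1 (volume : Measure (Fin d → ℝ)) → Lp ℝ 1 (volume : Measure (Fin d → ℝ)) :=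
    fun u => (hΦi u (lm u) (li u)).toL1 (Φ u)
  have hdist : ∀ u v : Lp ℝ 1 (volume : Measure (Fin d → ℝ)), dist u v = ∫ x, |u x - v x| := by
    intro u v
    rw [dist_eq_norm, L1.norm_eq_integral_norm]
    refine integral_congr_ae ?_
    filter_upwards [Lp.coeFn_sub u v] with x hx
    rw [hx]; rfl
  have hK1 : (1 + Λ)⁻¹ * Λ < 1 := by
    rw [inv_mul_lt_iff₀ hΛ1]; linarith
  have hK0 : 0 ≤ (1 + Λ)⁻¹ * Λ := by positivity
  have hcon : ContractingWith ⟨(1 + Λ)⁻¹ * Λ, hK0⟩ F := by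
    refine ⟨by exact_mod_cast hK1, LipschitzWith.of_dist_le_mul ?_⟩
    intro u v
    rw [hdist, hdist]
    refine le_trans (le_of_eq ?_) (hΦest u v (lm u) (li u) (lm v) (li v))
    refine integral_congr_ae ?_
    filter_upwards [(hΦi u (lm u) (li u)).coeFn_toL1, (hΦi v (lm v) (li v)).coeFn_toL1] with x h1 h2
    simp only [F]
    rw [h1, h2]
  let u := hcon.fixedPoint
  have hfix : F u = u := hcon.fixedPoint_isFixedPt
  have hae : ∀ᵐ x, u x = Φ u x := by
    have h1 := (hΦi u (lm u) (li u)).coeFn_toL1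
    filter_upwards [h1] with x hx
    have : F u x = Φ u x := hx
    rwa [hfix] at this
  have hae2 : ∀ᵐ x, u x = f x + G u x := by
    filter_upwards [hae] with x hx
    simp only [Φ] at hx
    rw [eq_inv_mul_iff_mul_eq₀ hΛ1.ne'] at hx
    linarith
  refine ⟨u, lm u, li u, ?_, ?_⟩
  · have h0 := hΦest u 0 (lm u) (li u) measurable_const (integrable_zero _ _ _)
    have hΦ0 : ∀ x, Φ 0 x = (1 + Λ)⁻¹ * f x := by
      intro x
      simp [Φ, G, gflux, flux, hp.zero, hm.zero]
    have h1 : ∫ x, |u x| ≤ ∫ x, (|Φ u x - Φ 0 x| + (1 + Λ)⁻¹ * |f x|) := by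
      refine integral_mono_ae (li u).abs (((hΦi u (lm u) (li u)).sub
        (hΦi 0 measurable_const (integrable_zero _ _ _))).abs.add (hf.abs.const_mul _)) ?_
      filter_upwards [hae] with x hx
      rw [hΦ0]
      have : |u x| = |(Φ u x - (1 + Λ)⁻¹ * f x) + (1 + Λ)⁻¹ * f x| := by rw [hx]; congr 1; ring
      rw [this]
      refine (abs_add_le _ _).trans (le_of_eq ?_)
      rw [abs_mul _ (f x), abs_of_pos (inv_pos.2 hΛ1)]
    have ii : Integrable (fun x => |Φ u x - Φ 0 x|) := ((hΦi u (lm u) (li u)).sub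
        (hΦi 0 measurable_const (integrable_zero _ _ _))).abs
    rw [integral_add ii (hf.abs.const_mul _), integral_const_mul] at h1
    simp only [Pi.zero_apply, sub_zero] at h0
    have h2 : ∫ x, |u x| ≤ (1 + Λ)⁻¹ * (Λ * (∫ x, |u x|) + ∫ x, |f x|) := by
      calc _ ≤ _ := h1
        _ ≤ _ := add_le_add_left h0 _
        _ = _ := by ring
    rw [le_inv_mul_iff₀ hΛ1] at h2
    linarith
  · rintro φ hφ ⟨C, hC⟩
    have ig := integrable_gflux (ν := ν) hp hm hh (lm u) (li u)
    have iF := integrable_flux (ν := ν) hp hm hh (lm u) (li u)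
    have iFs := integrable_shift_neg hh iF
    have hb0 : ∀ {g : (Fin d → ℝ) → ℝ},
        Integrable g → Integrable (fun x => g x * φ x) := by
      intro g hg
      exact hg.mul_bdd (c := C) hφ.aestronglyMeasurable (ae_of_all _ (fun x => hC _))
    have hb : ∀ {g : Ω × (Fin d → ℝ) → ℝ} {k : Ω × (Fin d → ℝ) → (Fin d → ℝ)},
        Measurable k → Integrable g (ν.prod volume) →
          Integrable (fun x => g x * φ (k x)) (ν.prod volume) := by
      intro g k hk hg
      exact hg.mul_bdd (c := C) (hφ.comp hk).aestronglyMeasurable (ae_of_all _ (fun x => hC _))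
    have e1 : ∫ x, u x * φ x = (∫ x, f x * φ x) + ∫ x, G u x * φ x := by
      rw [← integral_add (hb0 hf) (hb0 (hGi u (lm u) (li u)))]
      refine integral_congr_ae ?_
      filter_upwards [hae2] with x hx
      rw [← add_mul, ← hx]
    rw [e1]
    congr 1
    have e2 : ∫ x, G u x * φ x = ∫ p : Ω × (Fin d → ℝ), gflux Vp Vm h u p * φ p.2 ∂(ν.prod volume) := by
      rw [integral_prod_symm _ (hb measurable_snd ig)]
      refine integral_congr_ae (ae_of_all _ fun x => ?_)
      simp only [G]
      rw [integral_mul_const]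
    rw [e2]
    have j1 := hb (k := fun p : Ω × (Fin d → ℝ) => p.2) measurable_snd iF
    have j2 := hb (k := fun p : Ω × (Fin d → ℝ) => p.2 + h p.1) (by fun_prop) iF
    have j3 := integrable_shift_neg hh j2
    have e3 := integral_shift_neg hh j2
    simp only [sub_add_cancel] at e3 j3
    simp only [gflux, sub_mul, mul_sub]
    rw [integral_sub j3 j1, integral_sub j2 j1, e3]

end Solve2


open MeasureTheory Filter

/-- Test nonlinearities. -/
structure GoodPsi (δ : ℝ) (ψ : ℝ → ℝ) : Prop where
  mono : Monotone ψ
  zero : ψ 0 = 0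
  bdd : ∀ r, |ψ r| ≤ 1
  nn : 0 ≤ δ
  key : ∀ a b, |b - a| ≤ (|a| + |b|) / 2 → (|a| + |b|) * |ψ b - ψ a| ≤ δ * |b - a|

/-- Odd extension. -/
noncomputable def oddE (θ : ℝ → ℝ) (r : ℝ) : ℝ := if 0 ≤ r then θ r else - θ (-r)

structure GoodTheta (δ : ℝ) (θ : ℝ → ℝ) : Prop where
  zero : θ 0 = 0
  nn : 0 ≤ δ
  mono : ∀ a b, 0 ≤ a → a ≤ b → θ a ≤ θ b
  le_one : ∀ a, 0 ≤ a → θ a ≤ 1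
  key : ∀ a b, 0 ≤ a → a ≤ b → (1 + a) * (θ b - θ a) ≤ δ * (b - a)

theorem GoodTheta.nonneg {δ : ℝ} {θ : ℝ → ℝ} (h : GoodTheta δ θ) {a : ℝ} (ha : 0 ≤ a) : 0 ≤ θ a := by
  have := h.mono 0 a le_rfl ha
  rwa [h.zero] at this

theorem oddE_of_nonneg {θ : ℝ → ℝ} {r : ℝ} (hr : 0 ≤ r) : oddE θ r = θ r := by simp [oddE, hr]

theorem oddE_of_nonpos {θ : ℝ → ℝ} (h0 : θ 0 = 0) {r : ℝ} (hr : r ≤ 0) : oddE θ r = - θ (-r) := by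
  rcases hr.lt_or_eq with h | h
  · simp [oddE, not_le.2 h]
  · subst h; simp [oddE, h0]

theorem GoodTheta.abs_oddE {δ : ℝ} {θ : ℝ → ℝ} (h : GoodTheta δ θ) (r : ℝ) : |oddE θ r| = θ |r| := by
  rcases le_total 0 r with hr | hr
  · rw [oddE_of_nonneg hr, abs_of_nonneg (h.nonneg hr), abs_of_nonneg hr]
  · rw [oddE_of_nonpos h.zero hr, abs_neg, abs_of_nonneg (h.nonneg (by linarith)), abs_of_nonpos hr]

theorem GoodTheta.mul_oddE {δ : ℝ} {θ : ℝ → ℝ} (h : GoodTheta δ θ) (r : ℝ) :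
    r * oddE θ r = |r| * θ |r| := by
  rcases le_total 0 r with hr | hr
  · rw [oddE_of_nonneg hr, abs_of_nonneg hr]
  · rw [oddE_of_nonpos h.zero hr, abs_of_nonpos hr]; ring

theorem GoodTheta.goodPsi {δ : ℝ} {θ : ℝ → ℝ} (h : GoodTheta δ θ) : GoodPsi (4 * δ) (oddE θ) where
  mono := by
    intro a b hab
    rcases le_total 0 a with ha | ha
    · rw [oddE_of_nonneg ha, oddE_of_nonneg (ha.trans hab)]; exact h.mono _ _ ha hab
    · rw [oddE_of_nonpos h.zero ha]
      have h1 := h.nonneg (a := -a) (by linarith)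
      rcases le_total 0 b with hb | hb
      · rw [oddE_of_nonneg hb]; have := h.nonneg hb; linarith
      · rw [oddE_of_nonpos h.zero hb]
        have := h.mono (-b) (-a) (by linarith) (by linarith)
        linarith
  zero := by rw [oddE_of_nonneg le_rfl, h.zero]
  bdd r := by rw [h.abs_oddE]; exact h.le_one _ (abs_nonneg _)
  nn := by have := h.nn; linarith
  key := by
    have main : ∀ a b, 0 ≤ a → a ≤ b → b - a ≤ (a + b) / 2 →
        (a + b) * (θ b - θ a) ≤ 4 * δ * (b - a) := by
      intro a b ha hab hc
      have h1 := h.key a b ha hab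
      have h2 := h.mono a b ha hab
      nlinarith
    have main2 : ∀ a b, a ≤ b → |b - a| ≤ (|a| + |b|) / 2 →
        (|a| + |b|) * |oddE θ b - oddE θ a| ≤ 4 * δ * |b - a| := by
      intro a b hab hc
      rcases le_total 0 a with ha | ha
      · have hb := ha.trans hab
        rw [oddE_of_nonneg ha, oddE_of_nonneg hb, abs_of_nonneg ha, abs_of_nonneg hb,
          abs_of_nonneg (sub_nonneg.2 hab), abs_of_nonneg (sub_nonneg.2 (h.mono _ _ ha hab))] at *
        exact main a b ha hab hc
      · rcases le_total 0 b with hb | hb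
        · rw [abs_of_nonpos ha, abs_of_nonneg hb, abs_of_nonneg (sub_nonneg.2 hab)] at *
          have : a = 0 := by linarith
          have : b = 0 := by linarith
          subst a; subst b; simp
        · have := main (-b) (-a) (by linarith) (by linarith)
          have h3 := h.mono (-b) (-a) (by linarith) (by linarith)
          rw [abs_of_nonpos ha, abs_of_nonpos hb, abs_of_nonneg (sub_nonneg.2 hab)] at *
          rw [oddE_of_nonpos h.zero ha, oddE_of_nonpos h.zero hb, abs_of_nonneg (by linarith)]
          have h4 := this (by linarith)
          linarith
    intro a b hc
    rcases le_total a b with hab | hab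
    · exact main2 a b hab hc
    · have := main2 b a hab (by rw [abs_sub_comm, add_comm]; exact hc)
      rw [abs_sub_comm b a, abs_sub_comm (oddE θ b), add_comm]; exact this

noncomputable def th1 (r : ℝ) : ℝ := r / (1 + r)

noncomputable def thl (δ r : ℝ) : ℝ := min 1 (δ * Real.log (1 + r))

theorem good_th1 : GoodTheta 1 th1 where
  zero := by simp [th1]
  nn := zero_le_one
  mono a b ha hab := by
    unfold th1
    rw [div_le_div_iff₀ (by linarith) (by linarith)]; nlinarith
  le_one a ha := by
    unfold th1
    rw [div_le_one (by linarith)]; linarith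
  key a b ha hab := by
    unfold th1
    have h1 : (0:ℝ) < 1 + a := by linarith
    have h2 : (0:ℝ) < 1 + b := by linarith
    have : (1 + a) * (b / (1 + b) - a / (1 + a)) = (b - a) / (1 + b) := by
      field_simp; ring
    rw [this, one_mul]
    exact div_le_self (by linarith) (by linarith)

theorem good_thl {δ : ℝ} (hδ : 0 ≤ δ) : GoodTheta δ (thl δ) where
  zero := by simp [thl]
  nn := hδ
  mono a b ha hab := by
    unfold thl
    refine min_le_min le_rfl (mul_le_mul_of_nonneg_left (Real.log_le_log (by linarith) (by linarith)) hδ)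
  le_one a ha := min_le_left _ _
  key a b ha hab := by
    have h1 : (0:ℝ) < 1 + a := by linarith
    have h2 : (0:ℝ) < 1 + b := by linarith
    have h3 : Real.log (1 + b) - Real.log (1 + a) ≤ (b - a) / (1 + a) := by
      rw [← Real.log_div h2.ne' h1.ne']
      refine (Real.log_le_sub_one_of_pos (by positivity)).trans (le_of_eq ?_)
      field_simp; ring
    have h0 : Real.log (1 + a) ≤ Real.log (1 + b) := Real.log_le_log h1 (by linarith)
    have h4 : thl δ b - thl δ a ≤ δ * (Real.log (1 + b) - Real.log (1 + a)) := by
      unfold thl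
      have h5 := mul_le_mul_of_nonneg_left h0 hδ
      rcases le_total 1 (δ * Real.log (1 + a)) with hc | hc
      · rw [min_eq_left hc, min_eq_left (hc.trans h5)]; linarith
      · rw [min_eq_right hc]
        have := min_le_right 1 (δ * Real.log (1 + b))
        linarith
    rw [le_div_iff₀ h1] at h3
    calc (1 + a) * (thl δ b - thl δ a) ≤ (1 + a) * (δ * (Real.log (1 + b) - Real.log (1 + a))) :=
          mul_le_mul_of_nonneg_left h4 h1.le
      _ = δ * ((Real.log (1 + b) - Real.log (1 + a)) * (1 + a)) := by ring
      _ ≤ _ := mul_le_mul_of_nonneg_left h3 hδ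

/-- The pointwise absorption inequality. -/
theorem absorb {δ ε C : ℝ} {ψ : ℝ → ℝ} (h : GoodPsi δ ψ) (hε : 0 ≤ ε) (hC : 0 ≤ C)
    (hεC : 4 * (ε * C) ≤ 1) (a b : ℝ) :
    ε * C * ((|a| + |b|) * |ψ b - ψ a|) ≤ 1 / 2 * ((b - a) * (ψ b - ψ a))
      + 2 * ε ^ 2 * C ^ 2 * δ * (|a| + |b|) := by
  have hp : (b - a) * (ψ b - ψ a) = |b - a| * |ψ b - ψ a| := by
    rcases le_total a b with hab | hab
    · rw [abs_of_nonneg (sub_nonneg.2 hab), abs_of_nonneg (sub_nonneg.2 (h.mono hab))]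
    · rw [abs_of_nonpos (sub_nonpos.2 hab), abs_of_nonpos (sub_nonpos.2 (h.mono hab))]; ring
  rw [hp]
  have hx := abs_nonneg (ψ b - ψ a)
  have hy := abs_nonneg (b - a)
  have hs : 0 ≤ |a| + |b| := by positivity
  have hk := h.key a b
  have hec : 0 ≤ ε * C := mul_nonneg hε hC
  have hδ := h.nn
  generalize |ψ b - ψ a| = x at *
  generalize |b - a| = y at *
  generalize |a| + |b| = s at *
  have e : 2 * ε ^ 2 * C ^ 2 * δ * s = 2 * (ε * C) ^ 2 * δ * s := by ring
  rw [e]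
  generalize ε * C = t at *
  have hlast : 0 ≤ 2 * t ^ 2 * δ * s := by positivity
  rcases le_total y (s / 2) with hc | hc
  · have hk := hk hc
    rcases le_total (2 * t * s) y with h1 | h1
    · have : t * (s * x) = (t * s) * x := by ring
      have : (t * s) * x ≤ y / 2 * x := mul_le_mul_of_nonneg_right (by linarith) hx
      linarith
    · have h2 : t * (s * x) ≤ t * (δ * y) := mul_le_mul_of_nonneg_left hk hec
      have h3 : t * (δ * y) ≤ t * (δ * (2 * t * s)) := by gcongr
      have h4 : t * (δ * (2 * t * s)) = 2 * t ^ 2 * δ * s := by ring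
      have : 0 ≤ y * x := mul_nonneg hy hx
      linarith
  · have h1 : t * s ≤ y / 2 := by nlinarith
    have : (t * s) * x ≤ y / 2 * x := mul_le_mul_of_nonneg_right h1 hx
    linarith


open MeasureTheory Filter

/-- Assumptions on the nonlocal scheme. -/
structure Scheme {d : ℕ} {Ω : Type*} [MeasurableSpace Ω] (q : Ω → (Fin d → ℝ)) (κ : Ω → ℝ)
    (S D : Ω → (Fin d → ℝ) → ℝ → ℝ) (L C K : ℝ) : Prop where
  q_meas : Measurable q
  κ_meas : Measurable κ
  κ_nn : ∀ ω, 0 ≤ κ ω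
  κ_le : ∀ ω, κ ω ≤ K
  S_meas : Measurable (fun p : Ω × (Fin d → ℝ) × ℝ => S p.1 p.2.1 p.2.2)
  D_meas : Measurable (fun p : Ω × (Fin d → ℝ) × ℝ => D p.1 p.2.1 p.2.2)
  S_zero : ∀ ω y, S ω y 0 = 0
  D_zero : ∀ ω y, D ω y 0 = 0
  S_slope : ∀ ω y a b, a ≤ b → κ ω * (b - a) ≤ S ω y b - S ω y a
  S_lip : ∀ ω y a b, |S ω y a - S ω y b| ≤ L * |a - b|
  D_lip : ∀ ω y a b, |D ω y a - D ω y b| ≤ κ ω * L * |a - b|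
  D_bd : ∀ ω y r, |D ω y r| ≤ κ ω * C * |r|
  L_nn : 0 ≤ L
  C_nn : 0 ≤ C

noncomputable def Vsch {d : ℕ} {Ω : Type*} (q : Ω → (Fin d → ℝ))
    (S D : Ω → (Fin d → ℝ) → ℝ → ℝ) (lam ε σ : ℝ) (ω : Ω) (y : Fin d → ℝ) (r : ℝ) : ℝ :=
  lam * (ε ^ 2)⁻¹ * (S ω (y + (ε / 2) • q ω) r + σ * ε * D ω (y + (ε / 2) • q ω) r)

section En

variable {d : ℕ} {Ω : Type*} [MeasurableSpace Ω] {q : Ω → (Fin d → ℝ)} {κ : Ω → ℝ}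
    {S D : Ω → (Fin d → ℝ) → ℝ → ℝ} {L C K : ℝ}

theorem Scheme.K_nn (h : Scheme q κ S D L C K) [Nonempty Ω] : 0 ≤ K :=
  (h.κ_nn (Classical.arbitrary Ω)).trans (h.κ_le _)

theorem Scheme.goodV (h : Scheme q κ S D L C K) (hK : 0 ≤ K) {lam ε σ : ℝ} (hlam : 0 < lam) (hε : 0 < ε)
    (hεL : ε * L ≤ 1) (hσ : |σ| ≤ 1) :
    GoodV (lam * (ε ^ 2)⁻¹ * (L + K)) (Vsch q S D lam ε σ) where
  meas := by
    have hs := h.S_meas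
    have hd := h.D_meas
    have hq := h.q_meas
    have hm : Measurable (fun p : Ω × (Fin d → ℝ) × ℝ =>
      (p.1, (p.2.1 + (ε / 2) • q p.1, p.2.2))) := by fun_prop
    exact ((hs.comp hm).add ((hd.comp hm).const_mul (σ * ε))).const_mul _
  zero ω y := by simp [Vsch, h.S_zero, h.D_zero]
  mono ω y := by
    intro a b hab
    unfold Vsch
    refine mul_le_mul_of_nonneg_left ?_ (by positivity)
    generalize y + (ε / 2) • q ω = m
    have h1 := h.S_slope ω m a b hab
    have h2 := h.D_lip ω m a b
    have h3 : |σ * ε * (D ω m a - D ω m b)| ≤ κ ω * (b - a) := by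
      rw [abs_mul, abs_mul, abs_of_pos hε]
      rw [abs_sub_comm a b, abs_of_nonneg (sub_nonneg.2 hab)] at h2
      have hk := h.κ_nn ω
      have hba := sub_nonneg.2 hab
      calc |σ| * ε * |D ω m a - D ω m b| ≤ 1 * ε * (κ ω * L * (b - a)) := by gcongr
        _ = (ε * L) * (κ ω * (b - a)) := by ring
        _ ≤ 1 * (κ ω * (b - a)) := by gcongr
        _ = _ := one_mul _
    have := (abs_le.1 h3).2
    linarith
  lip ω y a b := by
    unfold Vsch
    rw [← mul_sub, abs_mul, abs_of_pos (a := lam * (ε ^ 2)⁻¹) (by positivity), mul_assoc (lam * _)]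
    refine mul_le_mul_of_nonneg_left ?_ (by positivity)
    generalize y + (ε / 2) • q ω = m
    have h1 := h.S_lip ω m a b
    have h2 := h.D_lip ω m a b
    have h3 : |σ * ε * (D ω m a - D ω m b)| ≤ K * |a - b| := by
      rw [abs_mul, abs_mul, abs_of_pos hε]
      have hk := h.κ_nn ω
      have hk2 := h.κ_le ω
      calc |σ| * ε * |D ω m a - D ω m b| ≤ 1 * ε * (κ ω * L * |a - b|) := by gcongr
        _ = (ε * L) * (κ ω * |a - b|) := by ring
        _ ≤ 1 * (K * |a - b|) := by gcongr
        _ = _ := one_mul _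
    have e : S ω m a + σ * ε * D ω m a - (S ω m b + σ * ε * D ω m b) =
      (S ω m a - S ω m b) + σ * ε * (D ω m a - D ω m b) := by ring
    rw [e, add_mul]
    exact (abs_add_le _ _).trans (add_le_add h1 h3)

theorem Scheme.flux_le (h : Scheme q κ S D L C K) {lam ε : ℝ} (hlam : 0 < lam) (hε : 0 < ε)
    (hεC : 4 * (ε * C) ≤ 1) {δ : ℝ} {ψ : ℝ → ℝ} (hψ : GoodPsi δ ψ) (ω : Ω) (y : Fin d → ℝ) (a b : ℝ) :
    (Vsch q S D lam ε 1 ω y a - Vsch q S D lam ε (-1) ω y b) * (ψ b - ψ a) ≤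
      - (lam / 2 * (ε ^ 2)⁻¹) * (κ ω * ((b - a) * (ψ b - ψ a)))
        + 2 * lam * C ^ 2 * δ * (κ ω * (|a| + |b|)) := by
  unfold Vsch
  generalize y + (ε / 2) • q ω = m
  have hk := h.κ_nn ω
  have h0 := absorb hψ hε.le h.C_nn hεC a b
  have hS : κ ω * ((b - a) * (ψ b - ψ a)) ≤ (S ω m b - S ω m a) * (ψ b - ψ a) := by
    rcases le_total a b with hab | hab
    · have h1 := h.S_slope ω m a b hab
      have h2 := sub_nonneg.2 (hψ.mono hab)
      nlinarith
    · have h1 := h.S_slope ω m b a hab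
      have h2 := sub_nonneg.2 (hψ.mono hab)
      nlinarith
  have hD : (D ω m a + D ω m b) * (ψ b - ψ a) ≤ κ ω * C * ((|a| + |b|) * |ψ b - ψ a|) := by
    refine (le_abs_self _).trans ?_
    rw [abs_mul, ← mul_assoc]
    refine mul_le_mul_of_nonneg_right ?_ (abs_nonneg _)
    rw [mul_add]
    exact (abs_add_le _ _).trans (add_le_add (h.D_bd _ _ _) (h.D_bd _ _ _))
  have hε2 : 0 < lam * (ε ^ 2)⁻¹ := by positivity
  have key : - ((S ω m b - S ω m a) * (ψ b - ψ a)) + ε * ((D ω m a + D ω m b) * (ψ b - ψ a)) ≤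
      κ ω * (- (1 / 2) * ((b - a) * (ψ b - ψ a)) + 2 * ε ^ 2 * C ^ 2 * δ * (|a| + |b|)) := by
    have h1 := mul_le_mul_of_nonneg_left hD hε.le
    have h2 := mul_le_mul_of_nonneg_left h0 hk
    nlinarith
  have h3 := mul_le_mul_of_nonneg_left key hε2.le
  calc _ = lam * (ε ^ 2)⁻¹ * (- ((S ω m b - S ω m a) * (ψ b - ψ a)) +
        ε * ((D ω m a + D ω m b) * (ψ b - ψ a))) := by ring
    _ ≤ _ := h3
    _ = _ := by field_simp

theorem Scheme.energy (h : Scheme q κ S D L C K) (hK : 0 ≤ K) {ν : Measure Ω} [IsFiniteMeasure ν]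
    {Km : ℝ} (hKm : ∫ ω, κ ω ∂ν ≤ Km)
    {lam ε : ℝ} (hlam : 0 < lam) (hε : 0 < ε) (hεL : ε * L ≤ 1)
    (hεC : 4 * (ε * C) ≤ 1) {f : (Fin d → ℝ) → ℝ} (hf : Integrable f) :
    ∃ u : (Fin d → ℝ) → ℝ, Measurable u ∧ Integrable u ∧ ∫ x, |u x| ≤ ∫ x, |f x| ∧
      (∀ φ : (Fin d → ℝ) → ℝ, Measurable φ → (∃ C, ∀ x, |φ x| ≤ C) →
        ∫ x, u x * φ x = (∫ x, f x * φ x) + ∫ p : Ω × (Fin d → ℝ),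
          flux (Vsch q S D lam ε 1) (Vsch q S D lam ε (-1)) (fun ω => ε • q ω) u p
            * (φ (p.2 + ε • q p.1) - φ p.2) ∂(ν.prod volume)) ∧
      ∀ δ ψ, GoodPsi δ ψ →
        Integrable (fun p : Ω × (Fin d → ℝ) => κ p.1 * ((u (p.2 + ε • q p.1) - u p.2) *
          (ψ (u (p.2 + ε • q p.1)) - ψ (u p.2)))) (ν.prod volume) ∧
        (∫ x, u x * ψ (u x)) + lam / 2 * (ε ^ 2)⁻¹ * ∫ p : Ω × (Fin d → ℝ),
          κ p.1 * ((u (p.2 + ε • q p.1) - u p.2) *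
            (ψ (u (p.2 + ε • q p.1)) - ψ (u p.2))) ∂(ν.prod volume)
        ≤ (∫ x, f x * ψ (u x)) + 4 * lam * C ^ 2 * δ * Km * ∫ x, |f x| := by
  have gp := h.goodV hK hlam hε hεL (σ := 1) (by simp)
  have gm := h.goodV hK hlam hε hεL (σ := -1) (by simp)
  have hL := h.L_nn
  have hqm := h.q_meas
  have hκm := h.κ_meas
  have hh : Measurable (fun ω => ε • q ω) := by fun_prop
  obtain ⟨u, um, ui, ule, hw⟩ := solve (ν := ν) (by positivity) gp gm hh hf
  refine ⟨u, um, ui, ule, hw, ?_⟩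
  intro δ ψ hψ
  have hψm : Measurable ψ := hψ.mono.measurable
  have iu : Integrable (fun p : Ω × (Fin d → ℝ) => u p.2) (ν.prod volume) := integrable_snd ui
  have ius : Integrable (fun p : Ω × (Fin d → ℝ) => u (p.2 + ε • q p.1)) (ν.prod volume) :=
    integrable_shift hh iu
  have hψd : ∀ a b, |ψ a - ψ b| ≤ 2 := fun a b =>
    (abs_sub _ _).trans (by linarith [hψ.bdd a, hψ.bdd b])
  have hκa : ∀ ω, |κ ω| ≤ K := fun ω => by rw [abs_of_nonneg (h.κ_nn ω)]; exact h.κ_le ω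
  have I1 : Integrable (fun p : Ω × (Fin d → ℝ) => κ p.1 * ((u (p.2 + ε • q p.1) - u p.2) *
          (ψ (u (p.2 + ε • q p.1)) - ψ (u p.2)))) (ν.prod volume) := by
    refine Integrable.bdd_mul (c := K) (Integrable.mul_bdd (c := 2) (ius.sub iu) ?_ ?_) ?_ ?_
    · exact Measurable.aestronglyMeasurable (by fun_prop)
    · exact ae_of_all _ (fun p => hψd _ _)
    · exact Measurable.aestronglyMeasurable (by fun_prop)
    · exact ae_of_all _ (fun p => hκa _)
  have I2 : Integrable (fun p : Ω × (Fin d → ℝ) => κ p.1 * (|u p.2| + |u (p.2 + ε • q p.1)|))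
      (ν.prod volume) := by
    refine Integrable.bdd_mul (c := K) (iu.abs.add ius.abs) ?_ ?_
    · exact Measurable.aestronglyMeasurable (by fun_prop)
    · exact ae_of_all _ (fun p => hκa _)
  refine ⟨I1, ?_⟩
  have h1 := hw (fun x => ψ (u x)) (hψm.comp um) ⟨1, fun x => hψ.bdd _⟩
  rw [h1]
  have I3 : Integrable (fun p : Ω × (Fin d → ℝ) =>
      flux (Vsch q S D lam ε 1) (Vsch q S D lam ε (-1)) (fun ω => ε • q ω) u p *
      (ψ (u (p.2 + ε • q p.1)) - ψ (u p.2))) (ν.prod volume) := by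
    refine Integrable.mul_bdd (c := 2) (integrable_flux gp gm hh um ui) ?_ ?_
    · exact Measurable.aestronglyMeasurable (by fun_prop)
    · exact ae_of_all _ (fun p => hψd _ _)
  have h2 := integral_mono I3 ((I1.const_mul (-(lam / 2 * (ε ^ 2)⁻¹))).add
    (I2.const_mul (2 * lam * C ^ 2 * δ))) (fun p => h.flux_le hlam hε hεC hψ p.1 p.2 _ _)
  have h2 := h2.trans_eq (integral_add (I1.const_mul (-(lam / 2 * (ε ^ 2)⁻¹)))
    (I2.const_mul (2 * lam * C ^ 2 * δ)))
  rw [integral_const_mul, integral_const_mul] at h2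
  have h3 : ∫ p : Ω × (Fin d → ℝ), κ p.1 * (|u p.2| + |u (p.2 + ε • q p.1)|) ∂(ν.prod volume) ≤
      2 * (Km * ∫ x, |f x|) := by
    have e1 : ∫ p : Ω × (Fin d → ℝ), κ p.1 * |u p.2| ∂(ν.prod volume) = (∫ ω, κ ω ∂ν) * ∫ x, |u x| :=
      integral_prod_mul κ (fun x => |u x|)
    have J1 : Integrable (fun p : Ω × (Fin d → ℝ) => κ p.1 * |u p.2|) (ν.prod volume) :=
      Integrable.bdd_mul (c := K) iu.abs (Measurable.aestronglyMeasurable (by fun_prop))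
        (ae_of_all _ (fun p => hκa _))
    have J2 := integrable_shift hh J1
    have e2 := integral_shift hh J1
    rw [e1] at e2
    have hk0 : 0 ≤ ∫ ω, κ ω ∂ν := integral_nonneg h.κ_nn
    simp only [mul_add]
    rw [integral_add J1 J2, e1, e2, ← two_mul]
    have : 0 ≤ ∫ x, |u x| := integral_nonneg fun x => abs_nonneg _
    have := hk0.trans hKm
    gcongr
  have h4 : 0 ≤ 2 * lam * C ^ 2 * δ := by have := hψ.nn; positivity
  have h5 := mul_le_mul_of_nonneg_left h3 h4
  calc _ ≤ (∫ x, f x * ψ (u x)) + (2 * lam * C ^ 2 * δ) * (2 * (Km * ∫ x, |f x|)) := by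
        linarith
    _ = _ := by ring

end En


open MeasureTheory Filter

/-- The bounded nonlinearity `r / (1 + |r|)`. -/
noncomputable def ww (r : ℝ) : ℝ := oddE th1 r

theorem good_ww : GoodPsi 4 ww := by
  have := good_th1.goodPsi
  rwa [mul_one] at this

theorem ww_meas : Measurable ww := good_ww.mono.measurable

theorem ww_eq (r : ℝ) : ww r = r / (1 + |r|) := by
  unfold ww
  rcases le_total 0 r with h | h
  · rw [oddE_of_nonneg h, abs_of_nonneg h, th1]
  · rw [oddE_of_nonpos good_th1.zero h, abs_of_nonpos h, th1]; ring

theorem ww_lip (a b : ℝ) : |ww b - ww a| ≤ |b - a| := by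
  have main : ∀ a b, a ≤ b → ww b - ww a ≤ b - a := by
    intro a b hab
    have key : ∀ a b, 0 ≤ a → a ≤ b → th1 b - th1 a ≤ b - a := by
      intro a b ha hab
      have := good_th1.key a b ha hab
      have := good_th1.mono a b ha hab
      nlinarith
    unfold ww
    rcases le_total 0 a with ha | ha
    · rw [oddE_of_nonneg ha, oddE_of_nonneg (ha.trans hab)]; exact key _ _ ha hab
    · rw [oddE_of_nonpos good_th1.zero ha]
      rcases le_total 0 b with hb | hb
      · rw [oddE_of_nonneg hb]
        have h1 := key 0 b le_rfl hb
        have h2 := key 0 (-a) le_rfl (by linarith)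
        rw [good_th1.zero] at h1 h2
        linarith
      · rw [oddE_of_nonpos good_th1.zero hb]
        have := key (-b) (-a) (by linarith) (by linarith)
        linarith
  rcases le_total a b with hab | hab
  · rw [abs_of_nonneg (sub_nonneg.2 hab), abs_of_nonneg (sub_nonneg.2 (good_ww.mono hab))]
    exact main a b hab
  · rw [abs_sub_comm, abs_sub_comm b, abs_of_nonneg (sub_nonneg.2 hab), abs_of_nonneg (sub_nonneg.2 (good_ww.mono hab))]
    exact main b a hab

theorem ww_sq_le (a b : ℝ) : (ww b - ww a) ^ 2 ≤ (b - a) * (ww b - ww a) := by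
  have h := ww_lip a b
  rcases le_total a b with hab | hab
  · have h2 := sub_nonneg.2 (good_ww.mono hab)
    rw [abs_of_nonneg (sub_nonneg.2 hab), abs_of_nonneg h2] at h
    nlinarith
  · have h2 := sub_nonpos.2 (good_ww.mono hab)
    rw [abs_of_nonpos (sub_nonpos.2 hab), abs_of_nonpos h2] at h
    nlinarith

/-- The unit cube. -/
def QQ (d : ℕ) : Set (Fin d → ℝ) := Metric.closedBall 0 (1 / 2)

noncomputable def Enr {d : ℕ} (u : (Fin d → ℝ) → ℝ) (t : ℝ) : ENNReal :=
  ∫⁻ z in QQ d, ∫⁻ y, ENNReal.ofReal ((ww (u (y + t • z)) - ww (u y)) ^ 2)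

structure Bd {d : ℕ} (C : ℝ) (δ : ℕ → ℝ) (u : (Fin d → ℝ) → ℝ) : Prop where
  meas : Measurable u
  l1 : ∫⁻ x, ENNReal.ofReal |u x| ≤ ENNReal.ofReal C
  tail : ∀ k, ∫⁻ x, ENNReal.ofReal (|u x| * thl (δ k) |u x|) ≤ ENNReal.ofReal (1 / (k + 1))

section

variable {d : ℕ}

theorem thl_le {δ r : ℝ} (hδ : 0 ≤ δ) (hr : 0 ≤ r) : thl δ r ≤ δ * r := by
  unfold thl
  refine (min_le_right _ _).trans (mul_le_mul_of_nonneg_left ?_ hδ)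
  have := Real.log_le_sub_one_of_pos (x := 1 + r) (by linarith)
  linarith

theorem bd_of_energy {f : (Fin d → ℝ) → ℝ} (hf : Integrable f) {A : ℝ} (hA : 0 ≤ A) :
    ∃ δ : ℕ → ℝ, (∀ k, 0 < δ k) ∧ ∀ u : (Fin d → ℝ) → ℝ, Measurable u → Integrable u →
      ∫ x, |u x| ≤ ∫ x, |f x| →
      (∀ δ ψ, GoodPsi δ ψ → ∫ x, u x * ψ (u x) ≤ (∫ x, f x * ψ (u x)) + A * δ) →
      Bd (∫ x, |f x|) δ u := by
  -- truncation of f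
  have hlim : Tendsto (fun M : ℕ => ∫ x, max (|f x| - M) 0) atTop (nhds (∫ _ : Fin d → ℝ, (0:ℝ))) := by
    refine tendsto_integral_of_dominated_convergence (fun x => |f x|) ?_ hf.abs ?_ ?_
    · intro n
      exact ((hf.abs.1.sub aestronglyMeasurable_const).sup aestronglyMeasurable_const)
    · intro n
      refine ae_of_all _ fun x => ?_
      rw [Real.norm_eq_abs, abs_of_nonneg (le_max_right _ _)]
      refine max_le ?_ (abs_nonneg _)
      have : (0:ℝ) ≤ n := Nat.cast_nonneg n
      linarith
    · refine ae_of_all _ fun x => ?_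
      refine tendsto_const_nhds.congr' ?_
      obtain ⟨N, hN⟩ := exists_nat_ge |f x|
      filter_upwards [eventually_ge_atTop N] with n hn
      have : (N:ℝ) ≤ n := Nat.cast_le.2 hn
      rw [max_eq_right]; linarith
  simp only [integral_zero] at hlim
  have hsel : ∀ k : ℕ, ∃ δ : ℝ, 0 < δ ∧ ∀ u : (Fin d → ℝ) → ℝ, Measurable u → Integrable u →
      ∫ x, |u x| ≤ ∫ x, |f x| →
      (∀ δ ψ, GoodPsi δ ψ → ∫ x, u x * ψ (u x) ≤ (∫ x, f x * ψ (u x)) + A * δ) →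
      ∫⁻ x, ENNReal.ofReal (|u x| * thl δ |u x|) ≤ ENNReal.ofReal (1 / (k + 1)) := by
    intro k
    have he : (0:ℝ) < 1 / (k + 1) / 2 := by positivity
    obtain ⟨M, hM⟩ := (hlim.eventually (gt_mem_nhds he)).exists
    have hF : 0 ≤ ∫ x, |f x| := integral_nonneg fun x => abs_nonneg _
    set B : ℝ := M * (∫ x, |f x|) + 4 * A + 1 with hB
    have hB1 : 0 < B := by positivity
    refine ⟨1 / (k + 1) / 2 / B, by positivity, ?_⟩
    set δ := (1:ℝ) / (k + 1) / 2 / B with hδd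
    have hδ : 0 < δ := by positivity
    intro u um ui ule hen
    have hθ := good_thl hδ.le
    have h1 := hen _ _ hθ.goodPsi
    have hmψ : Measurable (fun x => oddE (thl δ) (u x)) := hθ.goodPsi.mono.measurable.comp um
    have i1 : Integrable (fun x => u x * oddE (thl δ) (u x)) :=
      ui.mul_bdd (c := 1) hmψ.aestronglyMeasurable (ae_of_all _ fun x => hθ.goodPsi.bdd _)
    have i2 : Integrable (fun x => f x * oddE (thl δ) (u x)) :=
      hf.mul_bdd (c := 1) hmψ.aestronglyMeasurable (ae_of_all _ fun x => hθ.goodPsi.bdd _)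
    have i3 : Integrable (fun x => max (|f x| - M) 0) := by
      refine hf.abs.mono' ((hf.abs.1.sub aestronglyMeasurable_const).sup aestronglyMeasurable_const) ?_
      refine ae_of_all _ fun x => ?_
      rw [Real.norm_eq_abs, abs_of_nonneg (le_max_right _ _)]
      refine max_le ?_ (abs_nonneg _)
      have : (0:ℝ) ≤ M := Nat.cast_nonneg M
      linarith
    have h2 : ∫ x, f x * oddE (thl δ) (u x) ≤ ∫ x, (max (|f x| - M) 0 + (M * δ) * |u x|) := by
      refine integral_mono i2 (i3.add (ui.abs.const_mul _)) fun x => ?_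
      refine (le_abs_self _).trans ?_
      rw [abs_mul, hθ.abs_oddE]
      have a1 := hθ.nonneg (abs_nonneg (u x))
      have a2 := hθ.le_one _ (abs_nonneg (u x))
      have a3 := thl_le hδ.le (abs_nonneg (u x))
      have a4 := le_max_left (|f x| - M) 0
      have a5 := le_max_right (|f x| - M) 0
      have a6 : (0:ℝ) ≤ M := Nat.cast_nonneg M
      simp only
      generalize max (|f x| - M) 0 = m at *
      calc |f x| * thl δ |u x| ≤ (m + M) * thl δ |u x| := by gcongr; linarith
        _ = m * thl δ |u x| + M * thl δ |u x| := by ring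
        _ ≤ m * 1 + M * (δ * |u x|) := by gcongr
        _ = _ := by ring
    rw [integral_add i3 (ui.abs.const_mul _), integral_const_mul] at h2
    simp only [hθ.mul_oddE] at h1 i1
    rw [← ofReal_integral_eq_lintegral_ofReal i1
      (ae_of_all _ fun x => mul_nonneg (abs_nonneg _) (hθ.nonneg (abs_nonneg _)))]
    apply ENNReal.ofReal_le_ofReal
    have h3 : (M * δ) * ∫ x, |u x| ≤ M * δ * ∫ x, |f x| := by gcongr
    have h4 : δ * B = 1 / (k + 1) / 2 := by rw [hδd]; field_simp
    have h5 : δ * B = M * δ * (∫ x, |f x|) + A * (4 * δ) + δ := by rw [hB]; ring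
    linarith
  choose δ hδ hsel using hsel
  refine ⟨δ, hδ, fun u um ui ule hen => ⟨um, ?_, fun k => hsel k u um ui ule hen⟩⟩
  rw [← ofReal_integral_eq_lintegral_ofReal ui.abs (ae_of_all _ fun x => abs_nonneg _)]
  exact ENNReal.ofReal_le_ofReal ule

theorem enr_meas {u : (Fin d → ℝ) → ℝ} (um : Measurable u) (t : ℝ) :
    Measurable (fun z : Fin d → ℝ => ∫⁻ y, ENNReal.ofReal ((ww (u (y + t • z)) - ww (u y)) ^ 2)) := by
  have hw := ww_meas
  have : Measurable (fun p : (Fin d → ℝ) × (Fin d → ℝ) =>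
    ENNReal.ofReal ((ww (u (p.2 + t • p.1)) - ww (u p.2)) ^ 2)) := by fun_prop
  exact this.lintegral_prod_right'

theorem enr_of_energy {Ω : Type*} [MeasurableSpace Ω] {ν : Measure Ω} [IsFiniteMeasure ν]
    {q : Ω → (Fin d → ℝ)} {κ : Ω → ℝ} (hq : Measurable q) (hκ : Measurable κ) (hκ0 : ∀ ω, 0 ≤ κ ω)
    {κ0 : ℝ} (hκ00 : 0 < κ0)
    (hz : ∀ g : (Fin d → ℝ) → ENNReal, Measurable g →
      ENNReal.ofReal κ0 * ∫⁻ z in QQ d, g z ≤ ∫⁻ ω, ENNReal.ofReal (κ ω) * g (q ω) ∂ν)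
    {u : (Fin d → ℝ) → ℝ} (um : Measurable u) {lam ε B : ℝ} (hlam : 0 < lam) (hε : 0 < ε)
    (hi : Integrable (fun p : Ω × (Fin d → ℝ) => κ p.1 * ((u (p.2 + ε • q p.1) - u p.2) *
          (ww (u (p.2 + ε • q p.1)) - ww (u p.2)))) (ν.prod volume))
    (hB : lam / 2 * (ε ^ 2)⁻¹ * ∫ p : Ω × (Fin d → ℝ),
          κ p.1 * ((u (p.2 + ε • q p.1) - u p.2) *
            (ww (u (p.2 + ε • q p.1)) - ww (u p.2))) ∂(ν.prod volume) ≤ B) :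
    Enr u ε ≤ ENNReal.ofReal (2 * B / (lam * κ0) * ε ^ 2) := by
  have hw := ww_meas
  have h1 := hz _ (enr_meas um ε)
  have h2 : ∫⁻ ω, ENNReal.ofReal (κ ω) * (∫⁻ y, ENNReal.ofReal ((ww (u (y + ε • q ω)) - ww (u y)) ^ 2)) ∂ν
      ≤ ENNReal.ofReal (∫ p : Ω × (Fin d → ℝ),
          κ p.1 * ((u (p.2 + ε • q p.1) - u p.2) *
            (ww (u (p.2 + ε • q p.1)) - ww (u p.2))) ∂(ν.prod volume)) := by
    have hnn : ∀ a b, 0 ≤ (b - a) * (ww b - ww a) := fun a b => (sq_nonneg _).trans (ww_sq_le a b)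
    rw [ofReal_integral_eq_lintegral_ofReal hi
      (ae_of_all _ fun p => mul_nonneg (hκ0 _) (hnn _ _))]
    rw [lintegral_prod _ hi.1.aemeasurable.ennreal_ofReal]
    refine lintegral_mono fun ω => ?_
    rw [← lintegral_const_mul _ (by fun_prop)]
    refine lintegral_mono fun y => ?_
    rw [← ENNReal.ofReal_mul (hκ0 _)]
    exact ENNReal.ofReal_le_ofReal (mul_le_mul_of_nonneg_left (ww_sq_le _ _) (hκ0 _))
  have h3 := h1.trans h2
  generalize (∫ p : Ω × (Fin d → ℝ),
          κ p.1 * ((u (p.2 + ε • q p.1) - u p.2) *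
            (ww (u (p.2 + ε • q p.1)) - ww (u p.2))) ∂(ν.prod volume)) = X at *
  change ENNReal.ofReal κ0 * Enr u ε ≤ _ at h3
  have h4 : Enr u ε ≤ ENNReal.ofReal X / ENNReal.ofReal κ0 := by
    rw [ENNReal.le_div_iff_mul_le (Or.inl (by simpa using hκ00)) (Or.inl ENNReal.ofReal_ne_top), mul_comm]
    exact h3
  refine h4.trans ?_
  rw [← ENNReal.ofReal_div_of_pos hκ00]
  apply ENNReal.ofReal_le_ofReal
  have : X ≤ 2 * B / lam * ε ^ 2 := by
    have hp : 0 < lam / 2 * (ε ^ 2)⁻¹ := by positivity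
    have h5 : X ≤ B / (lam / 2 * (ε ^ 2)⁻¹) := by rw [le_div_iff₀ hp]; linarith
    refine h5.trans_eq ?_
    field_simp
  calc X / κ0 ≤ 2 * B / lam * ε ^ 2 / κ0 := by gcongr
    _ = _ := by field_simp

theorem enr_double {u : (Fin d → ℝ) → ℝ} (um : Measurable u) (t : ℝ) : Enr u (2 * t) ≤ 4 * Enr u t := by
  have hw := ww_meas
  unfold Enr
  rw [← lintegral_const_mul _ (enr_meas um t)]
  refine lintegral_mono fun z => ?_
  have e : ∀ y, ENNReal.ofReal ((ww (u (y + (2 * t) • z)) - ww (u y)) ^ 2) ≤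
      2 * ENNReal.ofReal ((ww (u ((y + t • z) + t • z)) - ww (u (y + t • z))) ^ 2) +
      2 * ENNReal.ofReal ((ww (u (y + t • z)) - ww (u y)) ^ 2) := by
    intro y
    have e1 : y + (2 * t) • z = (y + t • z) + t • z := by rw [two_mul, add_smul, add_assoc]
    rw [e1]
    have e2 : (2 : ENNReal) = ENNReal.ofReal 2 := by simp
    rw [e2, ← ENNReal.ofReal_mul (by norm_num), ← ENNReal.ofReal_mul (by norm_num),
      ← ENNReal.ofReal_add (by positivity) (by positivity)]
    apply ENNReal.ofReal_le_ofReal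
    nlinarith [sq_nonneg ((ww (u ((y + t • z) + t • z)) - ww (u (y + t • z))) - (ww (u (y + t • z)) - ww (u y)))]
  refine (lintegral_mono e).trans ?_
  rw [lintegral_add_right _ (by fun_prop), lintegral_const_mul _ (by fun_prop), lintegral_const_mul _ (by fun_prop)]
  rw [lintegral_add_right_eq_self (μ := (volume : Measure (Fin d → ℝ)))
    (fun y => ENNReal.ofReal ((ww (u (y + t • z)) - ww (u y)) ^ 2)) (t • z), ← add_mul]
  norm_num

theorem enr_dyadic {u : (Fin d → ℝ) → ℝ} (um : Measurable u) {B : ℝ} {m : ℕ}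
    (h : Enr u ((1 / 2) ^ m) ≤ ENNReal.ofReal (B * ((1 / 2) ^ m) ^ 2)) {j : ℕ} (hj : j ≤ m) :
    Enr u ((1 / 2) ^ j) ≤ ENNReal.ofReal (B * ((1 / 2) ^ j) ^ 2) := by
  induction hj using Nat.decreasingInduction with
  | self => exact h
  | of_succ k hk ih =>
    have h1 := enr_double um ((1 / 2) ^ (k + 1))
    have e : (2:ℝ) * (1 / 2) ^ (k + 1) = (1 / 2) ^ k := by rw [pow_succ]; ring
    rw [e] at h1
    refine h1.trans ((mul_le_mul_right ih 4).trans (le_of_eq ?_))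
    have e2 : (4 : ENNReal) = ENNReal.ofReal 4 := by simp
    rw [e2, ← ENNReal.ofReal_mul (by norm_num)]
    congr 1
    rw [← e]; ring

end


open MeasureTheory Filter Topology

section Weak

variable {d : ℕ}

theorem weak_seq {w : ℕ → (Fin d → ℝ) → ℝ} (hm : ∀ n, Measurable (w n)) {C : ℝ} (hC : 0 ≤ C)
    (h2 : ∀ n, ∫⁻ x, ENNReal.ofReal (w n x ^ 2) ≤ ENNReal.ofReal C) :
    ∃ φ : ℕ → ℕ, StrictMono φ ∧ ∀ A : Set (Fin d → ℝ), MeasurableSet A → volume A ≠ ⊤ →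
      ∃ l, Tendsto (fun n => ∫ x in A, w (φ n) x) atTop (𝓝 l) := by
  have : Fact ((1 : ENNReal) ≤ 2) := ⟨by norm_num⟩
  have : Fact ((2 : ENNReal) ≠ ⊤) := ⟨by norm_num⟩
  have hi : ∀ n, Integrable (fun x => w n x ^ 2) := by
    intro n
    refine ⟨((hm n).pow_const 2).aestronglyMeasurable, ?_⟩
    rw [hasFiniteIntegral_iff_ofReal (ae_of_all _ fun x => sq_nonneg _)]
    exact (h2 n).trans_lt ENNReal.ofReal_lt_top
  have hL : ∀ n, MemLp (w n) 2 := fun n =>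
    (memLp_two_iff_integrable_sq (hm n).aestronglyMeasurable).2 (hi n)
  let W : ℕ → Lp ℝ 2 (volume : Measure (Fin d → ℝ)) := fun n => (hL n).toLp (w n)
  have hn : ∀ n, ‖W n‖ ≤ Real.sqrt C := by
    intro n
    apply Real.le_sqrt_of_sq_le
    have e1 : ‖W n‖ ^ 2 = ∫ x, w n x ^ 2 := by
      rw [← real_inner_self_eq_norm_sq, L2.inner_def]
      refine integral_congr_ae ?_
      filter_upwards [(hL n).coeFn_toLp] with x hx
      simp only [W]
      rw [hx]; simp [sq]
    rw [e1]
    have := h2 n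
    rw [← ofReal_integral_eq_lintegral_ofReal (hi n) (ae_of_all _ fun x => sq_nonneg _)] at this
    exact (ENNReal.ofReal_le_ofReal_iff hC).1 this
  let T : ℕ → WeakDual ℝ (Lp ℝ 2 (volume : Measure (Fin d → ℝ))) := fun n =>
    StrongDual.toWeakDual (InnerProductSpace.toDual ℝ _ (W n))
  obtain ⟨T0, -, φ, hφ, hT⟩ := WeakDual.isSeqCompact_closedBall ℝ
    (Lp ℝ 2 (volume : Measure (Fin d → ℝ))) 0 (Real.sqrt C) (x := T) (by
      intro n
      simp only [T, Set.mem_preimage, mem_closedBall_zero_iff]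
      have := (InnerProductSpace.toDual ℝ (Lp ℝ 2 (volume : Measure (Fin d → ℝ)))).norm_map (W n)
      exact this.trans_le (hn n))
  refine ⟨φ, hφ, fun A hA hA2 => ⟨T0 (indicatorConstLp 2 hA hA2 (1:ℝ)), ?_⟩⟩
  have h3 := (WeakBilin.eval_continuous _ (indicatorConstLp 2 hA hA2 (1:ℝ))).continuousAt.tendsto.comp hT
  refine Tendsto.congr (fun n => ?_) h3
  have e : (T (φ n)) (indicatorConstLp 2 hA hA2 (1:ℝ)) = inner ℝ (W (φ n)) (indicatorConstLp 2 hA hA2 (1:ℝ)) := rfl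
  refine Eq.trans e ?_
  rw [real_inner_comm, L2.inner_indicatorConstLp_one]
  refine setIntegral_congr_ae hA ?_
  filter_upwards [(hL (φ n)).coeFn_toLp] with x hx _
  exact hx

theorem QQ_vol : volume (QQ d) = 1 := by
  unfold QQ
  rw [Real.volume_pi_closedBall _ (by norm_num)]; simp

theorem QQ_meas : MeasurableSet (QQ d) := Metric.isClosed_closedBall.measurableSet

instance QQ_prob : IsProbabilityMeasure ((volume : Measure (Fin d → ℝ)).restrict (QQ d)) :=
  ⟨by rw [Measure.restrict_apply_univ, QQ_vol]⟩

/-- averages -/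
noncomputable def avg (t : ℝ) (w : (Fin d → ℝ) → ℝ) (x : Fin d → ℝ) : ℝ := ∫ z in QQ d, w (x + t • z)

theorem avg_eq {t : ℝ} (ht : 0 < t) (w : (Fin d → ℝ) → ℝ) (x : Fin d → ℝ) :
    avg t w x = |(t ^ d)⁻¹| * ∫ y in Metric.closedBall x (t / 2), w y := by
  unfold avg
  rw [← integral_indicator QQ_meas, ← integral_indicator Metric.isClosed_closedBall.measurableSet]
  set F := (Metric.closedBall x (t / 2)).indicator w with hF
  have h1 : ∀ z, (QQ d).indicator (fun z => w (x + t • z)) z = F (x + t • z) := by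
    intro z
    have : z ∈ QQ d ↔ x + t • z ∈ Metric.closedBall x (t / 2) := by
      unfold QQ
      rw [mem_closedBall_zero_iff, Metric.mem_closedBall, dist_eq_norm, add_sub_cancel_left,
        norm_smul, Real.norm_eq_abs, abs_of_pos ht]
      constructor
      · intro h; nlinarith
      · intro h; nlinarith
    by_cases hz : z ∈ QQ d
    · rw [Set.indicator_of_mem hz, hF, Set.indicator_of_mem (this.1 hz)]
    · rw [Set.indicator_of_notMem hz, hF, Set.indicator_of_notMem (fun h => hz (this.2 h))]
  simp_rw [h1]
  have h2 := Measure.integral_comp_smul (volume : Measure (Fin d → ℝ)) (fun v => F (x + v)) t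
  rw [h2, integral_add_left_eq_self F x]
  simp

theorem avg_meas {w : (Fin d → ℝ) → ℝ} (hw : Measurable w) (t : ℝ) : Measurable (avg t w) := by
  have : StronglyMeasurable (fun p : (Fin d → ℝ) × (Fin d → ℝ) => w (p.1 + t • p.2)) :=
    Measurable.stronglyMeasurable (by fun_prop)
  exact (this.integral_prod_right (ν := (volume : Measure (Fin d → ℝ)).restrict (QQ d))).measurable

theorem avg_bdd {w : (Fin d → ℝ) → ℝ} (hw1 : ∀ x, |w x| ≤ 1) (t : ℝ) (x : Fin d → ℝ) :
    |avg t w x| ≤ 1 := by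
  have := norm_integral_le_of_norm_le_const (μ := (volume : Measure (Fin d → ℝ)).restrict (QQ d))
    (f := fun z => w (x + t • z)) (C := 1) (ae_of_all _ fun z => hw1 _)
  simp only [Real.norm_eq_abs, probReal_univ, mul_one] at this
  exact this

theorem avg_sq {w : (Fin d → ℝ) → ℝ} (hw : Measurable w) (hw1 : ∀ x, |w x| ≤ 1) (t : ℝ) :
    ∫⁻ x, ENNReal.ofReal ((w x - avg t w x) ^ 2) ≤
      ∫⁻ z in QQ d, ∫⁻ y, ENNReal.ofReal ((w (y + t • z) - w y) ^ 2) := by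
  rw [lintegral_lintegral_swap (by fun_prop)]
  refine lintegral_mono fun x => ?_
  set μ := (volume : Measure (Fin d → ℝ)).restrict (QQ d)
  have b1 : ∀ z, ‖w (x + t • z) - w x‖ ≤ 2 := fun z =>
    (norm_sub_le _ _).trans (by have := hw1 (x + t • z); have := hw1 x; simp only [Real.norm_eq_abs]; linarith)
  have i0 : Integrable (fun z => w (x + t • z)) μ :=
    Integrable.of_bound (C := 1) (Measurable.aestronglyMeasurable (by fun_prop)) (ae_of_all _ fun z => hw1 _)
  have i1 : Integrable (fun z => w (x + t • z) - w x) μ := i0.sub (integrable_const _)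
  have i2 : Integrable (fun z => (w (x + t • z) - w x) ^ 2) μ := by
    refine Integrable.of_bound (C := 4) (Measurable.aestronglyMeasurable (by fun_prop)) (ae_of_all _ fun z => ?_)
    rw [norm_pow]
    have := b1 z
    have := norm_nonneg (w (x + t • z) - w x)
    nlinarith
  have e : ∫ z, (w (x + t • z) - w x) ∂μ = avg t w x - w x := by
    rw [integral_sub i0 (integrable_const _)]
    simp [avg, μ]
  rw [← ofReal_integral_eq_lintegral_ofReal i2 (ae_of_all _ fun x => sq_nonneg _)]
  apply ENNReal.ofReal_le_ofReal
  set c := avg t w x - w x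
  have h0 : 0 ≤ ∫ z, ((w (x + t • z) - w x) - c) ^ 2 ∂μ := integral_nonneg fun z => sq_nonneg _
  have h1 : ∀ z, ((w (x + t • z) - w x) - c) ^ 2 = (w (x + t • z) - w x) ^ 2 -
      ((2 * c) * (w (x + t • z) - w x) - c ^ 2) := fun z => by ring
  simp_rw [h1] at h0
  have i3 : Integrable (fun z => (2 * c) * (w (x + t • z) - w x) - c ^ 2) μ :=
    (i1.const_mul _).sub (integrable_const _)
  rw [integral_sub i2 i3, integral_sub (i1.const_mul _) (integrable_const _), integral_const_mul, e] at h0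
  have e2 : ∫ z, c ^ 2 ∂μ = c ^ 2 := by simp [μ]
  rw [e2] at h0
  have : (w x - avg t w x) ^ 2 = c ^ 2 := by simp only [c]; ring
  rw [this]
  nlinarith

theorem exists_fin_meas : ∃ μ : Measure (Fin d → ℝ), IsFiniteMeasure μ ∧ μ ≤ volume ∧
    (volume : Measure (Fin d → ℝ)) ≪ μ := by
  obtain ⟨g, g0, gm, gi⟩ := exists_pos_lintegral_lt_of_sigmaFinite
    (volume : Measure (Fin d → ℝ)) (ε := 1) one_ne_zero
  set ρ : (Fin d → ℝ) → ENNReal := fun x => min (g x : ENNReal) 1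
  have hρ : Measurable ρ := by fun_prop
  refine ⟨volume.withDensity ρ, ⟨?_⟩, ?_, ?_⟩
  · rw [withDensity_apply _ MeasurableSet.univ, Measure.restrict_univ]
    refine (lintegral_mono fun x => min_le_left _ _).trans_lt (gi.trans (by simp))
  · refine (withDensity_mono (g := 1) (ae_of_all _ fun x => min_le_right _ _)).trans ?_
    rw [withDensity_one]
  · refine withDensity_absolutelyContinuous' hρ.aemeasurable (ae_of_all _ fun x => ?_)
    simp only [ρ]
    have := g0 x
    simp [this.ne']

theorem compact_ae {w : ℕ → (Fin d → ℝ) → ℝ} (hm : ∀ n, Measurable (w n)) {C : ℝ} (hC : 0 ≤ C)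
    (hw1 : ∀ n x, |w n x| ≤ 1)
    (h2 : ∀ n, ∫⁻ x, ENNReal.ofReal (w n x ^ 2) ≤ ENNReal.ofReal C) {C' : ℝ}
    (hE : ∀ j : ℕ, ∀ᶠ n in atTop, ∫⁻ z in QQ d, ∫⁻ y,
      ENNReal.ofReal ((w n (y + ((1:ℝ) / 2) ^ j • z) - w n y) ^ 2) ≤ ENNReal.ofReal (C' * ((1 / 2) ^ j) ^ 2)) :
    ∃ φ : ℕ → ℕ, StrictMono φ ∧ ∃ W : (Fin d → ℝ) → ℝ, Measurable W ∧
      ∀ᵐ x, Tendsto (fun n => w (φ n) x) atTop (𝓝 (W x)) := by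
  obtain ⟨φ, hφ, hl⟩ := weak_seq hm hC h2
  obtain ⟨μ, hμf, hμle, hμac⟩ := exists_fin_meas (d := d)
  have hfact : Fact ((1 : ENNReal) ≤ 1) := ⟨le_rfl⟩
  have hlim : ∀ (j : ℕ) x, ∃ l, Tendsto (fun n => avg ((1 / 2) ^ j) (w (φ n)) x) atTop (𝓝 l) := by
    intro j x
    obtain ⟨l, hl⟩ := hl (Metric.closedBall x ((1 / 2) ^ j / 2)) Metric.isClosed_closedBall.measurableSet
      measure_closedBall_lt_top.ne
    simp_rw [avg_eq (t := (1 / 2) ^ j) (by positivity)]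
    exact ⟨_, hl.const_mul _⟩
  choose Wj hWj using hlim
  have hWm : ∀ j, Measurable (Wj j) := fun j =>
    measurable_of_tendsto_metrizable (fun n => avg_meas (hm (φ n)) ((1 / 2) ^ j)) (tendsto_pi_nhds.2 (hWj j))
  have hWb : ∀ j x, |Wj j x| ≤ 1 := fun j x =>
    le_of_tendsto (hWj j x).abs (Eventually.of_forall fun n => avg_bdd (hw1 _) _ _)
  have m1 : ∀ n, MemLp (w (φ n)) 1 μ := fun n =>
    MemLp.of_bound (hm _).aestronglyMeasurable 1 (ae_of_all _ (hw1 _))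
  have m2 : ∀ j n, MemLp (avg ((1 / 2) ^ j) (w (φ n))) 1 μ := fun j n =>
    MemLp.of_bound (avg_meas (hm _) _).aestronglyMeasurable 1 (ae_of_all _ (avg_bdd (hw1 _) _))
  have m3 : ∀ j, MemLp (Wj j) 1 μ := fun j =>
    MemLp.of_bound (hWm j).aestronglyMeasurable 1 (ae_of_all _ (hWb j))
  have d1 : ∀ j : ℕ, ∀ᶠ n in atTop, edist ((m1 n).toLp (w (φ n))) ((m2 j n).toLp (avg ((1 / 2) ^ j) (w (φ n)))) ≤
      ENNReal.ofReal ((1 / 2) ^ j) * (μ Set.univ + ENNReal.ofReal C') := by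
    intro j
    filter_upwards [hφ.tendsto_atTop.eventually (hE j)] with n hn
    have hn := (avg_sq (hm (φ n)) (hw1 _) ((1 / 2) ^ j)).trans hn
    rw [Lp.edist_toLp_toLp, eLpNorm_one_eq_lintegral_enorm]
    set t : ℝ := (1 / 2) ^ j with ht
    have ht0 : 0 < t := by positivity
    have hav := avg_meas (hm (φ n)) t
    have hmm := hm (φ n)
    have p1 : ∀ x, ‖(w (φ n) - avg t (w (φ n))) x‖ₑ ≤ ENNReal.ofReal t +
        ENNReal.ofReal t⁻¹ * ENNReal.ofReal ((w (φ n) x - avg t (w (φ n)) x) ^ 2) := by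
      intro x
      rw [← ENNReal.ofReal_mul (by positivity), ← ENNReal.ofReal_add (by positivity) (by positivity),
        Real.enorm_eq_ofReal_abs]
      apply ENNReal.ofReal_le_ofReal
      simp only [Pi.sub_apply]
      generalize (w (φ n) x - avg t (w (φ n)) x) = y
      rw [← sq_abs]
      have hy := abs_nonneg y
      generalize |y| = y at *
      rcases le_total y t with h | h
      · have : 0 ≤ t⁻¹ * y ^ 2 := by positivity
        linarith
      · have : t⁻¹ * y ^ 2 = (y / t) * y := by field_simp
        rw [this]
        have : 1 ≤ y / t := by rw [le_div_iff₀ ht0]; linarith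
        nlinarith
    refine (lintegral_mono p1).trans ?_
    rw [lintegral_add_left (by fun_prop), lintegral_const, lintegral_const_mul _ (by fun_prop), mul_add]
    refine add_le_add le_rfl ?_
    calc _ ≤ ENNReal.ofReal t⁻¹ * ENNReal.ofReal (C' * t ^ 2) := by
            gcongr
            exact (lintegral_mono' hμle le_rfl).trans hn
      _ = _ := by
        rw [← ENNReal.ofReal_mul (by positivity), ← ENNReal.ofReal_mul (by positivity)]
        congr 1; field_simp
  have d2 : ∀ j : ℕ, Tendsto (fun n => edist ((m2 j n).toLp (avg ((1 / 2) ^ j) (w (φ n)))) ((m3 j).toLp (Wj j)))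
      atTop (𝓝 0) := by
    intro j
    simp_rw [Lp.edist_toLp_toLp, eLpNorm_one_eq_lintegral_enorm]
    have : Tendsto (fun n => ∫⁻ x, ‖(avg ((1 / 2) ^ j) (w (φ n)) - Wj j) x‖ₑ ∂μ) atTop
        (𝓝 (∫⁻ x, 0 ∂μ)) := by
      refine tendsto_lintegral_of_dominated_convergence (fun _ => ENNReal.ofReal 2) ?_ ?_ ?_ ?_
      · intro n
        have := avg_meas (hm (φ n)) ((1 / 2) ^ j)
        have := hWm j
        exact (Measurable.sub ‹_› ‹_›).enorm
      · intro n
        refine ae_of_all _ fun x => ?_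
        beta_reduce
        rw [Real.enorm_eq_ofReal_abs]
        apply ENNReal.ofReal_le_ofReal
        have h1 := avg_bdd (hw1 (φ n)) ((1 / 2) ^ j) x
        have h2 := hWb j x
        simp only [Pi.sub_apply]
        exact (abs_sub _ _).trans (by linarith)
      · rw [lintegral_const]
        exact ENNReal.mul_ne_top ENNReal.ofReal_ne_top (measure_ne_top _ _)
      · refine ae_of_all _ fun x => ?_
        have h1 : Tendsto (fun n => avg ((1 / 2) ^ j) (w (φ n)) x - Wj j x) atTop (𝓝 (Wj j x - Wj j x)) :=
          (hWj j x).sub tendsto_const_nhds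
        rw [sub_self] at h1
        have h2 := h1.enorm
        rwa [enorm_zero] at h2
    simpa using this
  have hcau : CauchySeq (fun n => (m1 n).toLp (w (φ n))) := by
    rw [EMetric.cauchySeq_iff]
    intro e he
    -- choose j
    have hK : μ Set.univ + ENNReal.ofReal C' ≠ ⊤ := by simp
    have hj : Tendsto (fun j : ℕ => ENNReal.ofReal ((1 / 2) ^ j) * (μ Set.univ + ENNReal.ofReal C')) atTop (𝓝 0) := by
      have h1 : Tendsto (fun j : ℕ => ENNReal.ofReal ((1 / 2) ^ j)) atTop (𝓝 (ENNReal.ofReal 0)) :=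
        ENNReal.tendsto_ofReal (tendsto_pow_atTop_nhds_zero_of_lt_one (by norm_num) (by norm_num))
      have h2 := ENNReal.Tendsto.mul_const (b := μ Set.univ + ENNReal.ofReal C') h1 (Or.inr hK)
      simpa using h2
    have he4 : 0 < e / 4 := ENNReal.div_pos he.ne' (by norm_num)
    obtain ⟨j, hj⟩ := (hj.eventually (gt_mem_nhds he4)).exists
    obtain ⟨N1, hN1⟩ := eventually_atTop.1 (d1 j)
    obtain ⟨N2, hN2⟩ := eventually_atTop.1 ((d2 j).eventually (gt_mem_nhds he4))
    refine ⟨max N1 N2, fun m hm' n hn' => ?_⟩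
    have a1 := (hN1 m ((le_max_left _ _).trans hm')).trans_lt hj
    have a2 := (hN1 n ((le_max_left _ _).trans hn')).trans_lt hj
    have a3 := hN2 m ((le_max_right _ _).trans hm')
    have a4 := hN2 n ((le_max_right _ _).trans hn')
    set A := (m1 m).toLp (w (φ m))
    set A' := (m1 n).toLp (w (φ n))
    set B := (m2 j m).toLp (avg ((1 / 2) ^ j) (w (φ m)))
    set B' := (m2 j n).toLp (avg ((1 / 2) ^ j) (w (φ n)))
    set G := (m3 j).toLp (Wj j)
    have t1 : edist A A' ≤ (edist A B + edist B G) + (edist A' B' + edist B' G) := by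
      refine (edist_triangle A G A').trans ?_
      rw [edist_comm G A']
      exact add_le_add (edist_triangle _ _ _) (edist_triangle _ _ _)
    refine t1.trans_lt ((ENNReal.add_lt_add (ENNReal.add_lt_add a1 a3) (ENNReal.add_lt_add a2 a4)).trans_le
      (le_of_eq ?_))
    have : e / 4 + e / 4 + (e / 4 + e / 4) = 4 * (e / 4) := by ring
    rw [this]
    exact ENNReal.mul_div_cancel (by norm_num) (by norm_num)
  obtain ⟨W, hW⟩ := cauchySeq_tendsto_of_complete hcau
  obtain ⟨ns, hns, hae⟩ := (tendstoInMeasure_of_tendsto_Lp hW).exists_seq_tendsto_ae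
  refine ⟨φ ∘ ns, hφ.comp hns, W, (Lp.stronglyMeasurable W).measurable, ?_⟩
  refine hμac.ae_le (?_ : ∀ᵐ x ∂μ, _)
  have hall : ∀ᵐ x ∂μ, ∀ n, (m1 n).toLp (w (φ n)) x = w (φ n) x :=
    ae_all_iff.2 fun n => (m1 n).coeFn_toLp
  filter_upwards [hae, hall] with x h1 h2
  refine h1.congr fun n => ?_
  rw [h2]; rfl

end Weak


open MeasureTheory Filter Topology

section Closure

variable {d : ℕ}

theorem fatou_liminf {α : Type*} [MeasurableSpace α] {μ : Measure α} {F : ℕ → α → ENNReal} {G : α → ENNReal}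
    (hF : ∀ n, Measurable (F n)) (h : ∀ᵐ x ∂μ, Tendsto (fun n => F n x) atTop (𝓝 (G x))) :
    ∫⁻ x, G x ∂μ ≤ liminf (fun n => ∫⁻ x, F n x ∂μ) atTop := by
  have : ∫⁻ x, G x ∂μ = ∫⁻ x, liminf (fun n => F n x) atTop ∂μ := by
    refine lintegral_congr_ae ?_
    filter_upwards [h] with x hx
    exact hx.liminf_eq.symm
  rw [this]
  exact lintegral_liminf_le hF

theorem liminf_le_of_ev {x : ℕ → ENNReal} {c : ENNReal} (h : ∀ᶠ n in atTop, x n ≤ c) :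
    liminf x atTop ≤ c := by
  refine (liminf_le_liminf h).trans ?_
  simp

theorem ww_abs (r : ℝ) : |ww r| = th1 |r| := good_th1.abs_oddE r

theorem ww_cont : Continuous ww := by
  have : ww = fun r => r / (1 + |r|) := funext ww_eq
  rw [this]
  exact Continuous.div (by fun_prop) (by fun_prop) (fun r => by positivity)

theorem thl_cont {δ : ℝ} : Continuous (fun r : ℝ => thl δ |r|) := by
  unfold thl
  refine continuous_const.min (continuous_const.mul ?_)
  exact Continuous.log (by fun_prop) (fun r => by positivity)

/-- the inverse of `ww` -/
noncomputable def gg (s : ℝ) : ℝ := s / (1 - |s|)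

theorem gg_ww (r : ℝ) : gg (ww r) = r := by
  have h : 0 < 1 + |r| := by positivity
  have : 1 - |ww r| = 1 / (1 + |r|) := by
    rw [ww_abs, th1]; field_simp; ring
  rw [gg, this, ww_eq]; field_simp

theorem Bd.shift_ae {u : ℕ → (Fin d → ℝ) → ℝ} {v : (Fin d → ℝ) → ℝ}
    (h : ∀ᵐ x, Tendsto (fun n => u n x) atTop (𝓝 (v x))) (a : Fin d → ℝ) :
    ∀ᵐ x, Tendsto (fun n => u n (x + a)) atTop (𝓝 (v (x + a))) :=
  (measurePreserving_add_right (volume : Measure (Fin d → ℝ)) a).quasiMeasurePreserving.ae h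

theorem Bd.limit {u : ℕ → (Fin d → ℝ) → ℝ} {v : (Fin d → ℝ) → ℝ} {C : ℝ} {δ : ℕ → ℝ}
    (hB : ∀ n, Bd C δ (u n)) (vm : Measurable v)
    (h : ∀ᵐ x, Tendsto (fun n => u n x) atTop (𝓝 (v x))) : Bd C δ v where
  meas := vm
  l1 := by
    have um := fun n => (hB n).meas
    refine (fatou_liminf (F := fun n x => ENNReal.ofReal |u n x|) (fun n => ?_) ?_).trans
      (liminf_le_of_ev (Eventually.of_forall fun n => (hB n).l1))
    · have := um n; fun_prop
    · filter_upwards [h] with x hx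
      exact ENNReal.tendsto_ofReal hx.abs
  tail k := by
    have um := fun n => (hB n).meas
    refine (fatou_liminf (F := fun n x => ENNReal.ofReal (|u n x| * thl (δ k) |u n x|)) (fun n => ?_) ?_).trans
      (liminf_le_of_ev (Eventually.of_forall fun n => (hB n).tail k))
    · exact (((um n).abs).mul (thl_cont.measurable.comp (um n))).ennreal_ofReal
    · filter_upwards [h] with x hx
      exact ENNReal.tendsto_ofReal (hx.abs.mul ((thl_cont.tendsto _).comp hx))

theorem Enr_limit {u : ℕ → (Fin d → ℝ) → ℝ} {v : (Fin d → ℝ) → ℝ} (um : ∀ n, Measurable (u n)) {t : ℝ}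
    {c : ENNReal} (h : ∀ᵐ x, Tendsto (fun n => u n x) atTop (𝓝 (v x)))
    (hE : ∀ᶠ n in atTop, Enr (u n) t ≤ c) : Enr v t ≤ c := by
  refine le_trans ?_ (liminf_le_of_ev hE)
  unfold Enr
  refine le_trans ?_ (lintegral_liminf_le (fun n => enr_meas (um n) t))
  refine lintegral_mono fun z => ?_
  refine fatou_liminf (fun n => ?_) ?_
  · have := um n
    have := ww_meas
    fun_prop
  · filter_upwards [h, Bd.shift_ae h (t • z)] with x h1 h2
    have a1 := (ww_cont.tendsto _).comp h1
    have a2 := (ww_cont.tendsto _).comp h2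
    exact ENNReal.tendsto_ofReal ((a2.sub a1).pow 2)

/-- clamp -/
noncomputable def clamp (M r : ℝ) : ℝ := max (-M) (min M r)

theorem clamp_cont (M : ℝ) : Continuous (clamp M) := by unfold clamp; fun_prop

theorem clamp_abs {M : ℝ} (hM : 0 ≤ M) (r : ℝ) : |clamp M r| ≤ M := by
  unfold clamp
  rw [abs_le]
  exact ⟨le_max_left _ _, max_le (by linarith) (min_le_left _ _)⟩

theorem clamp_eq {M r : ℝ} (h : |r| ≤ M) : clamp M r = r := by
  unfold clamp
  rw [abs_le] at h
  rw [min_eq_right h.2, max_eq_right h.1]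

theorem clamp_abs_le {M : ℝ} (hM : 0 ≤ M) (r : ℝ) : |clamp M r| ≤ |r| := by
  rcases le_total |r| M with h | h
  · rw [clamp_eq h]
  · exact (clamp_abs hM r).trans h

theorem clamp_lip (M r s : ℝ) : |clamp M r - clamp M s| ≤ |r - s| := by
  unfold clamp
  refine (abs_max_sub_max_le_max _ _ _ _).trans ?_
  refine max_le (by simp) ((abs_min_sub_min_le_max _ _ _ _).trans (max_le (by simp) le_rfl))

theorem clamp_mono (M : ℝ) : Monotone (clamp M) := fun a b h =>
  max_le_max le_rfl (min_le_min le_rfl h)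

theorem sub_clamp_le {M : ℝ} (hM : 0 ≤ M) (r : ℝ) : |r - clamp M r| ≤ |r| := by
  unfold clamp
  rcases le_total 0 r with h | h
  · rcases le_total M r with h1 | h1
    · rw [min_eq_left h1, max_eq_right (by linarith), abs_of_nonneg (by linarith), abs_of_nonneg h]; linarith
    · rw [min_eq_right h1, max_eq_right (by linarith)]; simp
  · rw [min_eq_right (by linarith)]
    rcases le_total (-M) r with h1 | h1
    · rw [max_eq_right h1]; simp
    · rw [max_eq_left h1, abs_of_nonpos (by linarith), abs_of_nonpos h]; linarith

theorem sub_clamp_tail {δ r : ℝ} (hδ : 0 < δ) :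
    |r - clamp (Real.exp (1 / δ)) r| ≤ |r| * thl δ |r| := by
  rcases le_total |r| (Real.exp (1 / δ)) with h | h
  · rw [clamp_eq h]
    simp only [sub_self, abs_zero]
    exact mul_nonneg (abs_nonneg _) ((good_thl hδ.le).nonneg (abs_nonneg _))
  · have : thl δ |r| = 1 := by
      unfold thl
      apply min_eq_left
      have h1 : 1 / δ ≤ Real.log (1 + |r|) := by
        rw [Real.le_log_iff_exp_le (by positivity)]; linarith
      have := mul_le_mul_of_nonneg_left h1 hδ.le
      rwa [mul_one_div_cancel hδ.ne'] at this
    rw [this, mul_one]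
    exact sub_clamp_le (Real.exp_pos _).le r

theorem l1loc_limit {u : ℕ → (Fin d → ℝ) → ℝ} {v : (Fin d → ℝ) → ℝ} {C : ℝ} {δ : ℕ → ℝ}
    (hδ : ∀ k, 0 < δ k) (hB : ∀ n, Bd C δ (u n)) (hv : Bd C δ v)
    (h : ∀ᵐ x, Tendsto (fun n => u n x) atTop (𝓝 (v x))) (R : ℝ) :
    Tendsto (fun n => ∫⁻ x in Metric.closedBall 0 R, ENNReal.ofReal |u n x - v x|) atTop (𝓝 0) := by
  have um := fun n => (hB n).meas
  have vm := hv.meas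
  set μ := (volume : Measure (Fin d → ℝ)).restrict (Metric.closedBall 0 R) with hμ
  have hμf : IsFiniteMeasure μ := ⟨by
    rw [hμ, Measure.restrict_apply_univ]; exact measure_closedBall_lt_top⟩
  have hμle : μ ≤ volume := Measure.restrict_le_self
  have key : ∀ k : ℕ, Tendsto (fun n => ∫⁻ x, ENNReal.ofReal |clamp (Real.exp (1 / δ k)) (u n x) -
      clamp (Real.exp (1 / δ k)) (v x)| ∂μ) atTop (𝓝 0) := by
    intro k
    set M := Real.exp (1 / δ k)
    have hM : 0 ≤ M := (Real.exp_pos _).le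
    have hcm := (clamp_cont M).measurable
    have : Tendsto (fun n => ∫⁻ x, ENNReal.ofReal |clamp M (u n x) - clamp M (v x)| ∂μ) atTop
        (𝓝 (∫⁻ x, 0 ∂μ)) := by
      refine tendsto_lintegral_of_dominated_convergence (fun _ => ENNReal.ofReal (2 * M)) ?_ ?_ ?_ ?_
      · intro n
        have := um n
        fun_prop
      · intro n
        refine ae_of_all _ fun x => ENNReal.ofReal_le_ofReal ?_
        have h1 := clamp_abs hM (u n x)
        have h2 := clamp_abs hM (v x)
        exact (abs_sub _ _).trans (by linarith)
      · rw [lintegral_const]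
        exact ENNReal.mul_ne_top ENNReal.ofReal_ne_top (measure_ne_top _ _)
      · filter_upwards [ae_restrict_of_ae h] with x hx
        have h1 := ((((clamp_cont M).tendsto _).comp hx).sub_const (clamp M (v x))).abs
        have h2 := ENNReal.tendsto_ofReal h1
        simpa using h2
    simpa using this
  rw [ENNReal.tendsto_nhds_zero]
  intro e he
  have hk : Tendsto (fun k : ℕ => ENNReal.ofReal (1 / (k + 1))) atTop (𝓝 0) := by
    have := ENNReal.tendsto_ofReal tendsto_one_div_add_atTop_nhds_zero_nat
    simpa using this
  have he3 : 0 < e / 3 := ENNReal.div_pos he.ne' (by norm_num)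
  obtain ⟨k, hk⟩ := (hk.eventually (gt_mem_nhds he3)).exists
  filter_upwards [(key k).eventually (gt_mem_nhds he3)] with n hn
  set M := Real.exp (1 / δ k)
  have hcm := (clamp_cont M).measurable
  have hun := um n
  have tl : ∀ f : (Fin d → ℝ) → ℝ, Bd C δ f → ∫⁻ x, ENNReal.ofReal |f x - clamp M (f x)| ∂μ ≤ e / 3 := by
    intro f hf
    refine (lintegral_mono' hμle le_rfl).trans ((lintegral_mono fun x => ?_).trans ((hf.tail k).trans hk.le))
    exact ENNReal.ofReal_le_ofReal (sub_clamp_tail (hδ k))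
  have p : ∀ x, ENNReal.ofReal |u n x - v x| ≤ (ENNReal.ofReal |u n x - clamp M (u n x)| +
      ENNReal.ofReal |v x - clamp M (v x)|) + ENNReal.ofReal |clamp M (u n x) - clamp M (v x)| := by
    intro x
    rw [← ENNReal.ofReal_add (by positivity) (by positivity), ← ENNReal.ofReal_add (by positivity) (by positivity)]
    apply ENNReal.ofReal_le_ofReal
    have e1 : u n x - v x = (u n x - clamp M (u n x)) - (v x - clamp M (v x)) +
      (clamp M (u n x) - clamp M (v x)) := by ring
    rw [e1]
    exact (abs_add_le _ _).trans (add_le_add (abs_sub _ _) le_rfl)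
  refine (lintegral_mono p).trans ?_
  rw [lintegral_add_left (by fun_prop), lintegral_add_left (by fun_prop)]
  refine (add_le_add (add_le_add (tl _ (hB n)) (tl _ hv)) hn.le).trans (le_of_eq ?_)
  exact ENNReal.add_thirds e

theorem closure_lemma {u : ℕ → (Fin d → ℝ) → ℝ} {C C' : ℝ} (hC : 0 ≤ C) {δ : ℕ → ℝ}
    (hδ : ∀ k, 0 < δ k) (hB : ∀ n, Bd C δ (u n))
    (hE : ∀ j : ℕ, ∀ᶠ n in atTop, Enr (u n) ((1 / 2) ^ j) ≤ ENNReal.ofReal (C' * ((1 / 2) ^ j) ^ 2)) :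
    ∃ φ : ℕ → ℕ, StrictMono φ ∧ ∃ v : (Fin d → ℝ) → ℝ, Bd C δ v ∧
      (∀ j : ℕ, Enr v ((1 / 2) ^ j) ≤ ENNReal.ofReal (C' * ((1 / 2) ^ j) ^ 2)) ∧
      (∀ᵐ x, Tendsto (fun n => u (φ n) x) atTop (𝓝 (v x))) ∧
      ∀ R : ℝ, Tendsto (fun n => ∫⁻ x in Metric.closedBall 0 R, ENNReal.ofReal |u (φ n) x - v x|)
        atTop (𝓝 0) := by
  have um := fun n => (hB n).meas
  obtain ⟨φ, hφ, W, Wm, hW⟩ := compact_ae (w := fun n x => ww (u n x)) (fun n => ww_meas.comp (um n)) hC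
    (fun n x => good_ww.bdd _) (C' := C') (fun n => by
      refine (lintegral_mono fun x => ENNReal.ofReal_le_ofReal ?_).trans (hB n).l1
      have h1 := ww_lip 0 (u n x)
      have h2 := good_ww.bdd (u n x)
      rw [good_ww.zero, sub_zero, sub_zero] at h1
      have h3 := abs_nonneg (ww (u n x))
      rw [← sq_abs]
      nlinarith) hE
  have hfin : ∀ᵐ x, liminf (fun n => ENNReal.ofReal |u (φ n) x|) atTop < ⊤ := by
    refine ae_lt_top (Measurable.liminf fun n => ?_) ?_
    · have := um (φ n); fun_prop
    · refine ne_top_of_le_ne_top (ENNReal.ofReal_ne_top (r := C)) ?_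
      refine (lintegral_liminf_le fun n => ?_).trans
        (liminf_le_of_ev (Eventually.of_forall fun n => (hB (φ n)).l1))
      have := um (φ n); fun_prop
  have hWlt : ∀ᵐ x, |W x| < 1 := by
    filter_upwards [hW, hfin] with x h1 h2
    obtain ⟨M, hM1, hM2⟩ := ENNReal.lt_iff_exists_nnreal_btwn.1 h2
    have h3 := frequently_lt_of_liminf_lt (by isBoundedDefault) hM1
    have h4 : ∃ᶠ n in atTop, |ww (u (φ n) x)| ≤ th1 M := by
      refine h3.mono fun n hn => ?_
      rw [ww_abs]
      refine good_th1.mono _ _ (abs_nonneg _) ?_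
      have : ENNReal.ofReal |u (φ n) x| < ENNReal.ofReal M := by simpa using hn
      exact (ENNReal.ofReal_lt_ofReal_iff_of_nonneg (abs_nonneg _)).1 this |>.le
    refine (le_of_tendsto_of_frequently h1.abs h4).trans_lt ?_
    have : (0:ℝ) ≤ M := M.2
    rw [th1, div_lt_one (by linarith)]; linarith
  have gm : Measurable gg := by unfold gg; fun_prop
  have hae : ∀ᵐ x, Tendsto (fun n => u (φ n) x) atTop (𝓝 (gg (W x))) := by
    filter_upwards [hW, hWlt] with x h1 h2
    have hc : ContinuousAt gg (W x) := by
      unfold gg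
      exact ContinuousAt.div (by fun_prop) (by fun_prop) (by linarith)
    have h3 := hc.tendsto.comp h1
    refine h3.congr fun n => ?_
    simp only [Function.comp]
    exact gg_ww _
  have hv : Bd C δ (fun x => gg (W x)) := Bd.limit (fun n => hB (φ n)) (gm.comp Wm) hae
  refine ⟨φ, hφ, fun x => gg (W x), hv, fun j => ?_, hae, fun R => ?_⟩
  · exact Enr_limit (fun n => um (φ n)) hae (hφ.tendsto_atTop.eventually (hE j))
  · exact l1loc_limit hδ (fun n => hB (φ n)) hv hae R

/-- Generalized dominated convergence. -/
theorem gdct {u : ℕ → (Fin d → ℝ) → ℝ} {v : (Fin d → ℝ) → ℝ} {C : ℝ} {δ : ℕ → ℝ}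
    (hB : ∀ n, Bd C δ (u n)) (hv : Bd C δ v) {R : ℝ}
    (hl : Tendsto (fun n => ∫⁻ x in Metric.closedBall 0 R, ENNReal.ofReal |u n x - v x|) atTop (𝓝 0))
    {F : ℕ → (Fin d → ℝ) → ℝ} {G : (Fin d → ℝ) → ℝ} {K : ℝ} (hK : 0 ≤ K)
    (hFm : ∀ n, AEStronglyMeasurable (F n) volume)
    (hFb : ∀ᶠ n in atTop, ∀ x, |F n x| ≤ K * |u n x|)
    (hFs : ∀ᶠ n in atTop, ∀ x, x ∉ Metric.closedBall 0 R → F n x = 0)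
    (hae : ∀ᵐ x, Tendsto (fun n => F n x) atTop (𝓝 (G x)))
    (haeu : ∀ᵐ x, Tendsto (fun n => u n x) atTop (𝓝 (v x))) :
    Integrable G ∧ Tendsto (fun n => ∫ x, F n x) atTop (𝓝 (∫ x, G x)) := by
  have um := fun n => (hB n).meas
  have vm := hv.meas
  have vi : Integrable v := by
    refine ⟨vm.aestronglyMeasurable, ?_⟩
    rw [hasFiniteIntegral_iff_norm]
    exact hv.l1.trans_lt ENNReal.ofReal_lt_top
  have hGm : AEStronglyMeasurable G volume := aestronglyMeasurable_of_tendsto_ae _ hFm hae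
  have hGb : ∀ᵐ x, |G x| ≤ K * |v x| := by
    filter_upwards [hae, haeu] with x h1 h2
    refine le_of_tendsto_of_tendsto h1.abs (h2.abs.const_mul K) ?_
    filter_upwards [hFb] with n hn using hn x
  have hGs : ∀ᵐ x, x ∉ Metric.closedBall 0 R → G x = 0 := by
    filter_upwards [hae] with x h1 hx
    refine tendsto_nhds_unique h1 (tendsto_const_nhds.congr' ?_)
    filter_upwards [hFs] with n hn using (hn x hx).symm
  have hGi : Integrable G := (vi.abs.const_mul K).mono' hGm hGb
  refine ⟨hGi, ?_⟩
  have ui : ∀ n, Integrable (u n) := by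
    intro n
    refine ⟨(um n).aestronglyMeasurable, ?_⟩
    rw [hasFiniteIntegral_iff_norm]
    exact (hB n).l1.trans_lt ENNReal.ofReal_lt_top
  have hFi : ∀ᶠ n in atTop, Integrable (F n) := by
    filter_upwards [hFb] with n hn
    exact ((ui n).abs.const_mul K).mono' (hFm n) (ae_of_all _ hn)
  refine tendsto_integral_of_L1 G hGi.1 hFi ?_
  -- bound by a dominated part plus the L1 error
  have hdom : Tendsto (fun n => ∫⁻ x, ENNReal.ofReal (max (|F n x - G x| - K * |u n x - v x|) 0)) atTop
      (𝓝 (∫⁻ _ : Fin d → ℝ, 0)) := by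
    refine tendsto_lintegral_filter_of_dominated_convergence' (fun x => ENNReal.ofReal (2 * K * |v x|)) ?_ ?_ ?_ ?_
    · refine Eventually.of_forall fun n => ?_
      have h1 := (hFm n).aemeasurable
      have h2 := hGm.aemeasurable
      have h3 := um n
      fun_prop
    · filter_upwards [hFb] with n hn
      filter_upwards [hGb] with x hx
      apply ENNReal.ofReal_le_ofReal
      refine max_le ?_ (by positivity)
      have h1 := abs_sub (F n x) (G x)
      have h2 := hn x
      have h3 : |u n x| ≤ |u n x - v x| + |v x| := by
        have := abs_add_le (u n x - v x) (v x); simpa using this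
      have h4 := mul_le_mul_of_nonneg_left h3 hK
      linarith
    · rw [← ofReal_integral_eq_lintegral_ofReal (vi.abs.const_mul _) (ae_of_all _ fun x => by positivity)]
      exact ENNReal.ofReal_ne_top
    · filter_upwards [hae, haeu] with x h1 h2
      have h3 : Tendsto (fun n => max (|F n x - G x| - K * |u n x - v x|) 0) atTop
          (𝓝 (max (|G x - G x| - K * |v x - v x|) 0)) :=
        (((h1.sub_const _).abs).sub (((h2.sub_const _).abs).const_mul K)).max tendsto_const_nhds
      have h4 := ENNReal.tendsto_ofReal h3
      simpa using h4
  have hsum := hdom.add (ENNReal.Tendsto.const_mul (a := ENNReal.ofReal K) hl (Or.inr ENNReal.ofReal_ne_top))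
  simp only [lintegral_zero, mul_zero, add_zero] at hsum
  refine tendsto_of_tendsto_of_tendsto_of_le_of_le' tendsto_const_nhds hsum (Eventually.of_forall fun _ => zero_le) ?_
  filter_upwards [hFs] with n hn
  have hmeas : Measurable (fun x => ENNReal.ofReal |u n x - v x|) := by have := um n; fun_prop
  rw [← lintegral_const_mul _ hmeas, ← lintegral_indicator Metric.isClosed_closedBall.measurableSet,
    ← lintegral_add_right _ ((hmeas.const_mul _).indicator Metric.isClosed_closedBall.measurableSet)]
  refine lintegral_mono_ae ?_
  filter_upwards [hGs] with x hx
  by_cases hxB : x ∈ Metric.closedBall (0 : Fin d → ℝ) R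
  · rw [Set.indicator_of_mem hxB, ← ENNReal.ofReal_mul hK, ← ENNReal.ofReal_add (le_max_right _ _) (by positivity),
      Real.enorm_eq_ofReal_abs]
    apply ENNReal.ofReal_le_ofReal
    have := le_max_left (|F n x - G x| - K * |u n x - v x|) 0
    linarith
  · rw [hn x hxB, hx hxB]; simp

end Closure


open MeasureTheory Filter Topology

section Cons

variable {d : ℕ}

/-- mean value theorem for symmetric differences -/
theorem mvt_sym {g g' : ℝ → ℝ} (hg : ∀ t, HasDerivAt g (g' t) t) {ε : ℝ} (hε : 0 < ε) :
    ∃ ξ, |ξ| ≤ ε ∧ g ε - g (-ε) = 2 * ε * g' ξ := by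
  obtain ⟨c, hc, h⟩ := exists_hasDerivAt_eq_slope g g' (a := -ε) (b := ε) (by linarith)
    (fun t _ => (hg t).continuousAt.continuousWithinAt) (fun t _ => hg t)
  refine ⟨c, abs_le.2 ⟨hc.1.le, hc.2.le⟩, ?_⟩
  rw [h]; field_simp; ring

theorem second_diff {g g' g'' : ℝ → ℝ} (hg : ∀ t, HasDerivAt g (g' t) t)
    (hg' : ∀ t, HasDerivAt g' (g'' t) t) {ε : ℝ} (hε : 0 < ε) :
    ∃ ξ, |ξ| ≤ ε ∧ (g ε - g 0) + (g (-ε) - g 0) = ε ^ 2 * g'' ξ := by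
  have hn : ∀ t, HasDerivAt (fun t => g t + g (-t)) (g' t - g' (-t)) t := by
    intro t
    have h1 : HasDerivAt (fun t => g (-t)) (g' (-t) * -1) t :=
      HasDerivAt.comp t (hg (-t)) (hasDerivAt_neg t)
    exact ((hg t).add h1).congr_deriv (by ring)
  have h2 : ∀ t : ℝ, HasDerivAt (fun t : ℝ => t ^ 2) (2 * t) t := by
    intro t; simpa using hasDerivAt_pow 2 t
  obtain ⟨c, hc, h⟩ := exists_ratio_hasDerivAt_eq_ratio_slope (fun t => g t + g (-t))
    (fun t => g' t - g' (-t)) hε (fun t _ => (hn t).continuousAt.continuousWithinAt) (fun t _ => hn t)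
    (fun t => t ^ 2) (fun t => 2 * t) (fun t _ => (h2 t).continuousAt.continuousWithinAt) (fun t _ => h2 t)
  obtain ⟨ξ, hξ, h3⟩ := mvt_sym hg' hc.1
  refine ⟨ξ, hξ.trans hc.2.le, ?_⟩
  rw [h3] at h
  have hc0 : c ≠ 0 := hc.1.ne'
  simp only [neg_zero] at h
  have : 2 * c * (g ε + g (-ε) - (g 0 + g 0)) = 2 * c * (ε ^ 2 * g'' ξ) := by
    linear_combination -h
  have := mul_left_cancel₀ (by positivity) this
  linarith

theorem line_deriv {φ : (Fin d → ℝ) → ℝ} (hφ : Differentiable ℝ φ) (y q : Fin d → ℝ) (t : ℝ) :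
    HasDerivAt (fun t : ℝ => φ (y + t • q)) (fderiv ℝ φ (y + t • q) q) t := by
  have h1 : HasDerivAt (fun t : ℝ => y + t • q) q t := by
    simpa using ((hasDerivAt_id t).smul_const q).const_add y
  exact (hφ (y + t • q)).hasFDerivAt.comp_hasDerivAt t h1

theorem line_deriv2 {φ : (Fin d → ℝ) → ℝ} (hφ : ContDiff ℝ 2 φ) (y q : Fin d → ℝ) (t : ℝ) :
    HasDerivAt (fun t : ℝ => fderiv ℝ φ (y + t • q) q) (fderiv ℝ (fderiv ℝ φ) (y + t • q) q q) t := by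
  have h1 : HasDerivAt (fun t : ℝ => y + t • q) q t := by
    simpa using ((hasDerivAt_id t).smul_const q).const_add y
  have h2 : Differentiable ℝ (fderiv ℝ φ) :=
    (hφ.fderiv_right (m := 1) (by norm_num)).differentiable (by norm_num)
  have h3 := (h2 (y + t • q)).hasFDerivAt.comp_hasDerivAt t h1
  exact h3.clm_apply (hasDerivAt_const t q) |>.congr_deriv (by simp)

/-- The symmetrized test functional -/
noncomputable def JJ {Ω : Type*} (q : Ω → (Fin d → ℝ)) (S D : Ω → (Fin d → ℝ) → ℝ → ℝ)
    (φ : (Fin d → ℝ) → ℝ) (ε : ℝ) (ω : Ω) (y : Fin d → ℝ) (r : ℝ) : ℝ :=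
  (ε ^ 2)⁻¹ * (S ω (y + (ε / 2) • q ω) r * (φ (y + ε • q ω) - φ y)
      + S ω (y - (ε / 2) • q ω) r * (φ (y - ε • q ω) - φ y))
  + ε⁻¹ * (D ω (y + (ε / 2) • q ω) r * (φ (y + ε • q ω) - φ y)
      - D ω (y - (ε / 2) • q ω) r * (φ (y - ε • q ω) - φ y))

noncomputable def JL {Ω : Type*} (q : Ω → (Fin d → ℝ)) (S S1 D : Ω → (Fin d → ℝ) → ℝ → ℝ)
    (φ : (Fin d → ℝ) → ℝ) (ω : Ω) (y : Fin d → ℝ) (r : ℝ) : ℝ :=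
  S ω y r * fderiv ℝ (fderiv ℝ φ) y (q ω) (q ω) + S1 ω y r * fderiv ℝ φ y (q ω)
   + 2 * (D ω y r * fderiv ℝ φ y (q ω))

/-- Extra regularity of the scheme -/
structure Reg {Ω : Type*} (q : Ω → (Fin d → ℝ)) (S S1 D : Ω → (Fin d → ℝ) → ℝ → ℝ)
    (Qm L1 : ℝ) : Prop where
  q_bd : ∀ ω, ‖q ω‖ ≤ Qm
  Q_nn : 0 ≤ Qm
  L1_nn : 0 ≤ L1
  deriv : ∀ ω m r, HasDerivAt (fun t : ℝ => S ω (m + t • q ω) r) (S1 ω m r) 0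
  S1c : ∀ ω, Continuous (fun p : (Fin d → ℝ) × ℝ => S1 ω p.1 p.2)
  Sc : ∀ ω, Continuous (fun p : (Fin d → ℝ) × ℝ => S ω p.1 p.2)
  Dc : ∀ ω, Continuous (fun p : (Fin d → ℝ) × ℝ => D ω p.1 p.2)
  S1b : ∀ ω m r, |S1 ω m r| ≤ L1 * |r|
  Sb : ∀ ω m r, |S ω m r| ≤ L1 * |r|
  Db : ∀ ω m r, |D ω m r| ≤ L1 * |r|

variable {Ω : Type*} {q : Ω → (Fin d → ℝ)} {S S1 D : Ω → (Fin d → ℝ) → ℝ → ℝ} {Qm L1 : ℝ}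

theorem Reg.deriv' (h : Reg q S S1 D Qm L1) (ω : Ω) (m : Fin d → ℝ) (r t : ℝ) :
    HasDerivAt (fun t : ℝ => S ω (m + t • q ω) r) (S1 ω (m + t • q ω) r) t := by
  have h1 := h.deriv ω (m + t • q ω) r
  have h2 : HasDerivAt (fun s : ℝ => s - t) 1 t := (hasDerivAt_id t).sub_const t
  have h3 : HasDerivAt (fun t : ℝ => S ω (m + t • q ω) r) (S1 ω (m + t • q ω) r * 1) t := by
    have h1' : HasDerivAt (fun s : ℝ => S ω (m + t • q ω + s • q ω) r) (S1 ω (m + t • q ω) r) (t - t) := by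
      simpa using h1
    have h4 := HasDerivAt.comp (h := fun s : ℝ => s - t) t h1' h2
    refine h4.congr_of_eventuallyEq (Eventually.of_forall fun s => ?_)
    simp only [Function.comp]
    congr 1
    rw [add_assoc, ← add_smul]; congr 2; ring
  simpa using h3

/-- exact mean value representation -/
theorem Reg.repr (h : Reg q S S1 D Qm L1) {φ : (Fin d → ℝ) → ℝ} (hφ : ContDiff ℝ 2 φ) {ε : ℝ} (hε : 0 < ε)
    (ω : Ω) (y : Fin d → ℝ) (r : ℝ) :
    ∃ t1 t2 t3 t4 t5 : ℝ, (|t1| ≤ ε ∧ |t2| ≤ ε ∧ |t3| ≤ ε ∧ |t4| ≤ ε ∧ |t5| ≤ ε) ∧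
      JJ q S D φ ε ω y r =
      (S ω (y + (ε / 2) • q ω) r + S ω (y + (-(ε / 2)) • q ω) r) / 2
        * fderiv ℝ (fderiv ℝ φ) (y + t1 • q ω) (q ω) (q ω)
      + S1 ω (y + t2 • q ω) r * fderiv ℝ φ (y + t3 • q ω) (q ω)
      + D ω (y + (ε / 2) • q ω) r * fderiv ℝ φ (y + t4 • q ω) (q ω)
      + D ω (y + (-(ε / 2)) • q ω) r * fderiv ℝ φ (y + t5 • q ω) (q ω) := by
  have hφd : Differentiable ℝ φ := hφ.differentiable (by norm_num)
  obtain ⟨t1, h1, e1⟩ := second_diff (line_deriv hφd y (q ω)) (line_deriv2 hφ y (q ω)) hε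
  obtain ⟨t2, h2, e2⟩ := mvt_sym (h.deriv' ω y r) (half_pos hε)
  obtain ⟨t3, h3, e3⟩ := mvt_sym (line_deriv hφd y (q ω)) hε
  obtain ⟨t4, h4, e4⟩ := exists_hasDerivAt_eq_slope _ _ hε
    (fun t _ => (line_deriv hφd y (q ω) t).continuousAt.continuousWithinAt)
    (fun t _ => line_deriv hφd y (q ω) t)
  obtain ⟨t5, h5, e5⟩ := exists_hasDerivAt_eq_slope _ _ (a := -ε) (b := 0) (by linarith)
    (fun t _ => (line_deriv hφd y (q ω) t).continuousAt.continuousWithinAt)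
    (fun t _ => line_deriv hφd y (q ω) t)
  refine ⟨t1, t2, t3, t4, t5, ⟨h1, by linarith, h3, abs_le.2 ⟨by linarith [h4.1], h4.2.le⟩,
    abs_le.2 ⟨h5.1.le, by linarith [h5.2]⟩⟩, ?_⟩
  rw [e4, e5]
  simp only [zero_smul, add_zero] at e1 ⊢
  have ea : fderiv ℝ (fderiv ℝ φ) (y + t1 • q ω) (q ω) (q ω) = (φ (y + ε • q ω) - φ y + (φ (y + (-ε) • q ω) - φ y)) / ε ^ 2 := by
    rw [e1]; field_simp
  have eb : S1 ω (y + t2 • q ω) r = (S ω (y + (ε / 2) • q ω) r - S ω (y + (-(ε / 2)) • q ω) r) / ε := by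
    rw [e2]; field_simp
  have ec : fderiv ℝ φ (y + t3 • q ω) (q ω) = (φ (y + ε • q ω) - φ (y + (-ε) • q ω)) / (2 * ε) := by
    rw [e3]; field_simp
  rw [ea, eb, ec]
  have s1 : y - (ε / 2) • q ω = y + (-(ε / 2)) • q ω := by rw [neg_smul, sub_eq_add_neg]
  have s2 : y - ε • q ω = y + (-ε) • q ω := by rw [neg_smul, sub_eq_add_neg]
  rw [JJ, s1, s2]
  generalize φ (y + ε • q ω) = A1
  generalize φ (y + (-ε) • q ω) = A2
  generalize S ω (y + (ε / 2) • q ω) r = A3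
  generalize S ω (y + (-(ε / 2)) • q ω) r = A4
  generalize D ω (y + (ε / 2) • q ω) r = A5
  generalize D ω (y + (-(ε / 2)) • q ω) r = A6
  rw [sub_zero, zero_sub, neg_neg]
  field_simp
  ring

end Cons


open MeasureTheory Filter Topology

section Cons2

variable {d : ℕ}
variable {Ω : Type*} {q : Ω → (Fin d → ℝ)} {S S1 D : Ω → (Fin d → ℝ) → ℝ → ℝ} {Qm L1 : ℝ}

theorem Reg.JJ_bd (h : Reg q S S1 D Qm L1) {φ : (Fin d → ℝ) → ℝ} (hφ : ContDiff ℝ 2 φ)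
    {M : ℝ} (hM1 : ∀ y, ‖fderiv ℝ φ y‖ ≤ M) (hM2 : ∀ y, ‖fderiv ℝ (fderiv ℝ φ) y‖ ≤ M)
    {ε : ℝ} (hε : 0 < ε) (ω : Ω) (y : Fin d → ℝ) (r : ℝ) :
    |JJ q S D φ ε ω y r| ≤ L1 * (M * Qm * Qm + 3 * (M * Qm)) * |r| := by
  obtain ⟨t1, t2, t3, t4, t5, -, e⟩ := h.repr hφ hε ω y r
  rw [e]
  have hM : 0 ≤ M := (norm_nonneg _).trans (hM1 y)
  have hQ := h.Q_nn
  have hL := h.L1_nn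
  have f1 : ∀ z, |fderiv ℝ φ z (q ω)| ≤ M * Qm := fun z =>
    ((fderiv ℝ φ z).le_opNorm (q ω)).trans (mul_le_mul (hM1 z) (h.q_bd ω) (norm_nonneg _) hM)
  have f2 : ∀ z, |fderiv ℝ (fderiv ℝ φ) z (q ω) (q ω)| ≤ M * Qm * Qm := fun z =>
    ((fderiv ℝ (fderiv ℝ φ) z).le_opNorm₂ (q ω) (q ω)).trans (by
      have := hM2 z; have := h.q_bd ω; gcongr)
  have a1 : |(S ω (y + (ε / 2) • q ω) r + S ω (y + (-(ε / 2)) • q ω) r) / 2| ≤ L1 * |r| := by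
    rw [abs_div, abs_two, div_le_iff₀ two_pos]
    refine (abs_add_le _ _).trans ?_
    linarith [h.Sb ω (y + (ε / 2) • q ω) r, h.Sb ω (y + (-(ε / 2)) • q ω) r]
  have m1 : ∀ x z : ℝ, ∀ A B : ℝ, 0 ≤ A → |x| ≤ A → |z| ≤ B → |x * z| ≤ A * B := by
    intro x z A B hA h1 h2
    rw [abs_mul]; exact mul_le_mul h1 h2 (abs_nonneg _) hA
  have hA : 0 ≤ L1 * |r| := by positivity
  have b1 := m1 _ _ _ _ hA a1 (f2 (y + t1 • q ω))
  have b2 := m1 _ _ _ _ hA (h.S1b ω (y + t2 • q ω) r) (f1 (y + t3 • q ω))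
  have b3 := m1 _ _ _ _ hA (h.Db ω (y + (ε / 2) • q ω) r) (f1 (y + t4 • q ω))
  have b4 := m1 _ _ _ _ hA (h.Db ω (y + (-(ε / 2)) • q ω) r) (f1 (y + t5 • q ω))
  refine (abs_add_le _ _).trans ((add_le_add_left ((abs_add_le _ _).trans (add_le_add_left (abs_add_le _ _) _)) _).trans ?_)
  linarith

theorem Reg.JJ_lim (h : Reg q S S1 D Qm L1) {φ : (Fin d → ℝ) → ℝ} (hφ : ContDiff ℝ 2 φ)
    {ε : ℕ → ℝ} (hε : ∀ n, 0 < ε n) (hε0 : Tendsto ε atTop (𝓝 0)) {r : ℕ → ℝ} {r0 : ℝ}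
    (hr : Tendsto r atTop (𝓝 r0)) (ω : Ω) (y : Fin d → ℝ) :
    Tendsto (fun n => JJ q S D φ (ε n) ω y (r n)) atTop (𝓝 (JL q S S1 D φ ω y r0)) := by
  choose t1 t2 t3 t4 t5 ht e using fun n => h.repr hφ (hε n) ω y (r n)
  simp only [e]
  have tz : ∀ t : ℕ → ℝ, (∀ n, |t n| ≤ ε n) → Tendsto (fun n => y + t n • q ω) atTop (𝓝 y) := by
    intro t ht
    have h1 : Tendsto t atTop (𝓝 0) := squeeze_zero_norm ht hε0
    have := (h1.smul_const (q ω)).const_add y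
    simpa using this
  have z1 := tz t1 fun n => (ht n).1
  have z2 := tz t2 fun n => (ht n).2.1
  have z3 := tz t3 fun n => (ht n).2.2.1
  have z4 := tz t4 fun n => (ht n).2.2.2.1
  have z5 := tz t5 fun n => (ht n).2.2.2.2
  have z6 := tz (fun n => ε n / 2) fun n => by rw [abs_of_pos (half_pos (hε n))]; linarith [hε n]
  have z7 := tz (fun n => -(ε n / 2)) fun n => by rw [abs_neg, abs_of_pos (half_pos (hε n))]; linarith [hε n]
  have c1 : Continuous (fderiv ℝ φ) := hφ.continuous_fderiv (by norm_num)
  have c2 : Continuous (fderiv ℝ (fderiv ℝ φ)) :=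
    (hφ.fderiv_right (m := 1) (by norm_num)).continuous_fderiv (by norm_num)
  have d1 : Continuous (fun z => fderiv ℝ φ z (q ω)) := by fun_prop
  have d2 : Continuous (fun z => fderiv ℝ (fderiv ℝ φ) z (q ω) (q ω)) := by fun_prop
  have g1 := ((h.Sc ω).tendsto (y, r0)).comp (z6.prodMk_nhds hr)
  have g2 := ((h.Sc ω).tendsto (y, r0)).comp (z7.prodMk_nhds hr)
  have g3 := ((h.S1c ω).tendsto (y, r0)).comp (z2.prodMk_nhds hr)
  have g4 := ((h.Dc ω).tendsto (y, r0)).comp (z6.prodMk_nhds hr)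
  have g5 := ((h.Dc ω).tendsto (y, r0)).comp (z7.prodMk_nhds hr)
  have k1 := (d2.tendsto y).comp z1
  have k3 := (d1.tendsto y).comp z3
  have k4 := (d1.tendsto y).comp z4
  have k5 := (d1.tendsto y).comp z5
  have := ((((g1.add g2).div_const 2).mul k1).add (g3.mul k3)).add (g4.mul k4) |>.add (g5.mul k5)
  refine (this.congr fun n => rfl).trans (le_of_eq ?_)
  congr 1
  simp only [JL]; ring

variable [MeasurableSpace Ω] {κ : Ω → ℝ} {L C K : ℝ}

theorem Scheme.JJ_meas (h : Scheme q κ S D L C K) {φ : (Fin d → ℝ) → ℝ} (hφ : Continuous φ) (ε : ℝ)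
    {u : (Fin d → ℝ) → ℝ} (hu : Measurable u) :
    Measurable (fun p : Ω × (Fin d → ℝ) => JJ q S D φ ε p.1 p.2 (u p.2)) := by
  have hq := h.q_meas
  have hφm := hφ.measurable
  have e1 : Measurable (fun p : Ω × (Fin d → ℝ) => (p.1, (p.2 + (ε / 2) • q p.1, u p.2))) := by fun_prop
  have e2 : Measurable (fun p : Ω × (Fin d → ℝ) => (p.1, (p.2 - (ε / 2) • q p.1, u p.2))) := by fun_prop
  have s1 := h.S_meas.comp e1
  have s2 := h.S_meas.comp e2
  have s3 := h.D_meas.comp e1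
  have s4 := h.D_meas.comp e2
  have p1 : Measurable (fun p : Ω × (Fin d → ℝ) => φ (p.2 + ε • q p.1) - φ p.2) := by fun_prop
  have p2 : Measurable (fun p : Ω × (Fin d → ℝ) => φ (p.2 - ε • q p.1) - φ p.2) := by fun_prop
  exact (((s1.mul p1).add (s2.mul p2)).const_mul _).add (((s3.mul p1).sub (s4.mul p2)).const_mul _)

/-- Weak form in terms of `JJ`. -/
theorem weak_JJ {ν : Measure Ω} [IsFiniteMeasure ν] (h : Scheme q κ S D L C K) (hK : 0 ≤ K) {lam ε : ℝ}
    (hlam : 0 < lam) (hε : 0 < ε) (hεL : ε * L ≤ 1)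
    {u φ : (Fin d → ℝ) → ℝ} (hu : Measurable u) (hui : Integrable u) (hφ : Continuous φ)
    {M : ℝ} (hM : ∀ x, |φ x| ≤ M) :
    ∫ p, flux (Vsch q S D lam ε 1) (Vsch q S D lam ε (-1)) (fun ω => ε • q ω) u p
      * (φ (p.2 + ε • q p.1) - φ p.2) ∂(ν.prod volume)
    = ∫ p, lam * JJ q S D φ ε p.1 p.2 (u p.2) ∂(ν.prod volume) := by
  have g1 := h.goodV hK hlam hε hεL (σ := 1) (by simp)
  have g2 := h.goodV hK hlam hε hεL (σ := -1) (by simp)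
  have hq := h.q_meas
  have hφm := hφ.measurable
  have hh : Measurable (fun ω => ε • q ω) := by fun_prop
  have pm : Measurable (fun p : Ω × (Fin d → ℝ) => φ (p.2 + ε • q p.1) - φ p.2) := by fun_prop
  have iu : Integrable (fun p : Ω × (Fin d → ℝ) => u p.2) (ν.prod volume) := integrable_snd hui
  have hpb : ∀ p : Ω × (Fin d → ℝ), ‖φ (p.2 + ε • q p.1) - φ p.2‖ ≤ M + M := fun p =>
    (norm_sub_le _ _).trans (add_le_add (hM _) (hM _))
  have i1 : Integrable (fun p : Ω × (Fin d → ℝ) => Vsch q S D lam ε 1 p.1 p.2 (u p.2)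
      * (φ (p.2 + ε • q p.1) - φ p.2)) (ν.prod volume) :=
    (g1.integrable_comp measurable_snd (by fun_prop) iu).mul_bdd pm.aestronglyMeasurable (ae_of_all _ hpb)
  have i2 : Integrable (fun p : Ω × (Fin d → ℝ) => Vsch q S D lam ε (-1) p.1 p.2 (u (p.2 + ε • q p.1))
      * (φ (p.2 + ε • q p.1) - φ p.2)) (ν.prod volume) :=
    (g2.integrable_comp measurable_snd (by fun_prop) (integrable_shift hh iu)).mul_bdd
      pm.aestronglyMeasurable (ae_of_all _ hpb)
  simp only [flux, sub_mul]
  rw [integral_sub i1 i2, ← integral_shift_neg hh i2, ← integral_sub i1 (integrable_shift_neg hh i2)]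
  refine integral_congr_ae (ae_of_all _ fun p => ?_)
  simp only [Vsch, JJ, sub_add_cancel]
  have : p.2 - ε • q p.1 + (ε / 2) • q p.1 = p.2 - (ε / 2) • q p.1 := by module
  rw [this]
  field_simp
  ring

end Cons2


open MeasureTheory Filter Topology

section Cons3

variable {d : ℕ}

theorem Bd.integrable {C : ℝ} {δ : ℕ → ℝ} {u : (Fin d → ℝ) → ℝ} (h : Bd C δ u) : Integrable u := by
  refine ⟨h.meas.aestronglyMeasurable, ?_⟩
  rw [hasFiniteIntegral_iff_norm]
  exact h.l1.trans_lt ENNReal.ofReal_lt_top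

theorem supp_ball {φ : (Fin d → ℝ) → ℝ} (hc : HasCompactSupport φ) :
    ∃ R : ℝ, 0 ≤ R ∧ ∀ x, R < ‖x‖ → φ x = 0 := by
  obtain ⟨R, hR⟩ := hc.isCompact.isBounded.subset_closedBall 0
  refine ⟨max R 0, le_max_right _ _, fun x hx => ?_⟩
  by_contra h
  have := hR (subset_tsupport _ h)
  rw [mem_closedBall_zero_iff] at this
  exact absurd hx (not_lt.2 (this.trans (le_max_left _ _)))

theorem gb {E F : Type*} [NormedAddCommGroup E] [NormedSpace ℝ E] [NormedAddCommGroup F] [NormedSpace ℝ F]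
    {φ : E → F} (hφ : ContDiff ℝ 1 φ) (hc : HasCompactSupport φ) : ∃ M : ℝ, 0 ≤ M ∧ ∀ y, ‖fderiv ℝ φ y‖ ≤ M := by
  have c1 : Continuous (fderiv ℝ φ) := hφ.continuous_fderiv (by norm_num)
  obtain ⟨M, h⟩ := c1.bounded_above_of_compact_support (hc.fderiv ℝ)
  exact ⟨max M 0, le_max_right _ _, fun y => (h y).trans (le_max_left _ _)⟩

theorem test_bds {φ : (Fin d → ℝ) → ℝ} (hφ : ContDiff ℝ 2 φ) (hc : HasCompactSupport φ) :
    ∃ M : ℝ, 0 ≤ M ∧ (∀ y, |φ y| ≤ M) ∧ (∀ y, ‖fderiv ℝ φ y‖ ≤ M) ∧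
      ∀ y, ‖fderiv ℝ (fderiv ℝ φ) y‖ ≤ M := by
  obtain ⟨M0, h0⟩ := hφ.continuous.bounded_above_of_compact_support hc
  obtain ⟨M1, p1, h1⟩ := gb (hφ.of_le (by norm_num)) hc
  obtain ⟨M2, p2, h2⟩ := gb (hφ.fderiv_right (m := 1) (by norm_num)) (hc.fderiv ℝ)
  exact ⟨max M0 (max M1 M2), p1.trans ((le_max_left _ _).trans (le_max_right _ _)),
    fun y => (h0 y).trans (le_max_left _ _), fun y => (h1 y).trans ((le_max_left _ _).trans (le_max_right _ _)),
    fun y => (h2 y).trans ((le_max_right _ _).trans (le_max_right _ _))⟩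

/-- `∫ u_n φ → ∫ v φ`. -/
theorem lim_test {u : ℕ → (Fin d → ℝ) → ℝ} {v : (Fin d → ℝ) → ℝ} {C : ℝ} {δ : ℕ → ℝ}
    (hB : ∀ n, Bd C δ (u n)) (hv : Bd C δ v)
    (hl : ∀ R : ℝ, Tendsto (fun n => ∫⁻ x in Metric.closedBall 0 R, ENNReal.ofReal |u n x - v x|) atTop (𝓝 0))
    (haeu : ∀ᵐ x, Tendsto (fun n => u n x) atTop (𝓝 (v x)))
    {φ : (Fin d → ℝ) → ℝ} (hφ : ContDiff ℝ 2 φ) (hc : HasCompactSupport φ) :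
    Tendsto (fun n => ∫ x, u n x * φ x) atTop (𝓝 (∫ x, v x * φ x)) := by
  obtain ⟨R, hR0, hR⟩ := supp_ball hc
  obtain ⟨M, hM, hM0, -, -⟩ := test_bds hφ hc
  have hφm := hφ.continuous.measurable
  refine (gdct hB hv (hl R) hM (fun n => ?_) (Eventually.of_forall fun n x => ?_)
    (Eventually.of_forall fun n x hx => ?_) ?_ haeu).2
  · exact ((hB n).meas.mul hφm).aestronglyMeasurable
  · rw [abs_mul, mul_comm]; exact mul_le_mul_of_nonneg_right (hM0 x) (abs_nonneg _)
  · rw [mem_closedBall_zero_iff, not_le] at hx; rw [hR x hx, mul_zero]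
  · filter_upwards [haeu] with x hx using hx.mul_const _

variable {Ω : Type*} {q : Ω → (Fin d → ℝ)} {S S1 D : Ω → (Fin d → ℝ) → ℝ → ℝ} {Qm L1 : ℝ}
variable [MeasurableSpace Ω] {κ : Ω → ℝ} {L C K : ℝ} {ν : Measure Ω} [IsFiniteMeasure ν]

theorem lim_JJ (h : Scheme q κ S D L C K) (hr : Reg q S S1 D Qm L1)
    {u : ℕ → (Fin d → ℝ) → ℝ} {v : (Fin d → ℝ) → ℝ} {C : ℝ} {δ : ℕ → ℝ}
    (hB : ∀ n, Bd C δ (u n)) (hv : Bd C δ v)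
    (hl : ∀ R : ℝ, Tendsto (fun n => ∫⁻ x in Metric.closedBall 0 R, ENNReal.ofReal |u n x - v x|) atTop (𝓝 0))
    (haeu : ∀ᵐ x, Tendsto (fun n => u n x) atTop (𝓝 (v x)))
    {ε : ℕ → ℝ} (hε : ∀ n, 0 < ε n) (hε0 : Tendsto ε atTop (𝓝 0))
    {φ : (Fin d → ℝ) → ℝ} (hφ : ContDiff ℝ 2 φ) (hc : HasCompactSupport φ) :
    Tendsto (fun n => ∫ p, JJ q S D φ (ε n) p.1 p.2 (u n p.2) ∂(ν.prod volume)) atTop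
      (𝓝 (∫ y, ∫ ω, JL q S S1 D φ ω y (v y) ∂ν)) := by
  obtain ⟨R, hR0, hR⟩ := supp_ball hc
  obtain ⟨M, hM, hM0, hM1, hM2⟩ := test_bds hφ hc
  have hQ := hr.Q_nn
  have hL := hr.L1_nn
  set K0 := L1 * (M * Qm * Qm + 3 * (M * Qm)) with hK0
  have hK0nn : 0 ≤ K0 := by positivity
  have hJb := fun n ω y r => hr.JJ_bd hφ hM1 hM2 (hε n) ω y r
  have hm := fun n => h.JJ_meas hφ.continuous (ε n) (hB n).meas
  have hi : ∀ n, Integrable (fun p : Ω × (Fin d → ℝ) => JJ q S D φ (ε n) p.1 p.2 (u n p.2)) (ν.prod volume) := by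
    intro n
    refine ((integrable_snd (ν := ν) (hB n).integrable).abs.const_mul K0).mono' (hm n).aestronglyMeasurable ?_
    exact ae_of_all _ fun p => hJb n _ _ _
  have he : ∀ n, ∫ p, JJ q S D φ (ε n) p.1 p.2 (u n p.2) ∂(ν.prod volume)
      = ∫ y, ∫ ω, JJ q S D φ (ε n) ω y (u n y) ∂ν := fun n => integral_prod_symm _ (hi n)
  simp only [he]
  refine (gdct hB hv (hl (R + 1)) (K := K0 * ν.real Set.univ) (by positivity) (fun n => ?_)
    (Eventually.of_forall fun n x => ?_) ?_ ?_ haeu).2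
  · exact (hi n).integral_prod_right.aestronglyMeasurable
  · have := norm_integral_le_of_norm_le_const (μ := ν) (f := fun ω => JJ q S D φ (ε n) ω x (u n x))
      (C := K0 * |u n x|) (ae_of_all _ fun ω => hJb n ω x (u n x))
    rw [Real.norm_eq_abs] at this
    refine this.trans (le_of_eq ?_); ring
  · have : ∀ᶠ n in atTop, ε n * Qm < 1 := by
      have := (hε0.mul_const Qm); rw [zero_mul] at this
      exact this.eventually (gt_mem_nhds one_pos)
    filter_upwards [this] with n hn x hx
    rw [mem_closedBall_zero_iff, not_le] at hx
    have z : ∀ ω, JJ q S D φ (ε n) ω x (u n x) = 0 := by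
      intro ω
      have hs : ‖ε n • q ω‖ < 1 := by
        rw [norm_smul, Real.norm_eq_abs, abs_of_pos (hε n)]
        exact (mul_le_mul_of_nonneg_left (hr.q_bd ω) (hε n).le).trans_lt hn
      have z1 : φ (x + ε n • q ω) = 0 := hR _ (by
        have := norm_sub_norm_le x (-(ε n • q ω)); rw [norm_neg, sub_neg_eq_add] at this; linarith)
      have z2 : φ (x - ε n • q ω) = 0 := hR _ (by
        have := norm_sub_norm_le x (ε n • q ω); linarith)
      have z3 : φ x = 0 := hR _ (by linarith)
      simp [JJ, z1, z2, z3]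
    simp [z]
  · filter_upwards [haeu] with y hy
    have hev : ∀ᶠ n in atTop, |u n y| ≤ |v y| + 1 :=
      (hy.abs.eventually (gt_mem_nhds (lt_add_one _))).mono fun _ h => h.le
    refine tendsto_integral_filter_of_dominated_convergence (fun _ => K0 * (|v y| + 1)) ?_ ?_
      (integrable_const _) (ae_of_all _ fun ω => hr.JJ_lim hφ hε hε0 hy ω y)
    · exact Eventually.of_forall fun n =>
        ((hm n).comp (measurable_id.prodMk measurable_const : Measurable fun ω : Ω => (ω, y))).aestronglyMeasurable
    · filter_upwards [hev] with n hn
      exact ae_of_all _ fun ω => (hJb n ω y (u n y)).trans (mul_le_mul_of_nonneg_left hn hK0nn)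

/-- First passage to the limit. -/
theorem pass1 (h : Scheme q κ S D L C K) (hr : Reg q S S1 D Qm L1) (hK : 0 ≤ K)
    {Km : ℝ} (hKm : ∫ ω, κ ω ∂ν ≤ Km) {κ0 : ℝ} (hκ00 : 0 < κ0)
    (hz : ∀ g : (Fin d → ℝ) → ENNReal, Measurable g →
      ENNReal.ofReal κ0 * ∫⁻ z in QQ d, g z ≤ ∫⁻ ω, ENNReal.ofReal (κ ω) * g (q ω) ∂ν)
    {lam : ℝ} (hlam : 0 < lam) {f : (Fin d → ℝ) → ℝ} (hf : Integrable f) {δ : ℕ → ℝ} (hδ : ∀ k, 0 < δ k)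
    (hδB : ∀ u : (Fin d → ℝ) → ℝ, Measurable u → Integrable u →
      ∫ x, |u x| ≤ ∫ x, |f x| →
      (∀ δ ψ, GoodPsi δ ψ → ∫ x, u x * ψ (u x) ≤ (∫ x, f x * ψ (u x)) + (4 * lam * C ^ 2 * Km * ∫ x, |f x|) * δ) →
      Bd (∫ x, |f x|) δ u) :
    ∃ v : (Fin d → ℝ) → ℝ, Bd (∫ x, |f x|) δ v ∧
      (∀ j : ℕ, Enr v ((1 / 2) ^ j) ≤ ENNReal.ofReal
        (2 * ((∫ x, |f x|) + 4 * lam * C ^ 2 * 4 * Km * ∫ x, |f x|) / (lam * κ0) * ((1 / 2) ^ j) ^ 2)) ∧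
      ∀ φ : (Fin d → ℝ) → ℝ, ContDiff ℝ 2 φ → HasCompactSupport φ →
        ∫ x, v x * φ x = (∫ x, f x * φ x) + lam * ∫ y, ∫ ω, JL q S S1 D φ ω y (v y) ∂ν := by
  have hnn : ∀ ψ : ℝ → ℝ, ∀ δ, GoodPsi δ ψ → ∀ r, 0 ≤ r * ψ r := by
    intro ψ δ hψ r
    rcases le_total 0 r with h0 | h0
    · exact mul_nonneg h0 (hψ.zero ▸ hψ.mono h0)
    · exact mul_nonneg_of_nonpos_of_nonpos h0 (hψ.zero ▸ hψ.mono h0)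
  have e0 : Tendsto (fun m : ℕ => ((1:ℝ) / 2) ^ m) atTop (𝓝 0) :=
    tendsto_pow_atTop_nhds_zero_of_lt_one (by norm_num) (by norm_num)
  obtain ⟨m0, hm0⟩ : ∃ m0 : ℕ, ∀ m, m0 ≤ m → ((1:ℝ) / 2) ^ m * L ≤ 1 ∧ 4 * (((1:ℝ) / 2) ^ m * C) ≤ 1 := by
    have t1 : Tendsto (fun m : ℕ => ((1:ℝ) / 2) ^ m * L) atTop (𝓝 0) := by simpa using e0.mul_const L
    have t2 : Tendsto (fun m : ℕ => 4 * (((1:ℝ) / 2) ^ m * C)) atTop (𝓝 0) := by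
      simpa using (e0.mul_const C).const_mul 4
    exact eventually_atTop.1 ((t1.eventually (ge_mem_nhds one_pos)).and (t2.eventually (ge_mem_nhds one_pos)))
  set ε : ℕ → ℝ := fun n => (1 / 2) ^ (n + m0) with hεd
  have hε : ∀ n, 0 < ε n := fun n => by positivity
  have hε0 : Tendsto ε atTop (𝓝 0) := e0.comp (tendsto_add_atTop_nat m0)
  choose u um ui ule uw ue using fun n => h.energy hK (ν := ν) hKm hlam (hε n)
    (hm0 (n + m0) (by omega)).1 (hm0 (n + m0) (by omega)).2 hf
  have hB : ∀ n, Bd (∫ x, |f x|) δ (u n) := by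
    intro n
    refine hδB _ (um n) (ui n) (ule n) fun δ' ψ hψ => ?_
    have h1 := (ue n δ' ψ hψ).2
    have h2 : 0 ≤ lam / 2 * (ε n ^ 2)⁻¹ * ∫ p : Ω × (Fin d → ℝ),
          κ p.1 * ((u n (p.2 + ε n • q p.1) - u n p.2) *
            (ψ (u n (p.2 + ε n • q p.1)) - ψ (u n p.2))) ∂(ν.prod volume) := by
      refine mul_nonneg (by positivity) (integral_nonneg fun p => mul_nonneg (h.κ_nn _) ?_)
      rcases le_total (u n p.2) (u n (p.2 + ε n • q p.1)) with h0 | h0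
      · exact mul_nonneg (sub_nonneg.2 h0) (sub_nonneg.2 (hψ.mono h0))
      · exact mul_nonneg_of_nonpos_of_nonpos (sub_nonpos.2 h0) (sub_nonpos.2 (hψ.mono h0))
    linarith
  set B0 : ℝ := (∫ x, |f x|) + 4 * lam * C ^ 2 * 4 * Km * ∫ x, |f x| with hB0
  have hE0 : ∀ n, Enr (u n) (ε n) ≤ ENNReal.ofReal (2 * B0 / (lam * κ0) * ε n ^ 2) := by
    intro n
    have h1 := ue n 4 ww good_ww
    refine enr_of_energy h.q_meas h.κ_meas h.κ_nn hκ00 hz (um n) hlam (hε n) h1.1 ?_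
    have h2 : 0 ≤ ∫ x, u n x * ww (u n x) := integral_nonneg fun x => hnn _ _ good_ww _
    have h3 : ∫ x, f x * ww (u n x) ≤ ∫ x, |f x| := by
      have wm := ww_meas.comp (um n)
      refine integral_mono (hf.mul_bdd wm.aestronglyMeasurable (ae_of_all _ fun x => good_ww.bdd _)) hf.abs fun x => ?_
      have := good_ww.bdd (u n x)
      refine (le_abs_self _).trans ?_
      rw [abs_mul]
      exact mul_le_of_le_one_right (abs_nonneg _) this
    linarith [h1.2]
  have hE : ∀ j : ℕ, ∀ᶠ n in atTop, Enr (u n) ((1 / 2) ^ j) ≤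
      ENNReal.ofReal (2 * B0 / (lam * κ0) * ((1 / 2) ^ j) ^ 2) := by
    intro j
    filter_upwards [eventually_ge_atTop j] with n hn
    exact enr_dyadic (um n) (hE0 n) (by omega)
  obtain ⟨s, hs, v, vB, vE, vae, vl⟩ := closure_lemma (integral_nonneg fun x => abs_nonneg _) hδ hB hE
  refine ⟨v, vB, vE, fun φ hφ hc => ?_⟩
  obtain ⟨M, hM, hM0, -, -⟩ := test_bds hφ hc
  have l1 := lim_test (fun n => hB (s n)) vB vl vae hφ hc
  have l2 := lim_JJ (ν := ν) h hr (fun n => hB (s n)) vB vl vae (fun n => hε (s n))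
    (hε0.comp hs.tendsto_atTop) hφ hc
  refine tendsto_nhds_unique l1 (((l2.const_mul lam).const_add (∫ x, f x * φ x)).congr fun n => ?_)
  rw [uw (s n) φ hφ.continuous.measurable ⟨M, hM0⟩,
    weak_JJ h hK hlam (hε (s n)) (hm0 (s n + m0) (by omega)).1 (um (s n)) (ui (s n)) hφ.continuous hM0,
    integral_const_mul]

end Cons3


open MeasureTheory Filter Topology

section Decomp

variable {d : ℕ}

theorem entry_id (η : ℝ) (Em : Fin d → Fin d → ℝ) (hs : ∀ i j, Em i j = Em j i) (a b : Fin d) :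
    ∑ i, ∑ j, ((η + Em i j / 4) * ((Pi.single i (1:ℝ) + Pi.single j 1 : Fin d → ℝ) a * (Pi.single i (1:ℝ) + Pi.single j 1 : Fin d → ℝ) b)
      + (η - Em i j / 4) * ((Pi.single i (1:ℝ) - Pi.single j 1 : Fin d → ℝ) a * (Pi.single i (1:ℝ) - Pi.single j 1 : Fin d → ℝ) b))
    = 4 * d * η * (if a = b then 1 else 0) + Em a b := by
  have h : ∀ i j, ((η + Em i j / 4) * ((Pi.single i (1:ℝ) + Pi.single j 1 : Fin d → ℝ) a * (Pi.single i (1:ℝ) + Pi.single j 1 : Fin d → ℝ) b)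
      + (η - Em i j / 4) * ((Pi.single i (1:ℝ) - Pi.single j 1 : Fin d → ℝ) a * (Pi.single i (1:ℝ) - Pi.single j 1 : Fin d → ℝ) b))
     = 2 * η * ((if a = i then 1 else 0) * (if b = i then 1 else 0)) + 2 * η * ((if a = j then 1 else 0) * (if b = j then 1 else 0))
      + (if a = i then 1 else 0) * ((if b = j then 1 else 0) * (Em i j / 2)) + (if b = i then 1 else 0) * ((if a = j then 1 else 0) * (Em i j / 2)) := by
    intro i j
    simp only [Pi.add_apply, Pi.sub_apply, Pi.single_apply]
    ring
  simp only [h, Finset.sum_add_distrib, ← Finset.mul_sum]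
  simp only [ite_mul, one_mul, zero_mul, Finset.sum_ite_eq, Finset.mem_univ, if_true, Finset.sum_const, Finset.card_univ,
    Fintype.card_fin, nsmul_eq_mul]
  rw [hs b a]
  have : (if b = a then (1:ℝ) else 0) = if a = b then 1 else 0 := by simp [eq_comm]
  rw [this]
  ring

open scoped MatrixOrder in
theorem psd_factor (M : Fin d → Fin d → ℝ) (hs : ∀ i j, M i j = M j i)
    (hp : ∀ ξ : Fin d → ℝ, 0 ≤ ∑ i, ∑ j, M i j * ξ i * ξ j) :
    ∃ B : Fin d → Fin d → ℝ, ∀ i j, M i j = ∑ k, B k i * B k j := by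
  have hP : (Matrix.of M).PosSemidef := by
    refine Matrix.PosSemidef.of_dotProduct_mulVec_nonneg ?_ fun x => ?_
    · ext i j; simp [hs i j]
    · have := hp x
      refine this.trans (le_of_eq ?_)
      simp only [dotProduct, Matrix.mulVec, Finset.mul_sum, Matrix.of_apply]
      refine Finset.sum_congr rfl fun i _ => Finset.sum_congr rfl fun j _ => ?_
      simp; ring
  have hB := CFC.sqrt_mul_sqrt_self (Matrix.of M) hP.nonneg
  have hH := (Matrix.nonneg_iff_posSemidef.1 (CFC.sqrt_nonneg (Matrix.of M))).1
  generalize CFC.sqrt (Matrix.of M) = B at hB hH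
  refine ⟨B, fun i j => ?_⟩
  have h1 := congrFun (congrFun hB i) j
  rw [Matrix.mul_apply, Matrix.of_apply] at h1
  rw [← h1]
  refine Finset.sum_congr rfl fun k _ => ?_
  have h2 := hH.apply i k
  rw [star_trivial] at h2
  rw [h2]

/-- Decomposition of a uniformly elliptic matrix field with fixed directions. -/
theorem decomp {X : Type} [NormedAddCommGroup X] [NormedSpace ℝ X] [FiniteDimensional ℝ X]
    (hd : 1 ≤ d) {G : Fin d → Fin d → X → ℝ} (hG : ∀ i j, ContDiff ℝ 1 (G i j))
    (hs : ∀ i j p, G i j p = G j i p) {Kc : Set X} (hK : IsCompact Kc) {γ : ℝ} (hγ : 0 < γ)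
    (hp : ∀ p ∈ Kc, ∀ ξ : Fin d → ℝ, γ * ∑ i, ξ i ^ 2 ≤ ∑ i, ∑ j, G i j p * ξ i * ξ j) :
    ∃ (I : Type) (_ : Fintype I) (q : I → Fin d → ℝ) (w : I → X → ℝ),
      (∀ k, ContDiff ℝ 1 (w k)) ∧ (∀ k p, 0 ≤ w k p) ∧
      ∀ p ∈ Kc, ∀ i j, ∑ k, w k p * (q k i * q k j) = G i j p := by
  have hd0 : (0:ℝ) < d := by exact_mod_cast hd
  set η : ℝ := γ / (4 * d) with hη
  have hη0 : 0 < η := by positivity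
  have hη4 : 4 * d * η = γ := by rw [hη]; field_simp
  let U : X → Set X := fun p0 => {p | ∀ i j, |G i j p - G i j p0| < 4 * η}
  have hUo : ∀ p0, IsOpen (U p0) := by
    intro p0
    simp only [U, Set.ofPred_forall]
    refine isOpen_iInter_of_finite fun i => isOpen_iInter_of_finite fun j => ?_
    have := (hG i j).continuous
    exact isOpen_lt (by fun_prop) continuous_const
  have hUm : ∀ p0, p0 ∈ U p0 := by intro p0 i j; simpa using hη0
  obtain ⟨t, htK, ht⟩ := hK.elim_nhds_subcover U fun p _ => (hUo p).mem_nhds (hUm p)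
  obtain ⟨ρ, hρ⟩ := SmoothPartitionOfUnity.exists_isSubordinate (modelWithCornersSelf ℝ X) hK.isClosed
    (fun l : t => U l) (fun l => hUo l) (by
      intro p hp
      obtain ⟨x, hx, hpx⟩ := Set.mem_iUnion₂.1 (ht hp)
      exact Set.mem_iUnion.2 ⟨⟨x, hx⟩, hpx⟩)
  have hρc : ∀ l, ContDiff ℝ 1 (ρ l) := fun l => (contMDiff_iff_contDiff.1 (ρ l).contMDiff).of_le (by exact_mod_cast le_top)
  have hρs : ∀ p ∈ Kc, ∑ l, ρ l p = 1 := by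
    intro p hp; have := ρ.sum_eq_one hp; rwa [finsum_eq_sum_of_fintype] at this
  have hρU : ∀ l p, ρ l p ≠ 0 → p ∈ U l := fun l p h => hρ l (subset_tsupport _ h)
  choose B hB using fun l : t => psd_factor (fun i j => G i j l - if i = j then γ else 0)
    (fun i j => by simp [hs i j, eq_comm]) (fun ξ => by
      have := hp l (htK l l.2) ξ
      have e : ∑ i, ∑ j, (G i j l - if i = j then γ else 0) * ξ i * ξ j
          = ∑ i, ∑ j, G i j l * ξ i * ξ j - γ * ∑ i, ξ i ^ 2 := by
        simp only [sub_mul, Finset.sum_sub_distrib, ite_mul, zero_mul, Finset.sum_ite_eq, Finset.mem_univ, if_true,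
          Finset.mul_sum]
        congr 1
        refine Finset.sum_congr rfl fun i _ => by ring
      rw [e]; linarith)
  refine ⟨t × (Fin d ⊕ ((Fin d × Fin d) ⊕ (Fin d × Fin d))), inferInstance,
    fun k => Sum.elim (fun m => B k.1 m) (Sum.elim (fun m => Pi.single m.1 1 + Pi.single m.2 1)
      (fun m => Pi.single m.1 1 - Pi.single m.2 1)) k.2,
    fun k => Sum.elim (fun _ => fun p => ρ k.1 p)
      (Sum.elim (fun m => fun p => ρ k.1 p * (η + (G m.1 m.2 p - G m.1 m.2 k.1) / 4))
        (fun m => fun p => ρ k.1 p * (η - (G m.1 m.2 p - G m.1 m.2 k.1) / 4))) k.2, ?_, ?_, ?_⟩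
  · rintro ⟨l, m | m | m⟩
    · exact hρc l
    · have := hG m.1 m.2; have := hρc l
      simp only [Sum.elim_inl, Sum.elim_inr]; fun_prop
    · have := hG m.1 m.2; have := hρc l
      simp only [Sum.elim_inl, Sum.elim_inr]; fun_prop
  · rintro ⟨l, m | m | m⟩ p
    · exact ρ.nonneg l p
    · by_cases h0 : ρ l p = 0
      · simp [h0]
      · have := abs_lt.1 (hρU l p h0 m.1 m.2)
        exact mul_nonneg (ρ.nonneg l p) (by linarith [this.1])
    · by_cases h0 : ρ l p = 0
      · simp [h0]
      · have := abs_lt.1 (hρU l p h0 m.1 m.2)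
        exact mul_nonneg (ρ.nonneg l p) (by linarith [this.2])
  · intro p hp i j
    rw [Fintype.sum_prod_type]
    have key : ∀ l : t, ∑ m : Fin d ⊕ ((Fin d × Fin d) ⊕ (Fin d × Fin d)),
      (Sum.elim (fun _ => fun p => ρ l p)
      (Sum.elim (fun m => fun p => ρ l p * (η + (G m.1 m.2 p - G m.1 m.2 l) / 4))
        (fun m => fun p => ρ l p * (η - (G m.1 m.2 p - G m.1 m.2 l) / 4))) m : X → ℝ) p *
      ((Sum.elim (fun m => B l m) (Sum.elim (fun m => Pi.single m.1 1 + Pi.single m.2 1)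
      (fun m => Pi.single m.1 1 - Pi.single m.2 1)) m : Fin d → ℝ) i *
      (Sum.elim (fun m => B l m) (Sum.elim (fun m => Pi.single m.1 1 + Pi.single m.2 1)
      (fun m => Pi.single m.1 1 - Pi.single m.2 1)) m : Fin d → ℝ) j) = ρ l p * G i j p := by
      intro l
      have e := entry_id η (fun i j => G i j p - G i j l) (fun i j => by rw [hs i j, hs i j]) i j
      rw [hη4] at e
      simp only [Fintype.sum_sum_type, Sum.elim_inl, Sum.elim_inr, Fintype.sum_prod_type]
      simp only [mul_assoc, ← Finset.mul_sum]
      rw [← hB l i j, ← mul_add, ← mul_add, ← Finset.sum_add_distrib]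
      simp only [← Finset.sum_add_distrib]
      rw [e]
      congr 1
      split_ifs <;> ring
    rw [Finset.sum_congr rfl fun l _ => key l, ← Finset.sum_mul, hρs p hp, one_mul]

end Decomp


open MeasureTheory Filter Topology

/-- Index set of jump families. -/
def JT (d : ℕ) (I : Type) : Type := Option (Fin d ⊕ I)

instance (d : ℕ) (I : Type) [Fintype I] : Fintype (JT d I) := inferInstanceAs (Fintype (Option (Fin d ⊕ I)))
instance (d : ℕ) (I : Type) : MeasurableSpace (JT d I) := ⊤
instance (d : ℕ) (I : Type) : DiscreteMeasurableSpace (JT d I) := ⟨fun _ => trivial⟩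

theorem JT.sum {d : ℕ} {I : Type} [Fintype I] {A : Type*} [AddCommMonoid A] (g : JT d I → A) :
    ∑ j, g j = g none + (∑ i : Fin d, g (some (Sum.inl i)) + ∑ k : I, g (some (Sum.inr k))) := by
  have h := Fintype.sum_option (α := Fin d ⊕ I) g
  rw [Fintype.sum_sum_type] at h
  exact h

section LevelJ

variable {d : ℕ} {I : Type}

noncomputable def qJ (qk : I → Fin d → ℝ) : JT d I × (Fin d → ℝ) → (Fin d → ℝ)
  | (none, z) => (QQ d).indicator id z
  | (some (Sum.inl i), _) => Pi.single i 1
  | (some (Sum.inr k), _) => qk k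

def kJ (d : ℕ) (I : Type) (κ0 κ' : ℝ) : JT d I → ℝ
  | none => κ0
  | some (Sum.inl _) => κ'
  | some (Sum.inr _) => 0

def sJ (κ0 κ' : ℝ) (Sk : I → (Fin d → ℝ) → ℝ → ℝ) : JT d I → (Fin d → ℝ) → ℝ → ℝ
  | none => fun _ r => κ0 * r
  | some (Sum.inl _) => fun _ r => κ' * r
  | some (Sum.inr k) => Sk k

def s1J (S1k : I → (Fin d → ℝ) → ℝ → ℝ) : JT d I → (Fin d → ℝ) → ℝ → ℝ
  | none => fun _ _ => 0
  | some (Sum.inl _) => fun _ _ => 0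
  | some (Sum.inr k) => S1k k

def dJ (H : Fin d → (Fin d → ℝ) → ℝ → ℝ) : JT d I → (Fin d → ℝ) → ℝ → ℝ
  | none => fun _ _ => 0
  | some (Sum.inl i) => H i
  | some (Sum.inr _) => fun _ _ => 0

/-- Data of a level. -/
structure Lev (qk : I → Fin d → ℝ) (Sk S1k : I → (Fin d → ℝ) → ℝ → ℝ) (H : Fin d → (Fin d → ℝ) → ℝ → ℝ)
    (κ' C L L1 : ℝ) : Prop where
  L_nn : 0 ≤ L
  L1_nn : 0 ≤ L1
  C_nn : 0 ≤ C
  κ_pos : 0 < κ'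
  Sc : ∀ k, Continuous (fun p : (Fin d → ℝ) × ℝ => Sk k p.1 p.2)
  S1c : ∀ k, Continuous (fun p : (Fin d → ℝ) × ℝ => S1k k p.1 p.2)
  Hc : ∀ i, Continuous (fun p : (Fin d → ℝ) × ℝ => H i p.1 p.2)
  S_zero : ∀ k y, Sk k y 0 = 0
  S_mono : ∀ k y, Monotone (Sk k y)
  S_lip : ∀ k y a b, |Sk k y a - Sk k y b| ≤ L * |a - b|
  S1b : ∀ k y r, |S1k k y r| ≤ L1 * |r|
  deriv : ∀ k m r, HasDerivAt (fun t : ℝ => Sk k (m + t • qk k) r) (S1k k m r) 0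
  H_lip : ∀ i y a b, |H i y a - H i y b| ≤ κ' * L * |a - b|
  H_bd : ∀ i y r, |H i y r| ≤ κ' * C * |r|

variable {qk : I → Fin d → ℝ} {Sk S1k : I → (Fin d → ℝ) → ℝ → ℝ} {H : Fin d → (Fin d → ℝ) → ℝ → ℝ}
    {κ' C L L1 κ0 : ℝ}

theorem qJ_meas [Fintype I] : Measurable (qJ qk : JT d I × (Fin d → ℝ) → (Fin d → ℝ)) := by
  refine measurable_from_prod_countable_right fun j => ?_
  rcases j with _ | i | k
  · exact measurable_id.indicator QQ_meas
  · exact measurable_const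
  · exact measurable_const

theorem meas_J [Fintype I] {s : JT d I → (Fin d → ℝ) → ℝ → ℝ}
    (hs : ∀ j, Continuous (fun p : (Fin d → ℝ) × ℝ => s j p.1 p.2)) :
    Measurable (fun p : (JT d I × (Fin d → ℝ)) × (Fin d → ℝ) × ℝ => s p.1.1 p.2.1 p.2.2) := by
  have h : Measurable (fun p : JT d I × ((Fin d → ℝ) × ℝ) => s p.1 p.2.1 p.2.2) :=
    measurable_from_prod_countable_right fun j => (hs j).measurable
  exact h.comp ((measurable_fst.comp measurable_fst).prodMk measurable_snd)

theorem Lev.scont (h : Lev qk Sk S1k H κ' C L L1) (j : JT d I) :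
    Continuous (fun p : (Fin d → ℝ) × ℝ => sJ κ0 κ' Sk j p.1 p.2) := by
  rcases j with _ | i | k
  · simp only [sJ]; fun_prop
  · simp only [sJ]; fun_prop
  · exact h.Sc k

theorem Lev.dcont (h : Lev qk Sk S1k H κ' C L L1) (j : JT d I) :
    Continuous (fun p : (Fin d → ℝ) × ℝ => dJ H j p.1 p.2) := by
  rcases j with _ | i | k
  · exact continuous_const
  · exact h.Hc i
  · exact continuous_const

theorem Lev.scheme [Fintype I] (h : Lev qk Sk S1k H κ' C L L1) (hκ0 : 0 < κ0) :
    Scheme (qJ qk) (fun ω => kJ d I κ0 κ' ω.1) (fun ω => sJ κ0 κ' Sk ω.1) (fun ω => dJ H ω.1)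
      (L + κ0 + κ') C (κ0 + κ') where
  q_meas := qJ_meas
  κ_meas := (Measurable.of_discrete (f := kJ d I κ0 κ')).comp measurable_fst
  κ_nn := by
    have := h.κ_pos
    rintro ⟨_ | i | k, z⟩ <;> simp only [kJ] <;> linarith
  κ_le := by
    have := h.κ_pos
    rintro ⟨_ | i | k, z⟩ <;> simp only [kJ] <;> linarith
  S_meas := meas_J h.scont
  D_meas := meas_J h.dcont
  S_zero := by
    rintro ⟨_ | i | k, z⟩ y
    · simp [sJ]
    · simp [sJ]
    · exact h.S_zero k y
  D_zero := by
    rintro ⟨_ | i | k, z⟩ y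
    · rfl
    · have := h.H_bd i y 0; simpa [dJ] using this
    · rfl
  S_slope := by
    rintro ⟨_ | i | k, z⟩ y a b hab
    · simp only [sJ, kJ]; linarith
    · simp only [sJ, kJ]; linarith
    · simp only [sJ, kJ]; have := h.S_mono k y hab; linarith
  S_lip := by
    have hk := h.κ_pos
    have hL := h.L_nn
    rintro ⟨_ | i | k, z⟩ y a b
    · simp only [sJ]; rw [← mul_sub, abs_mul, abs_of_pos hκ0]
      exact mul_le_mul_of_nonneg_right (by linarith) (abs_nonneg _)
    · simp only [sJ]; rw [← mul_sub, abs_mul, abs_of_pos hk]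
      exact mul_le_mul_of_nonneg_right (by linarith) (abs_nonneg _)
    · exact (h.S_lip k y a b).trans (mul_le_mul_of_nonneg_right (by linarith) (abs_nonneg _))
  D_lip := by
    have hk := h.κ_pos
    have hL := h.L_nn
    rintro ⟨_ | i | k, z⟩ y a b
    · simp only [dJ, kJ, sub_zero, abs_zero]; positivity
    · refine (h.H_lip i y a b).trans (mul_le_mul_of_nonneg_right ?_ (abs_nonneg _))
      exact mul_le_mul_of_nonneg_left (by linarith) hk.le
    · simp [dJ, kJ]
  D_bd := by
    have hk := h.κ_pos
    have hC := h.C_nn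
    rintro ⟨_ | i | k, z⟩ y r
    · simp only [dJ, kJ, abs_zero]; positivity
    · exact h.H_bd i y r
    · simp [dJ, kJ]
  L_nn := by have := h.κ_pos; have := h.L_nn; linarith
  C_nn := h.C_nn

theorem Lev.reg [Fintype I] (h : Lev qk Sk S1k H κ' C L L1) (hκ0 : 0 < κ0) :
    Reg (qJ qk) (fun ω => sJ κ0 κ' Sk ω.1) (fun ω => s1J S1k ω.1) (fun ω => dJ H ω.1)
      (1 + ∑ k, ‖qk k‖) (L + L1 + κ0 + κ' + κ' * C) where
  q_bd := by
    have hs : 0 ≤ ∑ k, ‖qk k‖ := Finset.sum_nonneg fun k _ => norm_nonneg _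
    rintro ⟨_ | i | k, z⟩
    · simp only [qJ]
      by_cases hz : z ∈ QQ d
      · rw [Set.indicator_of_mem hz]
        have : ‖z‖ ≤ 1 / 2 := by simpa [QQ] using hz
        simp only [id]; linarith
      · rw [Set.indicator_of_notMem hz, norm_zero]; linarith
    · simp only [qJ]; rw [Pi.norm_single]; simp; exact hs
    · have := Finset.single_le_sum (f := fun k => ‖qk k‖) (fun k _ => norm_nonneg _) (Finset.mem_univ k)
      simp only [qJ]; linarith
  Q_nn := by
    have hs : 0 ≤ ∑ k, ‖qk k‖ := Finset.sum_nonneg fun k _ => norm_nonneg _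
    linarith
  L1_nn := by have := h.κ_pos; have := h.L_nn; have := h.L1_nn; have := h.C_nn; positivity
  deriv := by
    rintro ⟨_ | i | k, z⟩ m r
    · exact hasDerivAt_const _ _
    · exact hasDerivAt_const _ _
    · exact h.deriv k m r
  S1c := by
    rintro ⟨_ | i | k, z⟩
    · exact continuous_const
    · exact continuous_const
    · exact h.S1c k
  Sc := fun ω => h.scont ω.1
  Dc := fun ω => h.dcont ω.1
  S1b := by
    have hk := h.κ_pos; have hL := h.L_nn; have hL1 := h.L1_nn; have hC := h.C_nn
    rintro ⟨_ | i | k, z⟩ m r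
    · simp only [s1J, abs_zero]; positivity
    · simp only [s1J, abs_zero]; positivity
    · exact (h.S1b k m r).trans (mul_le_mul_of_nonneg_right (by nlinarith [mul_nonneg hk.le hC]) (abs_nonneg _))
  Sb := by
    have hk := h.κ_pos; have hL := h.L_nn; have hL1 := h.L1_nn; have hC := h.C_nn
    have hkC := mul_nonneg hk.le hC
    intro ω m r
    have h1 := (h.scheme hκ0).S_lip ω m r 0
    rw [(h.scheme hκ0).S_zero, sub_zero, sub_zero] at h1
    exact h1.trans (mul_le_mul_of_nonneg_right (by linarith) (abs_nonneg _))
  Db := by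
    have hk := h.κ_pos; have hL := h.L_nn; have hL1 := h.L1_nn; have hC := h.C_nn
    have hkC := mul_nonneg hk.le hC
    rintro ⟨_ | i | k, z⟩ m r
    · simp only [dJ, abs_zero]; positivity
    · exact (h.H_bd i m r).trans (mul_le_mul_of_nonneg_right (by linarith) (abs_nonneg _))
    · simp only [dJ, abs_zero]; positivity

end LevelJ


open MeasureTheory Filter Topology

section LevelSol

variable {d : ℕ} {I : Type} [Fintype I]

/-- The jump measure. -/
noncomputable def nuJ (d : ℕ) (I : Type) : Measure (JT d I × (Fin d → ℝ)) :=
  (Measure.count : Measure (JT d I)).prod ((volume : Measure (Fin d → ℝ)).restrict (QQ d))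

instance : IsFiniteMeasure (nuJ d I) := by unfold nuJ; infer_instance

theorem nuJ_integral {g : JT d I × (Fin d → ℝ) → ℝ} (hg : Measurable g) {M : ℝ} (hM : ∀ ω, |g ω| ≤ M) :
    ∫ ω, g ω ∂(nuJ d I) = (∫ z in QQ d, g (none, z)) +
      (∑ i, (∫ z in QQ d, g (some (Sum.inl i), z)) + ∑ k, ∫ z in QQ d, g (some (Sum.inr k), z)) := by
  have hi : Integrable g (nuJ d I) :=
    Integrable.of_bound hg.aestronglyMeasurable M (Eventually.of_forall hM)
  unfold nuJ at hi ⊢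
  rw [integral_prod _ hi, integral_count, JT.sum]

theorem nuJ_lint (g : JT d I × (Fin d → ℝ) → ENNReal) (hg : Measurable g) :
    ∫⁻ z in QQ d, g (none, z) ≤ ∫⁻ ω, g ω ∂(nuJ d I) := by
  unfold nuJ
  rw [lintegral_prod _ hg.aemeasurable, lintegral_count]
  exact ENNReal.le_tsum (f := fun j => ∫⁻ z in QQ d, g (j, z)) (none : JT d I)

variable {qk : I → Fin d → ℝ} {Sk S1k : I → (Fin d → ℝ) → ℝ → ℝ} {H : Fin d → (Fin d → ℝ) → ℝ → ℝ}
    {κ' C L L1 κ0 : ℝ}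

theorem JL_int (h : Lev qk Sk S1k H κ' C L L1) (hκ0 : 0 < κ0) (φ : (Fin d → ℝ) → ℝ) (y : Fin d → ℝ) (r : ℝ) :
    ∫ ω, JL (qJ qk) (fun ω => sJ κ0 κ' Sk ω.1) (fun ω => s1J S1k ω.1) (fun ω => dJ H ω.1) φ ω y r ∂(nuJ d I)
    = κ0 * r * (∫ z in QQ d, fderiv ℝ (fderiv ℝ φ) y z z) +
      (∑ i, (κ' * r * fderiv ℝ (fderiv ℝ φ) y (Pi.single i 1) (Pi.single i 1)
          + 2 * (H i y r * fderiv ℝ φ y (Pi.single i 1)))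
       + ∑ k, (Sk k y r * fderiv ℝ (fderiv ℝ φ) y (qk k) (qk k) + S1k k y r * fderiv ℝ φ y (qk k))) := by
  have hr := h.reg hκ0
  have hq : Measurable (qJ qk : JT d I × (Fin d → ℝ) → (Fin d → ℝ)) := qJ_meas
  have m1 : ∀ s : JT d I → ℝ, Measurable (fun ω : JT d I × (Fin d → ℝ) => s ω.1) := fun s =>
    (Measurable.of_discrete (f := s)).comp measurable_fst
  have hB : Continuous (fun z : Fin d → ℝ => fderiv ℝ (fderiv ℝ φ) y z z) := by fun_prop
  have hD : Continuous (fun z : Fin d → ℝ => fderiv ℝ φ y z) := by fun_prop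
  have hm : Measurable (fun ω => JL (qJ qk) (fun ω => sJ κ0 κ' Sk ω.1) (fun ω => s1J S1k ω.1)
      (fun ω => dJ H ω.1) φ ω y r) := by
    unfold JL
    exact (((m1 (fun j => sJ κ0 κ' Sk j y r)).mul (hB.measurable.comp hq)).add
      ((m1 (fun j => s1J S1k j y r)).mul (hD.measurable.comp hq))).add
      (((m1 (fun j => dJ H j y r)).mul (hD.measurable.comp hq)).const_mul 2)
  set Q := 1 + ∑ k, ‖qk k‖
  set Λ := L + L1 + κ0 + κ' + κ' * C
  have hQ := hr.Q_nn
  have hL := hr.L1_nn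
  have hM : ∀ ω, |JL (qJ qk) (fun ω => sJ κ0 κ' Sk ω.1) (fun ω => s1J S1k ω.1)
      (fun ω => dJ H ω.1) φ ω y r| ≤ Λ * |r| * (‖fderiv ℝ (fderiv ℝ φ) y‖ * Q * Q)
        + Λ * |r| * (‖fderiv ℝ φ y‖ * Q) + 2 * (Λ * |r| * (‖fderiv ℝ φ y‖ * Q)) := by
    intro ω
    have b1 : |fderiv ℝ (fderiv ℝ φ) y (qJ qk ω) (qJ qk ω)| ≤ ‖fderiv ℝ (fderiv ℝ φ) y‖ * Q * Q := by
      refine ((fderiv ℝ (fderiv ℝ φ) y).le_opNorm₂ _ _).trans ?_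
      have := hr.q_bd ω
      gcongr
    have b2 : |fderiv ℝ φ y (qJ qk ω)| ≤ ‖fderiv ℝ φ y‖ * Q := by
      refine ((fderiv ℝ φ y).le_opNorm _).trans ?_
      have := hr.q_bd ω
      gcongr
    unfold JL
    refine (abs_add_le _ _).trans (add_le_add ((abs_add_le _ _).trans (add_le_add ?_ ?_)) ?_)
    · rw [abs_mul]
      exact mul_le_mul (hr.Sb ω y r) b1 (abs_nonneg _) (by positivity)
    · rw [abs_mul]
      exact mul_le_mul (hr.S1b ω y r) b2 (abs_nonneg _) (by positivity)
    · rw [abs_mul, abs_mul, abs_two]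
      exact mul_le_mul_of_nonneg_left (mul_le_mul (hr.Db ω y r) b2 (abs_nonneg _) (by positivity)) (by norm_num)
  rw [nuJ_integral hm hM]
  congr 1
  · rw [← integral_const_mul]
    refine setIntegral_congr_fun QQ_meas fun z hz => ?_
    simp [JL, sJ, s1J, dJ, qJ, Set.indicator_of_mem hz]
  · congr 1
    · refine Finset.sum_congr rfl fun i _ => ?_
      simp [JL, sJ, s1J, dJ, qJ, QQ_vol]
    · refine Finset.sum_congr rfl fun k _ => ?_
      simp [JL, sJ, s1J, dJ, qJ, QQ_vol]

theorem levelJ (h : Lev qk Sk S1k H κ' C L L1) (hκ0 : 0 < κ0)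
    {lam : ℝ} (hlam : 0 < lam) {f : (Fin d → ℝ) → ℝ} (hf : Integrable f) {δ : ℕ → ℝ} (hδ : ∀ k, 0 < δ k)
    (hδB : ∀ u : (Fin d → ℝ) → ℝ, Measurable u → Integrable u →
      ∫ x, |u x| ≤ ∫ x, |f x| →
      (∀ δ ψ, GoodPsi δ ψ → ∫ x, u x * ψ (u x) ≤ (∫ x, f x * ψ (u x))
        + (4 * lam * C ^ 2 * (κ0 + d * κ') * ∫ x, |f x|) * δ) →
      Bd (∫ x, |f x|) δ u) :
    ∃ v : (Fin d → ℝ) → ℝ, Bd (∫ x, |f x|) δ v ∧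
      (∀ j : ℕ, Enr v ((1 / 2) ^ j) ≤ ENNReal.ofReal
        (2 * ((∫ x, |f x|) + 4 * lam * C ^ 2 * 4 * (κ0 + d * κ') * ∫ x, |f x|) / (lam * κ0) * ((1 / 2) ^ j) ^ 2)) ∧
      ∀ φ : (Fin d → ℝ) → ℝ, ContDiff ℝ 2 φ → HasCompactSupport φ →
        ∫ x, v x * φ x = (∫ x, f x * φ x) + lam * ∫ y,
      (κ0 * v y * (∫ z in QQ d, fderiv ℝ (fderiv ℝ φ) y z z) +
      (∑ i, (κ' * v y * fderiv ℝ (fderiv ℝ φ) y (Pi.single i 1) (Pi.single i 1)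
          + 2 * (H i y (v y) * fderiv ℝ φ y (Pi.single i 1)))
       + ∑ k, (Sk k y (v y) * fderiv ℝ (fderiv ℝ φ) y (qk k) (qk k) + S1k k y (v y) * fderiv ℝ φ y (qk k)))) := by
  have hs := h.scheme hκ0
  have hKm : ∫ ω, kJ d I κ0 κ' ω.1 ∂(nuJ d I) ≤ κ0 + d * κ' := by
    rw [nuJ_integral hs.κ_meas (M := κ0 + κ')]
    · simp [kJ, QQ_vol]
    · intro ω
      rw [abs_of_nonneg (hs.κ_nn ω)]; exact hs.κ_le ω
  obtain ⟨v, h1, h2, h3⟩ := pass1 (ν := nuJ d I) hs (h.reg hκ0) (by have := h.κ_pos; linarith) hKm hκ0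
    (by
      intro g hg
      refine le_trans ?_ (nuJ_lint (fun ω => ENNReal.ofReal (kJ d I κ0 κ' ω.1) * g (qJ qk ω))
        ((ENNReal.measurable_ofReal.comp hs.κ_meas).mul (hg.comp hs.q_meas)))
      rw [← lintegral_const_mul _ hg]
      refine le_of_eq (setLIntegral_congr_fun QQ_meas fun z hz => ?_)
      simp [kJ, qJ, Set.indicator_of_mem hz]) hlam hf hδ hδB
  refine ⟨v, h1, h2, fun φ hφ hc => ?_⟩
  rw [h3 φ hφ hc]
  simp_rw [JL_int h hκ0]

end LevelSol


open MeasureTheory Filter Topology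

section Prim

variable {d : ℕ}

theorem supC {X : Type*} [NormedAddCommGroup X] {g : (Fin d → ℝ) × ℝ → X} (hg : Continuous g) {R : ℝ}
    (h0 : ∀ m s, R < ‖m‖ → g (m, s) = 0) (N : ℝ) :
    ∃ M, 0 ≤ M ∧ ∀ m s, |s| ≤ N → ‖g (m, s)‖ ≤ M := by
  have hc : IsCompact (Metric.closedBall (0 : Fin d → ℝ) R ×ˢ Metric.closedBall (0 : ℝ) N) :=
    (isCompact_closedBall _ _).prod (isCompact_closedBall _ _)
  obtain ⟨M, hM⟩ := hc.exists_bound_of_continuousOn hg.continuousOn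
  refine ⟨max M 0, le_max_right _ _, fun m s hs => ?_⟩
  by_cases hm : R < ‖m‖
  · rw [h0 m s hm, norm_zero]; exact le_max_right _ _
  · exact (hM (m, s) ⟨by simpa using not_lt.1 hm, by simpa using hs⟩).trans (le_max_left _ _)

theorem fderiv_out {g : (Fin d → ℝ) × ℝ → ℝ} {R : ℝ}
    (h0 : ∀ m s, R < ‖m‖ → g (m, s) = 0) (m : Fin d → ℝ) (s : ℝ) (hm : R < ‖m‖) : fderiv ℝ g (m, s) = 0 := by
  have : g =ᶠ[𝓝 (m, s)] fun _ => 0 := by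
    have ho : IsOpen {p : (Fin d → ℝ) × ℝ | R < ‖p.1‖} := isOpen_lt continuous_const (by fun_prop)
    filter_upwards [ho.mem_nhds (show (m, s) ∈ {p : (Fin d → ℝ) × ℝ | R < ‖p.1‖} from hm)] with p hp
    exact h0 p.1 p.2 hp
  rw [this.fderiv_eq]; simp

theorem lipC {g : (Fin d → ℝ) × ℝ → ℝ} (hg : ContDiff ℝ 1 g) {R : ℝ}
    (h0 : ∀ m s, R < ‖m‖ → g (m, s) = 0) (N : ℝ) :
    ∃ M, 0 ≤ M ∧ ∀ m s t, |s| ≤ N → |t| ≤ N → |g (m, s) - g (m, t)| ≤ M * |s - t| := by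
  obtain ⟨M, hM0, hM⟩ := supC (hg.continuous_fderiv one_ne_zero) (fderiv_out h0) N
  refine ⟨M, hM0, fun m s t hs ht => ?_⟩
  have hcv : Convex ℝ (({m} : Set (Fin d → ℝ)) ×ˢ Metric.closedBall (0 : ℝ) N) :=
    (convex_singleton m).prod (convex_closedBall _ _)
  have := hcv.norm_image_sub_le_of_norm_fderiv_le (f := g) (C := M) (𝕜 := ℝ) (x := (m, t)) (y := (m, s))
    (fun p _ => (hg.differentiable one_ne_zero) p)
    (fun p hp => hM p.1 p.2 (by simpa using hp.2)) ⟨rfl, by simpa using ht⟩ ⟨rfl, by simpa using hs⟩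
  simpa [Prod.norm_def] using this

noncomputable def pr (g : (Fin d → ℝ) × ℝ → ℝ) (m : Fin d → ℝ) (ρ : ℝ) : ℝ := ∫ s in (0:ℝ)..ρ, g (m, s)

noncomputable def pr1 (g : (Fin d → ℝ) × ℝ → ℝ) (v m : Fin d → ℝ) (ρ : ℝ) : ℝ :=
  ∫ s in (0:ℝ)..ρ, fderiv ℝ g (m, s) (v, 0)

theorem pr_cont {g : (Fin d → ℝ) × ℝ → ℝ} (hg : Continuous g) :
    Continuous (fun p : (Fin d → ℝ) × ℝ => pr g p.1 p.2) := by
  unfold pr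
  exact intervalIntegral.continuous_parametric_intervalIntegral_of_continuous (f := fun p : (Fin d → ℝ) × ℝ => fun s => g (p.1, s))
    (by simp only [Function.uncurry_def]; fun_prop) continuous_snd

theorem dg_cont {g : (Fin d → ℝ) × ℝ → ℝ} (hg : ContDiff ℝ 1 g) (v : (Fin d → ℝ) × ℝ) :
    Continuous (fun p : (Fin d → ℝ) × ℝ => fderiv ℝ g p v) :=
  (hg.continuous_fderiv one_ne_zero).clm_apply continuous_const

theorem pr1_eq (g : (Fin d → ℝ) × ℝ → ℝ) (v m : Fin d → ℝ) (ρ : ℝ) :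
    pr1 g v m ρ = pr (fun p => fderiv ℝ g p (v, 0)) m ρ := rfl

theorem pr1_cont {g : (Fin d → ℝ) × ℝ → ℝ} (hg : ContDiff ℝ 1 g) (v : Fin d → ℝ) :
    Continuous (fun p : (Fin d → ℝ) × ℝ => pr1 g v p.1 p.2) := pr_cont (dg_cont hg _)

theorem pr_ii {g : (Fin d → ℝ) × ℝ → ℝ} (hg : Continuous g) (m : Fin d → ℝ) (x y : ℝ) :
    IntervalIntegrable (fun s => g (m, s)) volume x y :=
  (by fun_prop : Continuous fun s => g (m, s)).intervalIntegrable _ _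

theorem pr1_sum {g : (Fin d → ℝ) × ℝ → ℝ} (hg : ContDiff ℝ 1 g) (v m : Fin d → ℝ) (ρ : ℝ) :
    pr1 g v m ρ = ∑ j, v j * pr1 g (Pi.single j 1) m ρ := by
  unfold pr1
  simp_rw [← intervalIntegral.integral_const_mul]
  rw [← intervalIntegral.integral_finsetSum]
  · refine intervalIntegral.integral_congr fun s _ => ?_
    have : (v, (0:ℝ)) = ∑ j, v j • ((Pi.single j 1 : Fin d → ℝ), (0:ℝ)) := by
      ext
      · simp [Prod.fst_sum, Finset.sum_apply, Pi.single_apply]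
      · simp [Prod.snd_sum]
    conv_lhs => rw [this]
    rw [map_sum]
    refine Finset.sum_congr rfl fun j _ => ?_
    rw [map_smul, smul_eq_mul]
  · intro j _
    exact (pr_ii (dg_cont hg (Pi.single j 1, 0)) m 0 ρ).const_mul _

theorem pr_deriv {g : (Fin d → ℝ) × ℝ → ℝ} (hg : ContDiff ℝ 1 g) {R : ℝ}
    (h0 : ∀ m s, R < ‖m‖ → g (m, s) = 0) (v m : Fin d → ℝ) (ρ : ℝ) :
    HasDerivAt (fun t : ℝ => pr g (m + t • v) ρ) (pr1 g v m ρ) 0 := by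
  have hgc := hg.continuous
  obtain ⟨M, hM0, hM⟩ := supC (dg_cont hg (v, 0)) (R := R)
    (fun m s hm => by rw [fderiv_out h0 m s hm]; rfl) |ρ|
  have := (intervalIntegral.hasDerivAt_integral_of_dominated_loc_of_deriv_le (μ := volume) (a := 0) (b := ρ)
    (F := fun t s => g (m + t • v, s)) (F' := fun t s => fderiv ℝ g (m + t • v, s) (v, 0)) (x₀ := (0:ℝ))
    (s := Set.univ) (bound := fun _ => M) univ_mem
    (Eventually.of_forall fun t => (by fun_prop : Continuous fun s => g (m + t • v, s)).aestronglyMeasurable)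
    ((by fun_prop : Continuous fun s => g (m + (0:ℝ) • v, s)).intervalIntegrable _ _)
    (((dg_cont hg (v, 0)).comp (by fun_prop : Continuous fun s : ℝ => (m + (0:ℝ) • v, s))).aestronglyMeasurable)
    (Eventually.of_forall fun s hs t _ => hM _ _ ?_)
    (intervalIntegrable_const) (Eventually.of_forall fun s _ t _ => ?_)).2
  · simpa [pr, pr1] using this
  · rw [Set.mem_uIoc] at hs
    rcases hs with hs | hs
    · rw [abs_of_pos hs.1]; exact hs.2.trans (le_abs_self _)
    · rw [abs_of_nonpos hs.2]; have := neg_abs_le ρ; linarith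
  · have h1 := ((hg.differentiable one_ne_zero) (m + t • v, s)).hasFDerivAt
    have h2 : HasDerivAt (fun t : ℝ => (m + t • v, s)) (v, (0:ℝ)) t := by
      have h3 : HasDerivAt (fun t : ℝ => m + t • v) v t := by
        simpa using ((hasDerivAt_id t).smul_const v).const_add m
      exact h3.prodMk (hasDerivAt_const t s)
    exact h1.comp_hasDerivAt t h2

theorem pr_lip {g : (Fin d → ℝ) × ℝ → ℝ} (hg : Continuous g) {M N : ℝ}
    (hM : ∀ m s, |s| ≤ N → |g (m, s)| ≤ M) (m : Fin d → ℝ) (x y : ℝ) (hx : |x| ≤ N) (hy : |y| ≤ N) :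
    |pr g m x - pr g m y| ≤ M * |x - y| := by
  unfold pr
  rw [intervalIntegral.integral_interval_sub_left (pr_ii hg m _ _) (pr_ii hg m _ _)]
  refine intervalIntegral.norm_integral_le_of_norm_le_const (f := fun s => g (m, s)) fun s hs => hM m s ?_
  rw [abs_le] at *
  rw [Set.mem_uIoc] at hs
  rcases hs with hs | hs <;> constructor <;> linarith [hs.1, hs.2]

theorem pr_mono {g : (Fin d → ℝ) × ℝ → ℝ} (hg : Continuous g) (h0 : ∀ p, 0 ≤ g p) (m : Fin d → ℝ) :
    Monotone (pr g m) := by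
  intro x y hxy
  have : pr g m y - pr g m x = ∫ s in x..y, g (m, s) :=
    intervalIntegral.integral_interval_sub_left (pr_ii hg m _ _) (pr_ii hg m _ _)
  have h2 : 0 ≤ ∫ s in x..y, g (m, s) := intervalIntegral.integral_nonneg hxy fun s _ => h0 _
  linarith

theorem pr_zero (g : (Fin d → ℝ) × ℝ → ℝ) (m : Fin d → ℝ) : pr g m 0 = 0 := by simp [pr]

end Prim


open MeasureTheory Filter Topology

section Kmat

variable {d : ℕ}

theorem bil_expand (B : (Fin d → ℝ) →L[ℝ] (Fin d → ℝ) →L[ℝ] ℝ) (z : Fin d → ℝ) :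
    B z z = ∑ i, ∑ j, z i * z j * B (Pi.single i 1) (Pi.single j 1) := by
  have hz : z = ∑ i, z i • (Pi.single i 1 : Fin d → ℝ) := by
    ext k; simp [Finset.sum_apply, Pi.single_apply]
  conv_lhs => rw [hz]
  simp [map_sum, Finset.mul_sum, mul_assoc]
  rw [Finset.sum_comm]
  refine Finset.sum_congr rfl fun i _ => Finset.sum_congr rfl fun j _ => by ring

theorem lin_expand (B : (Fin d → ℝ) →L[ℝ] ℝ) (z : Fin d → ℝ) :
    B z = ∑ i, z i * B (Pi.single i 1) := by
  have hz : z = ∑ i, z i • (Pi.single i 1 : Fin d → ℝ) := by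
    ext k; simp [Finset.sum_apply, Pi.single_apply]
  conv_lhs => rw [hz]
  simp [map_sum]

theorem QQ_int {g : (Fin d → ℝ) → ℝ} (hg : Continuous g) : IntegrableOn g (QQ d) :=
  hg.continuousOn.integrableOn_compact (isCompact_closedBall _ _)

theorem kmat (hd : 1 ≤ d) {γ : ℝ} (hγ : 0 < γ) : ∃ (κ0 κ' : ℝ) (Km : Fin d → Fin d → ℝ), 0 < κ0 ∧ 0 < κ' ∧
    (∀ i j, Km i j = Km j i) ∧
    (∀ ξ : Fin d → ℝ, ∑ i, ∑ j, Km i j * ξ i * ξ j ≤ γ / 2 * ∑ i, ξ i ^ 2) ∧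
    ∀ B : (Fin d → ℝ) →L[ℝ] (Fin d → ℝ) →L[ℝ] ℝ, κ0 * (∫ z in QQ d, B z z)
      + κ' * ∑ i, B (Pi.single i 1) (Pi.single i 1) = ∑ i, ∑ j, Km i j * B (Pi.single i 1) (Pi.single j 1) := by
  have hd' : (1:ℝ) ≤ d := by exact_mod_cast hd
  have hQ : ∀ i j, IntegrableOn (fun z : Fin d → ℝ => z i * z j) (QQ d) := fun i j => QQ_int (by fun_prop)
  refine ⟨γ / (4 * d), γ / 4, fun i j => γ / (4 * d) * (∫ z in QQ d, z i * z j) + γ / 4 * (if i = j then 1 else 0),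
    by positivity, by positivity, ?_, ?_, ?_⟩
  · intro i j
    simp_rw [mul_comm, eq_comm]
  · intro ξ
    have h1 : ∑ i, ∑ j, (∫ z in QQ d, z i * z j) * ξ i * ξ j = ∫ z in QQ d, (∑ i, z i * ξ i) ^ 2 := by
      simp_rw [← integral_mul_const]
      have : ∀ z : Fin d → ℝ, (∑ i, z i * ξ i) ^ 2 = ∑ i, ∑ j, z i * z j * ξ i * ξ j := by
        intro z
        rw [sq, Finset.sum_mul_sum]
        refine Finset.sum_congr rfl fun i _ => Finset.sum_congr rfl fun j _ => by ring
      simp_rw [this]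
      rw [integral_finsetSum]
      · refine Finset.sum_congr rfl fun i _ => ?_
        rw [integral_finsetSum]
        exact fun j _ => ((hQ i j).mul_const _).mul_const _
      · exact fun i _ => integrable_finsetSum _ fun j _ => ((hQ i j).mul_const _).mul_const _
    have h2 : ∫ z in QQ d, (∑ i, z i * ξ i) ^ 2 ≤ ∫ z in QQ d, (d:ℝ) * ∑ i, ξ i ^ 2 := by
      refine setIntegral_mono_on (QQ_int (by fun_prop)) (QQ_int (by fun_prop)) QQ_meas fun z hz => ?_
      refine (Finset.sum_mul_sq_le_sq_mul_sq _ _ _).trans ?_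
      refine mul_le_mul_of_nonneg_right ?_ (Finset.sum_nonneg fun i _ => sq_nonneg _)
      have : ∀ i, z i ^ 2 ≤ 1 := by
        intro i
        have hz' : ‖z‖ ≤ 1 / 2 := by simpa [QQ] using hz
        have h3 := (norm_le_pi_norm z i).trans hz'
        rw [← sq_abs]
        rw [Real.norm_eq_abs] at h3
        nlinarith [abs_nonneg (z i)]
      calc ∑ i, z i ^ 2 ≤ ∑ i : Fin d, (1:ℝ) := Finset.sum_le_sum fun i _ => this i
        _ = d := by simp
    rw [setIntegral_const] at h2
    simp only [Measure.real, QQ_vol, ENNReal.toReal_one, one_smul] at h2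
    have h3 : ∑ i, ∑ j, (if i = j then (1:ℝ) else 0) * ξ i * ξ j = ∑ i, ξ i ^ 2 := by
      simp [sq]
    have h4 : ∑ i, ∑ j, (γ / (4 * d) * (∫ z in QQ d, z i * z j) + γ / 4 * (if i = j then 1 else 0)) * ξ i * ξ j
        = γ / (4 * d) * ∑ i, ∑ j, (∫ z in QQ d, z i * z j) * ξ i * ξ j
          + γ / 4 * ∑ i, ∑ j, (if i = j then (1:ℝ) else 0) * ξ i * ξ j := by
      simp_rw [Finset.mul_sum, ← Finset.sum_add_distrib]
      refine Finset.sum_congr rfl fun i _ => Finset.sum_congr rfl fun j _ => by ring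
    rw [h4, h3, h1]
    have h5 := mul_le_mul_of_nonneg_left h2 (by positivity : 0 ≤ γ / (4 * d))
    have h6 : γ / (4 * d) * (d * ∑ i, ξ i ^ 2) = γ / 4 * ∑ i, ξ i ^ 2 := by field_simp
    linarith
  · intro B
    have h1 : ∫ z in QQ d, B z z = ∑ i, ∑ j, (∫ z in QQ d, z i * z j) * B (Pi.single i 1) (Pi.single j 1) := by
      simp_rw [bil_expand B, ← integral_mul_const]
      rw [integral_finsetSum]
      · refine Finset.sum_congr rfl fun i _ => ?_
        rw [integral_finsetSum]
        exact fun j _ => ((hQ i j).mul_const _)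
      · exact fun i _ => integrable_finsetSum _ fun j _ => ((hQ i j).mul_const _)
    rw [h1]
    simp_rw [add_mul, Finset.sum_add_distrib, Finset.mul_sum, mul_assoc]
    simp

end Kmat


open MeasureTheory Filter Topology

section LevelN

variable {d : ℕ}

theorem fd_slice {g : (Fin d → ℝ) × ℝ → ℝ} (hg : Differentiable ℝ g) (x v : Fin d → ℝ) (r : ℝ) :
    fderiv ℝ (fun y => g (y, r)) x v = fderiv ℝ g (x, r) (v, 0) := by
  have h2 : HasFDerivAt (fun y : Fin d → ℝ => (y, r)) (ContinuousLinearMap.inl ℝ (Fin d → ℝ) ℝ) x :=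
    hasFDerivAt_prodMk_left x r
  have := ((hg (x, r)).hasFDerivAt.comp x h2).fderiv
  have e : (g ∘ fun y => (y, r)) = fun y => g (y, r) := rfl
  rw [e] at this
  rw [this]; simp

theorem der_slice {g : (Fin d → ℝ) × ℝ → ℝ} (hg : Differentiable ℝ g) (x : Fin d → ℝ) (r : ℝ) :
    HasDerivAt (fun s => g (x, s)) (fderiv ℝ g (x, r) (0, 1)) r :=
  (hg (x, r)).hasFDerivAt.comp_hasDerivAt r ((hasDerivAt_const r x).prodMk (hasDerivAt_id r))

/-- Bounds on the coefficients. -/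
structure Coef (A : Fin d → Fin d → (Fin d → ℝ) × ℝ → ℝ) (bb : Fin d → (Fin d → ℝ) × ℝ → ℝ)
    (Km : Fin d → Fin d → ℝ) (γ Ma M1 Mb MK : ℝ) : Prop where
  A2 : ∀ i j, ContDiff ℝ 2 (A i j)
  Asym : ∀ i j p, A i j p = A j i p
  Ksym : ∀ i j, Km i j = Km j i
  Ab : ∀ i j p, |A i j p| ≤ Ma
  A1b : ∀ i j k p, |fderiv ℝ (A i j) p (Pi.single k 1, 0)| ≤ M1
  Kb : ∀ i j, |Km i j| ≤ MK
  ell : ∀ p (ξ : Fin d → ℝ), γ * ∑ i, ξ i ^ 2 ≤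
    ∑ i, ∑ j, (A i j p + p.2 * fderiv ℝ (A i j) p (0, 1) - Km i j) * ξ i * ξ j
  b1 : ∀ i, ContDiff ℝ 1 (bb i)
  bb_bd : ∀ i p, |bb i p| ≤ Mb
  γ_pos : 0 < γ

/-- Spatial derivative of the truncated flux. -/
noncomputable def DF (A : Fin d → Fin d → (Fin d → ℝ) × ℝ → ℝ) (Km : Fin d → Fin d → ℝ)
    (χ : (Fin d → ℝ) → ℝ) (i : Fin d) (p : (Fin d → ℝ) × ℝ) : ℝ :=
  ∑ j, (fderiv ℝ χ p.1 (Pi.single j 1) * (A i j p - Km i j) + χ p.1 * fderiv ℝ (A i j) p (Pi.single j 1, 0)) * p.2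

noncomputable def hN (A : Fin d → Fin d → (Fin d → ℝ) × ℝ → ℝ) (bb : Fin d → (Fin d → ℝ) × ℝ → ℝ)
    (Km : Fin d → Fin d → ℝ) (χ : (Fin d → ℝ) → ℝ) (i : Fin d) (p : (Fin d → ℝ) × ℝ) : ℝ :=
  2⁻¹ * (χ p.1 * bb i p * p.2 - DF A Km χ i p)

variable {A : Fin d → Fin d → (Fin d → ℝ) × ℝ → ℝ} {bb : Fin d → (Fin d → ℝ) × ℝ → ℝ}
    {Km : Fin d → Fin d → ℝ} {γ Ma M1 Mb MK : ℝ} {χ : (Fin d → ℝ) → ℝ} {R N Mχ : ℝ}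

theorem Coef.fdA (h : Coef A bb Km γ Ma M1 Mb MK) (i j : Fin d) (v : (Fin d → ℝ) × ℝ) :
    ContDiff ℝ 1 (fun p => fderiv ℝ (A i j) p v) :=
  ((h.A2 i j).fderiv_right (m := 1) (by norm_num)).clm_apply contDiff_const

theorem Coef.hN_c1 (h : Coef A bb Km γ Ma M1 Mb MK) (hχ : ContDiff ℝ 2 χ) (i : Fin d) :
    ContDiff ℝ 1 (hN A bb Km χ i) := by
  unfold hN DF
  have hχ1 : ContDiff ℝ 1 χ := hχ.of_le (by norm_num)
  have c1 : ContDiff ℝ 1 (fun p : (Fin d → ℝ) × ℝ => χ p.1) := hχ1.comp contDiff_fst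
  have c2 : ∀ v, ContDiff ℝ 1 (fun p : (Fin d → ℝ) × ℝ => fderiv ℝ χ p.1 v) := fun v =>
    ((hχ.fderiv_right (m := 1) (by norm_num)).clm_apply contDiff_const).comp contDiff_fst
  refine contDiff_const.mul (((c1.mul (h.b1 i)).mul contDiff_snd).sub (ContDiff.sum fun j _ => ?_))
  exact (((c2 _).mul (((h.A2 i j).of_le (by norm_num)).sub contDiff_const)).add (c1.mul (h.fdA i j _))).mul contDiff_snd

theorem chi_out (hχR : ∀ m, R < ‖m‖ → χ m = 0) (m : Fin d → ℝ) (hm : R < ‖m‖) : fderiv ℝ χ m = 0 := by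
  have : χ =ᶠ[𝓝 m] fun _ => 0 := by
    have ho : IsOpen {p : (Fin d → ℝ) | R < ‖p‖} := isOpen_lt continuous_const (by fun_prop)
    filter_upwards [ho.mem_nhds (show m ∈ {p : (Fin d → ℝ) | R < ‖p‖} from hm)] with p hp
    exact hχR p hp
  rw [this.fderiv_eq]; simp

theorem hN_out (hχR : ∀ m, R < ‖m‖ → χ m = 0) (i : Fin d) (m : Fin d → ℝ) (s : ℝ) (hm : R < ‖m‖) :
    hN A bb Km χ i (m, s) = 0 := by
  simp [hN, DF, chi_out hχR m hm, hχR m hm]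

theorem Coef.hN_bd (h : Coef A bb Km γ Ma M1 Mb MK) (hχ0 : ∀ m, 0 ≤ χ m) (hχ1 : ∀ m, χ m ≤ 1)
    (hMχ : ∀ m, ‖fderiv ℝ χ m‖ ≤ Mχ) (i : Fin d) (p : (Fin d → ℝ) × ℝ) :
    |hN A bb Km χ i p| ≤ 2⁻¹ * (Mb + d * (Mχ * (Ma + MK) + M1)) * |p.2| := by
  have hMχ0 : 0 ≤ Mχ := (norm_nonneg _).trans (hMχ 0)
  have hχa : ∀ m, |χ m| ≤ 1 := fun m => by rw [abs_of_nonneg (hχ0 m)]; exact hχ1 m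
  have h1 : |χ p.1 * bb i p * p.2| ≤ Mb * |p.2| := by
    rw [abs_mul, abs_mul]
    have := mul_le_mul (hχa p.1) (h.bb_bd i p) (abs_nonneg _) zero_le_one
    rw [one_mul] at this
    exact mul_le_mul_of_nonneg_right this (abs_nonneg _)
  have h2 : |DF A Km χ i p| ≤ d * (Mχ * (Ma + MK) + M1) * |p.2| := by
    unfold DF
    refine (Finset.abs_sum_le_sum_abs _ _).trans ?_
    have : ∀ j ∈ (Finset.univ : Finset (Fin d)), |(fderiv ℝ χ p.1 (Pi.single j 1) * (A i j p - Km i j)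
        + χ p.1 * fderiv ℝ (A i j) p (Pi.single j 1, 0)) * p.2| ≤ (Mχ * (Ma + MK) + M1) * |p.2| := by
      intro j _
      rw [abs_mul]
      refine mul_le_mul_of_nonneg_right ?_ (abs_nonneg _)
      refine (abs_add_le _ _).trans (add_le_add ?_ ?_)
      · rw [abs_mul]
        refine mul_le_mul ?_ ((abs_sub _ _).trans (add_le_add (h.Ab i j p) (h.Kb i j))) (abs_nonneg _) hMχ0
        have := (fderiv ℝ χ p.1).le_opNorm (Pi.single j 1)
        rw [Pi.norm_single, norm_one, mul_one] at this
        exact this.trans (hMχ _)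
      · rw [abs_mul]
        have := mul_le_mul (hχa p.1) (h.A1b i j j p) (abs_nonneg _) zero_le_one
        rwa [one_mul] at this
    refine (Finset.sum_le_sum this).trans ?_
    simp [mul_assoc]
  unfold hN
  rw [abs_mul, abs_of_pos (by norm_num : (0:ℝ) < 2⁻¹)]
  have := abs_sub (χ p.1 * bb i p * p.2) (DF A Km χ i p)
  nlinarith

end LevelN


open MeasureTheory Filter Topology

section LevelN2

variable {d : ℕ} {A : Fin d → Fin d → (Fin d → ℝ) × ℝ → ℝ} {bb : Fin d → (Fin d → ℝ) × ℝ → ℝ}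
    {Km : Fin d → Fin d → ℝ} {γ Ma M1 Mb MK : ℝ} {χ : (Fin d → ℝ) → ℝ} {R N Mχ : ℝ}

theorem Coef.parts (hd : 1 ≤ d) (h : Coef A bb Km γ Ma M1 Mb MK) (hχ : ContDiff ℝ 2 χ) (hχ0 : ∀ m, 0 ≤ χ m)
    (hχR : ∀ m, R < ‖m‖ → χ m = 0) :
    ∃ (I : Type) (_ : Fintype I) (q : I → Fin d → ℝ) (g : I → (Fin d → ℝ) × ℝ → ℝ),
      (∀ k, ContDiff ℝ 1 (g k)) ∧ (∀ k p, 0 ≤ g k p) ∧ (∀ k m s, R < ‖m‖ → g k (m, s) = 0) ∧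
      (∀ m ρ, |ρ| ≤ N → ∀ i j, ∑ k, pr (g k) m ρ * (q k i * q k j) = χ m * ((A i j (m, ρ) - Km i j) * ρ)) ∧
      (∀ m ρ, |ρ| ≤ N → ∀ i, ∑ k, pr1 (g k) (q k) m ρ * q k i = DF A Km χ i (m, ρ)) := by
  have hχ1 : ContDiff ℝ 1 χ := hχ.of_le (by norm_num)
  have hG : ∀ i j, ContDiff ℝ 1 (fun p : (Fin d → ℝ) × ℝ => A i j p + p.2 * fderiv ℝ (A i j) p (0, 1) - Km i j) :=
    fun i j => (((h.A2 i j).of_le (by norm_num)).add (contDiff_snd.mul (h.fdA i j _))).sub contDiff_const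
  have hAd : ∀ i j, Differentiable ℝ (A i j) := fun i j => (h.A2 i j).differentiable (by norm_num)
  obtain ⟨I, hI, q, w, hw1, hw0, hwG⟩ := decomp hd hG
    (fun i j p => by
      have : A i j = A j i := funext (h.Asym i j)
      rw [this, h.Ksym i j])
    ((isCompact_closedBall (0 : Fin d → ℝ) R).prod (isCompact_closedBall (0 : ℝ) N)) h.γ_pos
    (fun p _ ξ => h.ell p ξ)
  have hg1 : ∀ k, ContDiff ℝ 1 (fun p : (Fin d → ℝ) × ℝ => χ p.1 * w k p) := fun k =>
    (hχ1.comp contDiff_fst).mul (hw1 k)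
  have hgR : ∀ k m s, R < ‖m‖ → (fun p : (Fin d → ℝ) × ℝ => χ p.1 * w k p) (m, s) = 0 := by
    intro k m s hm; simp [hχR m hm]
  have hF : ∀ m ρ, |ρ| ≤ N → ∀ i j, ∑ k, pr (fun p : (Fin d → ℝ) × ℝ => χ p.1 * w k p) m ρ * (q k i * q k j)
      = χ m * ((A i j (m, ρ) - Km i j) * ρ) := by
    intro m ρ hρ i j
    have e1 : ∀ s ∈ Set.uIcc 0 ρ, ∑ k, χ m * w k (m, s) * (q k i * q k j)
        = χ m * (A i j (m, s) + s * fderiv ℝ (A i j) (m, s) (0, 1) - Km i j) := by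
      intro s hs
      by_cases hm : R < ‖m‖
      · simp [hχR m hm]
      have hs' : |s| ≤ N := by
        rw [Set.mem_uIcc] at hs
        rw [abs_le] at *
        rcases hs with hs | hs <;> constructor <;> linarith [hs.1, hs.2]
      rw [← hwG (m, s) ⟨by simpa using not_lt.1 hm, by simpa using hs'⟩ i j, Finset.mul_sum]
      simp_rw [mul_assoc]
    unfold pr
    simp_rw [← intervalIntegral.integral_mul_const]
    rw [← intervalIntegral.integral_finsetSum
      (fun k _ => (pr_ii (hg1 k).continuous m 0 ρ).mul_const _), intervalIntegral.integral_congr e1,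
      intervalIntegral.integral_const_mul]
    congr 1
    rw [intervalIntegral.integral_eq_sub_of_hasDerivAt (f := fun s => (A i j (m, s) - Km i j) * s)]
    · simp
    · intro s _
      have := ((der_slice (hAd i j) m s).sub_const (Km i j)).mul (hasDerivAt_id s)
      refine this.congr_deriv ?_
      simp; ring
    · exact pr_ii (hG i j).continuous m 0 ρ
  have hF1 : ∀ m ρ, |ρ| ≤ N → ∀ i j, ∑ k, pr1 (fun p : (Fin d → ℝ) × ℝ => χ p.1 * w k p) (Pi.single j 1) m ρ * (q k i * q k j)
      = (fderiv ℝ χ m (Pi.single j 1) * (A i j (m, ρ) - Km i j)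
        + χ m * fderiv ℝ (A i j) (m, ρ) (Pi.single j 1, 0)) * ρ := by
    intro m ρ hρ i j
    have d1 : HasDerivAt (fun t : ℝ => ∑ k, pr (fun p : (Fin d → ℝ) × ℝ => χ p.1 * w k p)
        (m + t • Pi.single j 1) ρ * (q k i * q k j))
        (∑ k, pr1 (fun p : (Fin d → ℝ) × ℝ => χ p.1 * w k p) (Pi.single j 1) m ρ * (q k i * q k j)) 0 :=
      HasDerivAt.fun_sum fun k _ => (pr_deriv (hg1 k) (hgR k) _ m ρ).mul_const _
    simp_rw [hF _ ρ hρ i j] at d1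
    have d2 : HasDerivAt (fun t : ℝ => m + t • (Pi.single j 1 : Fin d → ℝ)) (Pi.single j 1) 0 := by
      simpa using ((hasDerivAt_id (0:ℝ)).smul_const (Pi.single j 1 : Fin d → ℝ)).const_add m
    have m0 : m + (0:ℝ) • (Pi.single j 1 : Fin d → ℝ) = m := by simp
    have d3 : HasDerivAt (fun t : ℝ => χ (m + t • (Pi.single j 1 : Fin d → ℝ))) (fderiv ℝ χ m (Pi.single j 1)) 0 := by
      have := (hχ1.differentiable one_ne_zero (m + (0:ℝ) • (Pi.single j 1 : Fin d → ℝ))).hasFDerivAt.comp_hasDerivAt 0 d2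
      rw [m0] at this
      exact this
    have d4 : HasDerivAt (fun t : ℝ => A i j (m + t • (Pi.single j 1 : Fin d → ℝ), ρ))
        (fderiv ℝ (A i j) (m, ρ) (Pi.single j 1, 0)) 0 := by
      have := (hAd i j (m + (0:ℝ) • (Pi.single j 1 : Fin d → ℝ), ρ)).hasFDerivAt.comp_hasDerivAt 0
        (d2.prodMk (hasDerivAt_const 0 ρ))
      rw [m0] at this
      exact this
    have d5 := d3.mul ((d4.sub_const (Km i j)).mul_const ρ)
    have := d1.unique d5
    rw [this, m0]; ring
  refine ⟨I, hI, q, fun k p => χ p.1 * w k p, hg1, fun k p => mul_nonneg (hχ0 _) (hw0 k p), hgR, hF, ?_⟩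
  intro m ρ hρ i
  simp_rw [pr1_sum (hg1 _) (q _), Finset.sum_mul]
  rw [Finset.sum_comm]
  unfold DF
  refine Finset.sum_congr rfl fun j _ => ?_
  rw [← hF1 m ρ hρ i j]
  refine Finset.sum_congr rfl fun k _ => by ring

theorem levN (hd : 1 ≤ d) (h : Coef A bb Km γ Ma M1 Mb MK) (hχ : ContDiff ℝ 2 χ) (hχ0 : ∀ m, 0 ≤ χ m)
    (hχ1 : ∀ m, χ m ≤ 1) (hχR : ∀ m, R < ‖m‖ → χ m = 0) (hMχ : ∀ m, ‖fderiv ℝ χ m‖ ≤ Mχ) (hN0 : 0 ≤ N)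
    {κ0 κ' C : ℝ} (hκ0 : 0 < κ0) (hκ' : 0 < κ') (hC0 : 0 ≤ C)
    (hK : ∀ B : (Fin d → ℝ) →L[ℝ] (Fin d → ℝ) →L[ℝ] ℝ, κ0 * (∫ z in QQ d, B z z)
      + κ' * ∑ i, B (Pi.single i 1) (Pi.single i 1) = ∑ i, ∑ j, Km i j * B (Pi.single i 1) (Pi.single j 1))
    (hC : 2⁻¹ * (Mb + d * (Mχ * (Ma + MK) + M1)) ≤ κ' * C)
    {lam : ℝ} (hlam : 0 < lam) {f : (Fin d → ℝ) → ℝ} (hf : Integrable f) {δ : ℕ → ℝ} (hδ : ∀ k, 0 < δ k)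
    (hδB : ∀ u : (Fin d → ℝ) → ℝ, Measurable u → Integrable u →
      ∫ x, |u x| ≤ ∫ x, |f x| →
      (∀ δ ψ, GoodPsi δ ψ → ∫ x, u x * ψ (u x) ≤ (∫ x, f x * ψ (u x))
        + (4 * lam * C ^ 2 * (κ0 + d * κ') * ∫ x, |f x|) * δ) →
      Bd (∫ x, |f x|) δ u) :
    ∃ v : (Fin d → ℝ) → ℝ, Bd (∫ x, |f x|) δ v ∧
      (∀ j : ℕ, Enr v ((1 / 2) ^ j) ≤ ENNReal.ofReal
        (2 * ((∫ x, |f x|) + 4 * lam * C ^ 2 * 4 * (κ0 + d * κ') * ∫ x, |f x|) / (lam * κ0) * ((1 / 2) ^ j) ^ 2)) ∧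
      ∀ φ : (Fin d → ℝ) → ℝ, ContDiff ℝ 2 φ → HasCompactSupport φ →
        ∫ x, v x * φ x = (∫ x, f x * φ x) + lam * ∫ y,
      ((∑ i, ∑ j, (Km i j * v y + χ y * ((A i j (y, clamp N (v y)) - Km i j) * clamp N (v y)))
          * fderiv ℝ (fderiv ℝ φ) y (Pi.single i 1) (Pi.single j 1))
       + ∑ i, χ y * bb i (y, clamp N (v y)) * clamp N (v y) * fderiv ℝ φ y (Pi.single i 1)) := by
  obtain ⟨I, hI, q, g, hg1, hg0, hgR, hF, hDF⟩ := h.parts (N := N) hd hχ hχ0 hχR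
  have hcl := clamp_abs hN0
  -- constants
  choose Ls hLs0 hLs using fun k => supC (hg1 k).continuous (hgR k) N
  choose L1 hL10 hL1 using fun k => supC (dg_cont (hg1 k) (q k, 0)) (R := R)
    (fun m s hm => by rw [fderiv_out (hgR k) m s hm]; rfl) N
  choose Lh hLh0 hLh using fun i => lipC (h.hN_c1 (bb := bb) hχ i) (fun m s hm => hN_out hχR i m s hm) N
  have sS : ∀ k, Ls k ≤ ∑ k, Ls k := fun k => Finset.single_le_sum (fun k _ => hLs0 k) (Finset.mem_univ k)
  have s1 : ∀ k, L1 k ≤ ∑ k, L1 k := fun k => Finset.single_le_sum (fun k _ => hL10 k) (Finset.mem_univ k)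
  have sh : ∀ i, Lh i ≤ ∑ i, Lh i := fun k => Finset.single_le_sum (fun k _ => hLh0 k) (Finset.mem_univ k)
  have nS : 0 ≤ ∑ k, Ls k := Finset.sum_nonneg fun k _ => hLs0 k
  have n1 : 0 ≤ ∑ k, L1 k := Finset.sum_nonneg fun k _ => hL10 k
  have nh : 0 ≤ ∑ i, Lh i := Finset.sum_nonneg fun k _ => hLh0 k
  have hlev : Lev q (fun k m r => pr (g k) m (clamp N r)) (fun k m r => pr1 (g k) (q k) m (clamp N r))
      (fun i m r => hN A bb Km χ i (m, clamp N r)) κ' C (∑ k, Ls k + (∑ i, Lh i) / κ') (∑ k, L1 k) :=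
    { L_nn := by positivity
      L1_nn := n1
      C_nn := hC0
      κ_pos := hκ'
      Sc := fun k => (pr_cont (hg1 k).continuous).comp
        (continuous_fst.prodMk ((clamp_cont N).comp continuous_snd))
      S1c := fun k => (pr1_cont (hg1 k) (q k)).comp
        (continuous_fst.prodMk ((clamp_cont N).comp continuous_snd))
      Hc := fun i => (h.hN_c1 hχ i).continuous.comp
        (continuous_fst.prodMk ((clamp_cont N).comp continuous_snd))
      S_zero := fun k y => by
        rw [clamp_eq (by simpa using hN0), pr_zero]
      S_mono := fun k y => (pr_mono (hg1 k).continuous (hg0 k) y).comp (clamp_mono N)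
      S_lip := fun k y a b => by
        refine (pr_lip (hg1 k).continuous (hLs k) y _ _ (hcl a) (hcl b)).trans ?_
        refine mul_le_mul ?_ (clamp_lip N a b) (abs_nonneg _) (by positivity)
        have : 0 ≤ (∑ i, Lh i) / κ' := by positivity
        linarith [sS k]
      S1b := fun k y r => by
        have := pr_lip (dg_cont (hg1 k) (q k, 0)) (hL1 k) y (clamp N r) 0 (hcl r) (by simpa using hN0)
        rw [pr_zero, sub_zero, sub_zero] at this
        exact this.trans (mul_le_mul (s1 k) (clamp_abs_le hN0 r) (abs_nonneg _) n1)
      deriv := fun k m r => pr_deriv (hg1 k) (hgR k) (q k) m _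
      H_lip := fun i y a b => by
        refine (hLh i y _ _ (hcl a) (hcl b)).trans ?_
        refine mul_le_mul ?_ (clamp_lip N a b) (abs_nonneg _) (by positivity)
        have e : κ' * (∑ k, Ls k + (∑ i, Lh i) / κ') = κ' * ∑ k, Ls k + ∑ i, Lh i := by field_simp
        rw [e]
        have := mul_nonneg hκ'.le nS
        linarith [sh i]
      H_bd := fun i y r => by
        refine (h.hN_bd hχ0 hχ1 hMχ i _).trans ?_
        exact mul_le_mul hC (clamp_abs_le hN0 r) (abs_nonneg _) (by positivity) }
  obtain ⟨v, h1, h2, h3⟩ := levelJ hlev hκ0 hlam hf hδ hδB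
  refine ⟨v, h1, h2, fun φ hφ hc => ?_⟩
  rw [h3 φ hφ hc]
  congr 3
  funext y
  have hρ := hcl (v y)
  set ρ := clamp N (v y)
  set B := fderiv ℝ (fderiv ℝ φ) y
  set D := fderiv ℝ φ y
  have e1 : ∑ k, (pr (g k) y ρ * B (q k) (q k)) =
      ∑ i, ∑ j, χ y * ((A i j (y, ρ) - Km i j) * ρ) * B (Pi.single i 1) (Pi.single j 1) := by
    simp_rw [← hF y ρ hρ, bil_expand B (q _), Finset.mul_sum, Finset.sum_mul]
    rw [Finset.sum_comm]
    refine Finset.sum_congr rfl fun i _ => ?_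
    rw [Finset.sum_comm]
    refine Finset.sum_congr rfl fun j _ => Finset.sum_congr rfl fun k _ => by ring
  have e2 : ∑ k, (pr1 (g k) (q k) y ρ * D (q k)) = ∑ i, DF A Km χ i (y, ρ) * D (Pi.single i 1) := by
    simp_rw [← hDF y ρ hρ, lin_expand D (q _), Finset.mul_sum, Finset.sum_mul]
    rw [Finset.sum_comm]
    refine Finset.sum_congr rfl fun i _ => Finset.sum_congr rfl fun k _ => by ring
  have e3 : ∑ i, (κ' * v y * B (Pi.single i 1) (Pi.single i 1) + 2 * (hN A bb Km χ i (y, ρ) * D (Pi.single i 1)))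
      = v y * (κ' * ∑ i, B (Pi.single i 1) (Pi.single i 1))
        + ∑ i, χ y * bb i (y, ρ) * ρ * D (Pi.single i 1) - ∑ i, DF A Km χ i (y, ρ) * D (Pi.single i 1) := by
    rw [Finset.mul_sum, Finset.mul_sum, ← Finset.sum_add_distrib, ← Finset.sum_sub_distrib]
    refine Finset.sum_congr rfl fun i _ => ?_
    unfold hN; ring
  have e4 : ∑ i, ∑ j, (Km i j * v y + χ y * ((A i j (y, ρ) - Km i j) * ρ)) * B (Pi.single i 1) (Pi.single j 1)
      = v y * (∑ i, ∑ j, Km i j * B (Pi.single i 1) (Pi.single j 1)) +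
        ∑ i, ∑ j, χ y * ((A i j (y, ρ) - Km i j) * ρ) * B (Pi.single i 1) (Pi.single j 1) := by
    simp_rw [Finset.mul_sum, ← Finset.sum_add_distrib]
    refine Finset.sum_congr rfl fun i _ => Finset.sum_congr rfl fun j _ => by ring
  rw [e3, e4, Finset.sum_add_distrib, e1, e2, ← hK B]
  ring

end LevelN2


open MeasureTheory Filter Topology

section Pass2

variable {d : ℕ} {A : Fin d → Fin d → (Fin d → ℝ) × ℝ → ℝ} {bb : Fin d → (Fin d → ℝ) × ℝ → ℝ}
    {Km : Fin d → Fin d → ℝ} {γ Ma M1 Mb MK : ℝ}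

theorem fd_out {X : Type*} [NormedAddCommGroup X] [NormedSpace ℝ X] {φ : (Fin d → ℝ) → X} {R : ℝ}
    (h0 : ∀ m, R < ‖m‖ → φ m = 0) (m : Fin d → ℝ) (hm : R < ‖m‖) : fderiv ℝ φ m = 0 := by
  have : φ =ᶠ[𝓝 m] fun _ => 0 := by
    have ho : IsOpen {p : (Fin d → ℝ) | R < ‖p‖} := isOpen_lt continuous_const (by fun_prop)
    filter_upwards [ho.mem_nhds (show m ∈ {p : (Fin d → ℝ) | R < ‖p‖} from hm)] with p hp
    exact h0 p hp
  rw [this.fderiv_eq]; simp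

/-- Cutoff functions with uniformly bounded gradient. -/
theorem cutoffs (d : ℕ) : ∃ (χ : ℕ → (Fin d → ℝ) → ℝ) (M : ℝ), 0 ≤ M ∧ ∀ n, ContDiff ℝ 2 (χ n) ∧ (∀ m, 0 ≤ χ n m) ∧
    (∀ m, χ n m ≤ 1) ∧ (∀ m, 2 * ((n:ℝ) + 1) < ‖m‖ → χ n m = 0) ∧ (∀ m, ‖fderiv ℝ (χ n) m‖ ≤ M) ∧
    ∀ m, ‖m‖ ≤ (n:ℝ) + 1 → χ n m = 1 := by
  let c : ContDiffBump (0 : Fin d → ℝ) := ⟨1, 2, one_pos, one_lt_two⟩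
  have hc2 : ContDiff ℝ 2 c := c.contDiff
  obtain ⟨M, hM, -, hM1, -⟩ := test_bds hc2 c.hasCompactSupport
  refine ⟨fun n m => c (((n:ℝ) + 1)⁻¹ • m), M, hM, fun n => ?_⟩
  have hn : (0:ℝ) < (n:ℝ) + 1 := by positivity
  have hn1 : ((n:ℝ) + 1)⁻¹ ≤ 1 := inv_le_one_of_one_le₀ (by linarith [Nat.cast_nonneg (α := ℝ) n])
  have nrm : ∀ m : Fin d → ℝ, ‖((n:ℝ) + 1)⁻¹ • m‖ = ((n:ℝ) + 1)⁻¹ * ‖m‖ := fun m => by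
    rw [norm_smul, Real.norm_eq_abs, abs_of_pos (inv_pos.2 hn)]
  refine ⟨hc2.comp (contDiff_const_smul _), fun m => c.nonneg, fun m => c.le_one, ?_, ?_, ?_⟩
  · intro m hm
    refine c.zero_of_le_dist ?_
    rw [dist_zero_right, nrm]
    show (2:ℝ) ≤ _
    rw [← div_eq_inv_mul, le_div_iff₀ hn]; linarith
  · intro m
    have h1 : HasFDerivAt (fun m : Fin d → ℝ => ((n:ℝ) + 1)⁻¹ • m)
        (((n:ℝ) + 1)⁻¹ • ContinuousLinearMap.id ℝ (Fin d → ℝ)) m :=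
      (((n:ℝ) + 1)⁻¹ • ContinuousLinearMap.id ℝ (Fin d → ℝ)).hasFDerivAt
    have h2 := ((hc2.differentiable (by norm_num)) (((n:ℝ) + 1)⁻¹ • m)).hasFDerivAt.comp m h1
    have h3 : fderiv ℝ (fun m => c (((n:ℝ) + 1)⁻¹ • m)) m = _ := h2.fderiv
    rw [h3]
    refine ContinuousLinearMap.opNorm_le_bound _ hM fun x => ?_
    simp only [ContinuousLinearMap.comp_apply, ContinuousLinearMap.smul_apply, ContinuousLinearMap.id_apply]
    refine (ContinuousLinearMap.le_opNorm _ _).trans ?_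
    refine mul_le_mul (hM1 _) ?_ (norm_nonneg _) hM
    rw [nrm]
    exact mul_le_of_le_one_left (norm_nonneg _) hn1
  · intro m hm
    refine c.one_of_mem_closedBall ?_
    rw [mem_closedBall_zero_iff, nrm]
    show _ ≤ (1:ℝ)
    rw [← div_eq_inv_mul, div_le_iff₀ hn]; linarith

theorem pass2 (hd : 1 ≤ d) (h : Coef A bb Km γ Ma M1 Mb MK)
    {κ0 κ' : ℝ} (hκ0 : 0 < κ0) (hκ' : 0 < κ')
    (hK : ∀ B : (Fin d → ℝ) →L[ℝ] (Fin d → ℝ) →L[ℝ] ℝ, κ0 * (∫ z in QQ d, B z z)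
      + κ' * ∑ i, B (Pi.single i 1) (Pi.single i 1) = ∑ i, ∑ j, Km i j * B (Pi.single i 1) (Pi.single j 1))
    {lam : ℝ} (hlam : 0 < lam) {f : (Fin d → ℝ) → ℝ} (hf : Integrable f) :
    ∃ v : (Fin d → ℝ) → ℝ, Measurable v ∧ Integrable v ∧
      ∀ φ : (Fin d → ℝ) → ℝ, ContDiff ℝ 2 φ → HasCompactSupport φ →
        ∫ x, v x * φ x = (∫ x, f x * φ x) + lam * ∫ y,
      ((∑ i, ∑ j, A i j (y, v y) * v y * fderiv ℝ (fderiv ℝ φ) y (Pi.single i 1) (Pi.single j 1))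
       + ∑ i, bb i (y, v y) * v y * fderiv ℝ φ y (Pi.single i 1)) := by
  obtain ⟨χ, Mχ, hMχ, hχ⟩ := cutoffs d
  have i0 : Fin d := ⟨0, hd⟩
  have hMa : 0 ≤ Ma := (abs_nonneg _).trans (h.Ab i0 i0 0)
  have hMK : 0 ≤ MK := (abs_nonneg _).trans (h.Kb i0 i0)
  have hMb : 0 ≤ Mb := (abs_nonneg _).trans (h.bb_bd i0 0)
  have hM1 : 0 ≤ M1 := (abs_nonneg _).trans (h.A1b i0 i0 i0 0)
  set C : ℝ := 2⁻¹ * (Mb + d * (Mχ * (Ma + MK) + M1)) / κ' with hCd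
  have hC0 : 0 ≤ C := by positivity
  have hC : 2⁻¹ * (Mb + d * (Mχ * (Ma + MK) + M1)) ≤ κ' * C := by
    rw [hCd, mul_div_cancel₀ _ hκ'.ne']
  have hf0 : 0 ≤ ∫ x, |f x| := integral_nonneg fun x => abs_nonneg _
  obtain ⟨δ, hδ, hδB⟩ := bd_of_energy hf (A := 4 * lam * C ^ 2 * (κ0 + d * κ') * ∫ x, |f x|) (by positivity)
  choose u hB hE hu using fun n : ℕ => levN (N := (n:ℝ) + 1) hd h (hχ n).1 (hχ n).2.1 (hχ n).2.2.1 (hχ n).2.2.2.1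
    (hχ n).2.2.2.2.1 (by positivity) hκ0 hκ' hC0 hK hC hlam hf hδ hδB
  obtain ⟨s, hs, v, hv, -, hae, hl⟩ := closure_lemma hf0 hδ hB (fun j => Eventually.of_forall fun n => hE n j)
  refine ⟨v, hv.meas, hv.integrable, fun φ hφ hc => ?_⟩
  obtain ⟨R, hR0, hR⟩ := supp_ball hc
  obtain ⟨M, hM, -, hD, hDD⟩ := test_bds hφ hc
  have hD0 := fd_out hR
  have hDD0 := fd_out hD0
  have sN : ∀ n : ℕ, (n:ℝ) ≤ s n := fun n => by exact_mod_cast hs.le_apply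
  have cB : Continuous (fderiv ℝ (fderiv ℝ φ)) :=
    (hφ.fderiv_right (m := 1) (by norm_num)).continuous_fderiv one_ne_zero
  have cD : Continuous (fderiv ℝ φ) := hφ.continuous_fderiv (by norm_num)
  have bB : ∀ y i j, |fderiv ℝ (fderiv ℝ φ) y (Pi.single i 1) (Pi.single j 1)| ≤ M := by
    intro y i j
    have := (fderiv ℝ (fderiv ℝ φ) y).le_opNorm₂ (Pi.single i 1) (Pi.single j 1)
    rw [Pi.norm_single, Pi.norm_single, norm_one, mul_one, mul_one] at this
    exact this.trans (hDD y)
  have bD : ∀ y i, |fderiv ℝ φ y (Pi.single i 1)| ≤ M := by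
    intro y i
    have := (fderiv ℝ φ y).le_opNorm (Pi.single i 1)
    rw [Pi.norm_single, norm_one, mul_one] at this
    exact this.trans (hD y)
  have t1 := lim_test (fun n => hB (s n)) hv hl hae hφ hc
  have t2 := (gdct (fun n => hB (s n)) hv (hl R)
    (F := fun n y => ((∑ i, ∑ j, (Km i j * u (s n) y + χ (s n) y * ((A i j (y, clamp (((s n : ℕ) : ℝ) + 1) (u (s n) y)) - Km i j)
            * clamp (((s n : ℕ) : ℝ) + 1) (u (s n) y)))
          * fderiv ℝ (fderiv ℝ φ) y (Pi.single i 1) (Pi.single j 1))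
       + ∑ i, χ (s n) y * bb i (y, clamp (((s n : ℕ) : ℝ) + 1) (u (s n) y)) * clamp (((s n : ℕ) : ℝ) + 1) (u (s n) y)
          * fderiv ℝ φ y (Pi.single i 1)))
    (G := fun y => ((∑ i, ∑ j, A i j (y, v y) * v y * fderiv ℝ (fderiv ℝ φ) y (Pi.single i 1) (Pi.single j 1))
       + ∑ i, bb i (y, v y) * v y * fderiv ℝ φ y (Pi.single i 1)))
    (K := d * (d * ((MK + (Ma + MK)) * M)) + d * (Mb * M)) (by positivity) ?_ ?_ ?_ ?_ hae).2
  · have t3 : Tendsto (fun n => ∫ x, u (s n) x * φ x) atTop (𝓝 _) :=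
      ((t2.const_mul lam).const_add (∫ x, f x * φ x)).congr fun n => (hu (s n) φ hφ hc).symm
    exact tendsto_nhds_unique t1 t3
  · intro n
    have mu := (hB (s n)).meas
    have mc : Measurable (fun y => clamp (((s n : ℕ) : ℝ) + 1) (u (s n) y)) := (clamp_cont _).measurable.comp mu
    have mp := measurable_id.prodMk mc
    have mχ := (hχ (s n)).1.continuous.measurable
    have mA : ∀ i j, Measurable (fun y => A i j (y, clamp (((s n : ℕ) : ℝ) + 1) (u (s n) y))) :=
      fun i j => (h.A2 i j).continuous.measurable.comp mp
    have mb : ∀ i, Measurable (fun y => bb i (y, clamp (((s n : ℕ) : ℝ) + 1) (u (s n) y))) :=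
      fun i => (h.b1 i).continuous.measurable.comp mp
    have mB : ∀ i j : Fin d, Measurable (fun y => fderiv ℝ (fderiv ℝ φ) y (Pi.single i 1) (Pi.single j 1)) :=
      fun i j => ((cB.clm_apply continuous_const).clm_apply continuous_const).measurable
    have mD : ∀ i : Fin d, Measurable (fun y => fderiv ℝ φ y (Pi.single i 1)) :=
      fun i => (cD.clm_apply continuous_const).measurable
    refine Measurable.aestronglyMeasurable (Measurable.add ?_ ?_)
    · refine Finset.measurable_fun_sum _ fun i _ => Finset.measurable_fun_sum _ fun j _ => ?_
      exact ((mu.const_mul _).add (mχ.mul (((mA i j).sub_const _).mul mc))).mul (mB i j)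
    · refine Finset.measurable_fun_sum _ fun i _ => ?_
      exact (((mχ.mul (mb i)).mul mc)).mul (mD i)
  · refine Eventually.of_forall fun n y => ?_
    have hcl := clamp_abs_le (M := ((s n : ℕ) : ℝ) + 1) (by positivity) (u (s n) y)
    set ρ := clamp (((s n : ℕ) : ℝ) + 1) (u (s n) y)
    have hχa : |χ (s n) y| ≤ 1 := by
      rw [abs_of_nonneg ((hχ (s n)).2.1 y)]; exact (hχ (s n)).2.2.1 y
    have g1 : ∀ i j, |(Km i j * u (s n) y + χ (s n) y * ((A i j (y, ρ) - Km i j) * ρ))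
          * fderiv ℝ (fderiv ℝ φ) y (Pi.single i 1) (Pi.single j 1)| ≤ (MK + (Ma + MK)) * M * |u (s n) y| := by
      intro i j
      rw [abs_mul]
      have : |Km i j * u (s n) y + χ (s n) y * ((A i j (y, ρ) - Km i j) * ρ)| ≤ (MK + (Ma + MK)) * |u (s n) y| := by
        refine (abs_add_le _ _).trans ?_
        rw [add_mul, abs_mul, abs_mul, abs_mul]
        refine add_le_add (mul_le_mul_of_nonneg_right (h.Kb i j) (abs_nonneg _)) ?_
        have a1 := (abs_sub (A i j (y, ρ)) (Km i j)).trans (add_le_add (h.Ab i j (y, ρ)) (h.Kb i j))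
        have a2 := mul_le_mul a1 hcl (abs_nonneg _) (by positivity)
        have a3 := mul_le_mul hχa a2 (by positivity) zero_le_one
        rwa [one_mul] at a3
      refine (mul_le_mul this (bB y i j) (abs_nonneg _) (by positivity)).trans (le_of_eq (by ring))
    have g2 : ∀ i, |χ (s n) y * bb i (y, ρ) * ρ * fderiv ℝ φ y (Pi.single i 1)| ≤ Mb * M * |u (s n) y| := by
      intro i
      rw [abs_mul, abs_mul, abs_mul]
      have a1 := mul_le_mul hχa (h.bb_bd i (y, ρ)) (abs_nonneg _) zero_le_one
      rw [one_mul] at a1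
      have a2 := mul_le_mul (mul_le_mul a1 hcl (abs_nonneg _) hMb) (bD y i) (abs_nonneg _) (by positivity)
      exact a2.trans (le_of_eq (by ring))
    refine (abs_add_le _ _).trans ?_
    rw [add_mul]
    refine add_le_add ?_ ?_
    · refine (Finset.abs_sum_le_sum_abs _ _).trans ?_
      refine (Finset.sum_le_sum fun i _ => (Finset.abs_sum_le_sum_abs _ _).trans
        (Finset.sum_le_sum fun j _ => g1 i j)).trans (le_of_eq ?_)
      simp; ring
    · refine (Finset.abs_sum_le_sum_abs _ _).trans ?_
      refine (Finset.sum_le_sum fun i _ => g2 i).trans (le_of_eq ?_)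
      simp; ring
  · refine Eventually.of_forall fun n y hy => ?_
    have hy' : R < ‖y‖ := by simpa using hy
    simp [hD0 y hy', hDD0 y hy']
  · filter_upwards [hae] with y hy
    have cont : Continuous (fun r : ℝ => ((∑ i, ∑ j, A i j (y, r) * r * fderiv ℝ (fderiv ℝ φ) y (Pi.single i 1) (Pi.single j 1))
       + ∑ i, bb i (y, r) * r * fderiv ℝ φ y (Pi.single i 1))) := by
      have cA : ∀ i j, Continuous (fun r : ℝ => A i j (y, r)) := fun i j =>
        (h.A2 i j).continuous.comp (by fun_prop)
      have cb : ∀ i, Continuous (fun r : ℝ => bb i (y, r)) := fun i =>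
        (h.b1 i).continuous.comp (by fun_prop)
      refine (continuous_finsetSum _ fun i _ => continuous_finsetSum _ fun j _ => ?_).add
        (continuous_finsetSum _ fun i _ => ?_)
      · exact ((cA i j).mul continuous_id).mul continuous_const
      · exact ((cb i).mul continuous_id).mul continuous_const
    refine ((cont.tendsto (v y)).comp hy).congr' ?_
    have e1 : ∀ᶠ n in atTop, |u (s n) y| < |v y| + 1 := (hy.abs).eventually (gt_mem_nhds (by linarith))
    have e2 : ∀ᶠ n : ℕ in atTop, |v y| + 1 + ‖y‖ ≤ (n:ℝ) := tendsto_natCast_atTop_atTop.eventually_ge_atTop _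
    filter_upwards [e1, e2] with n h1 h2
    have h3 := sN n
    have c1 : clamp (((s n : ℕ) : ℝ) + 1) (u (s n) y) = u (s n) y := clamp_eq (by linarith [norm_nonneg y])
    have c2 : χ (s n) y = 1 := (hχ (s n)).2.2.2.2.2 y (by linarith [abs_nonneg (v y)])
    simp only [Function.comp, c1, c2]
    congr 1
    · refine Finset.sum_congr rfl fun i _ => Finset.sum_congr rfl fun j _ => by ring
    · refine Finset.sum_congr rfl fun i _ => by ring

end Pass2


open MeasureTheory Filter Topology

theorem pd2_eq {d : ℕ} {φ : (Fin d → ℝ) → ℝ} (hφ : ContDiff ℝ 2 φ) (i j : Fin d) (x : Fin d → ℝ) :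
    pd2 i j φ x = fderiv ℝ (fderiv ℝ φ) x (Pi.single i 1) (Pi.single j 1) := by
  unfold pd2
  have hd : DifferentiableAt ℝ (fderiv ℝ φ) x :=
    ((hφ.fderiv_right (m := 1) (by norm_num)).differentiable one_ne_zero) x
  have : pd j φ = fun y => fderiv ℝ φ y (Pi.single j 1) := rfl
  rw [pd, this, fderiv_clm_apply hd (differentiableAt_const _)]
  simp

theorem le_sum_abs {ι : Type*} [Fintype ι] (M : ι → ℝ) (i : ι) : M i ≤ ∑ i, |M i| :=
  (le_abs_self _).trans (Finset.single_le_sum (f := fun i => |M i|) (fun i _ => abs_nonneg _) (Finset.mem_univ i))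

theorem le_sum_abs2 {ι : Type*} [Fintype ι] (M : ι → ι → ℝ) (i j : ι) : M i j ≤ ∑ p : ι × ι, |M p.1 p.2| :=
  le_sum_abs (fun p : ι × ι => M p.1 p.2) (i, j)

theorem statement0 (d : ℕ) (a : Fin d → Fin d → (Fin d → ℝ) → ℝ → ℝ)
    (b : Fin d → (Fin d → ℝ) → ℝ → ℝ) (γ : ℝ)
    (hd : 1 ≤ d)
    (ha_smooth : ∀ i j, ContDiff ℝ 2 (fun p : (Fin d → ℝ) × ℝ => a i j p.1 p.2))
    (ha_bdd : ∀ i j, ∃ M : ℝ, ∀ (x : Fin d → ℝ) (r : ℝ), |a i j x r| ≤ M)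
    (hax_cont : ∀ i j,
      Continuous (fun p : (Fin d → ℝ) × ℝ => fderiv ℝ (fun y => a i j y p.2) p.1))
    (hax_bdd : ∀ i j, ∃ M : ℝ, ∀ (x : Fin d → ℝ) (r : ℝ),
      ‖fderiv ℝ (fun y => a i j y r) x‖ ≤ M)
    (ha_symm : ∀ i j x r, a i j x r = a j i x r)
    (hγ : 0 < γ)
    (hH2 : ∀ (x ξ : Fin d → ℝ) (r : ℝ),
      γ * ∑ i, ξ i ^ 2 ≤ ∑ i, ∑ j, (a i j x r + r * deriv (fun s => a i j x s) r) * ξ i * ξ j)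
    (hb_smooth : ∀ i, ContDiff ℝ 1 (fun p : (Fin d → ℝ) × ℝ => b i p.1 p.2))
    (hb_bdd : ∀ i, ∃ M : ℝ, ∀ (x : Fin d → ℝ) (r : ℝ), |b i x r| ≤ M)
    (hb_zero : ∀ i x, b i x 0 = 0)
    (lam : ℝ) (hlam : 0 < lam)
    (f : (Fin d → ℝ) → ℝ) (hf : Integrable f) :
    ∃ u : (Fin d → ℝ) → ℝ, IsWeakResolventSol a b lam f u := by
  obtain ⟨κ0, κ', Km, hκ0, hκ', hKs, hKq, hK⟩ := kmat hd hγ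
  choose Ma hMa using ha_bdd
  choose M1 hM1 using hax_bdd
  choose Mb hMb using hb_bdd
  have hAd : ∀ i j, Differentiable ℝ (fun p : (Fin d → ℝ) × ℝ => a i j p.1 p.2) := fun i j =>
    (ha_smooth i j).differentiable (by norm_num)
  have hcoef : Coef (fun i j p => a i j p.1 p.2) (fun i p => b i p.1 p.2) Km (γ / 2)
      (∑ p : Fin d × Fin d, |Ma p.1 p.2|) (∑ p : Fin d × Fin d, |M1 p.1 p.2|) (∑ i, |Mb i|)
      (∑ p : Fin d × Fin d, |(|Km p.1 p.2|)|) :=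
    { A2 := ha_smooth
      Asym := fun i j p => ha_symm i j _ _
      Ksym := hKs
      Ab := fun i j p => (hMa i j _ _).trans (le_sum_abs2 Ma i j)
      A1b := fun i j k p => by
        have e := fd_slice (hAd i j) p.1 (Pi.single k 1) p.2
        refine le_trans (le_of_eq (congrArg abs e.symm)) ?_
        have := (fderiv ℝ (fun y => a i j y p.2) p.1).le_opNorm (Pi.single k 1)
        rw [Pi.norm_single, norm_one, mul_one] at this
        exact this.trans ((hM1 i j _ _).trans (le_sum_abs2 M1 i j))
      Kb := fun i j => le_sum_abs2 (fun i j => |Km i j|) i j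
      ell := fun p ξ => by
        have h1 := hH2 p.1 ξ p.2
        have h2 := hKq ξ
        have h3 : ∀ i j, deriv (fun s => a i j p.1 s) p.2
            = fderiv ℝ (fun p : (Fin d → ℝ) × ℝ => a i j p.1 p.2) p (0, 1) := fun i j =>
          (der_slice (hAd i j) p.1 p.2).deriv
        simp_rw [h3] at h1
        have h4 : ∀ X : Fin d → Fin d → ℝ, ∑ i, ∑ j, (X i j - Km i j) * ξ i * ξ j
            = ∑ i, ∑ j, X i j * ξ i * ξ j - ∑ i, ∑ j, Km i j * ξ i * ξ j := by
          intro X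
          simp_rw [sub_mul, Finset.sum_sub_distrib]
        rw [h4]
        linarith
      b1 := hb_smooth
      bb_bd := fun i p => (hMb i _ _).trans (le_sum_abs Mb i)
      γ_pos := by linarith }
  obtain ⟨v, vm, vi, hv⟩ := pass2 hd hcoef hκ0 hκ' hK hlam hf
  refine ⟨v, vi, fun φ hφ hc => ?_⟩
  have hφ2 : ContDiff ℝ 2 φ := contDiff_infty.1 hφ 2
  have e := hv φ hφ2 hc
  obtain ⟨M, hM, -, hD, hDD⟩ := test_bds hφ2 hc
  have cB : Continuous (fderiv ℝ (fderiv ℝ φ)) :=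
    (hφ2.fderiv_right (m := 1) (by norm_num)).continuous_fderiv one_ne_zero
  have cD : Continuous (fderiv ℝ φ) := hφ2.continuous_fderiv (by norm_num)
  have bB : ∀ y i j, |fderiv ℝ (fderiv ℝ φ) y (Pi.single i 1) (Pi.single j 1)| ≤ M := by
    intro y i j
    have := (fderiv ℝ (fderiv ℝ φ) y).le_opNorm₂ (Pi.single i 1) (Pi.single j 1)
    rw [Pi.norm_single, Pi.norm_single, norm_one, mul_one, mul_one] at this
    exact this.trans (hDD y)
  have bD : ∀ y i, |fderiv ℝ φ y (Pi.single i 1)| ≤ M := by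
    intro y i
    have := (fderiv ℝ φ y).le_opNorm (Pi.single i 1)
    rw [Pi.norm_single, norm_one, mul_one] at this
    exact this.trans (hD y)
  have mp := measurable_id.prodMk vm
  have i1 : ∀ i j, Integrable (fun y => a i j y (v y) * v y * fderiv ℝ (fderiv ℝ φ) y (Pi.single i 1) (Pi.single j 1)) := by
    intro i j
    have m1 : Measurable (fun y => a i j y (v y)) := (ha_smooth i j).continuous.measurable.comp mp
    refine (vi.bdd_mul m1.aestronglyMeasurable (Eventually.of_forall fun y => hMa i j y (v y))).mul_bdd
      ((cB.clm_apply continuous_const).clm_apply continuous_const).aestronglyMeasurable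
      (Eventually.of_forall fun y => bB y i j)
  have i2 : ∀ i, Integrable (fun y => b i y (v y) * v y * fderiv ℝ φ y (Pi.single i 1)) := by
    intro i
    have m1 : Measurable (fun y => b i y (v y)) := (hb_smooth i).continuous.measurable.comp mp
    refine (vi.bdd_mul m1.aestronglyMeasurable (Eventually.of_forall fun y => hMb i y (v y))).mul_bdd
      (cD.clm_apply continuous_const).aestronglyMeasurable
      (Eventually.of_forall fun y => bD y i)
  rw [integral_add (integrable_finsetSum _ fun i _ => integrable_finsetSum _ fun j _ => i1 i j)
    (integrable_finsetSum _ fun i _ => i2 i),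
    integral_finsetSum _ (fun i _ => integrable_finsetSum _ fun j _ => i1 i j)] at e
  simp_rw [integral_finsetSum _ (fun j _ => i1 _ j)] at e
  have e3 : ∫ x, v x * ∑ i, b i x (v x) * pd i φ x
      = ∫ y, ∑ i, b i y (v y) * v y * fderiv ℝ φ y (Pi.single i 1) := by
    congr 1
    funext x
    rw [Finset.mul_sum]
    refine Finset.sum_congr rfl fun i _ => ?_
    unfold pd; ring
  simp_rw [pd2_eq hφ2]
  rw [e3, e]
  ring
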